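/- For all 1/2 < θ < β < 1 and every ε > 0 there exists a Beurling generalized number system together with constants A > 0, C > 0, c > 0 and T_0 such that: (i) its zeta function ζ has no zeros in the half-plane Re s > β, and N(β, T) ≥ c T^{(1−β)(1−ε)/(1+β−2θ)} for all T ≥ T_0; (ii) N(σ, T) ≥ c T^{(1+β−2σ)(1−ε)/(1+β−2θ)} for all θ < σ < β and T ≥ T_0; and (iii) N(x) = Ax + O(x^θ exp(C√(log x))). -/

import Mathlib

open Filter Topology

/-- A Beurling generalized prime number system: a nondecreasing sequence of
generalized primes, each `> 1`, tending to infinity. -/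
structure BeurlingSystem where
  p : ℕ → ℝ
  one_lt_p : ∀ k, 1 < p k
  p_mono : Monotone p
  p_tendsto : Filter.Tendsto p Filter.atTop Filter.atTop

namespace BeurlingSystem

variable (S : BeurlingSystem)

/-- The numerical value of a generalized integer, encoded as the finitely supported
vector of exponents of the generalized primes. -/
noncomputable def val (n : ℕ →₀ ℕ) : ℝ := n.prod fun k e => S.p k ^ e

/-- The integer counting function `N(x)`. -/
noncomputable def cnt (x : ℝ) : ℝ := (Set.ncard {n : ℕ →₀ ℕ | S.val n ≤ x} : ℝ)

/-- `χ(x, λ)`: the number of generalized integers within distance `λ` of `x`. -/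
noncomputable def chi (x lam : ℝ) : ℝ := (Set.ncard {n : ℕ →₀ ℕ | |x - S.val n| ≤ lam} : ℝ)

/-- The integers are `θ`-well-behaved with density `A` and implied constant `K₀`:
`N(x) = A x + O(x^θ)`. -/
def WellBehaved (A θ K₀ : ℝ) : Prop :=
  0 < A ∧ 0 ≤ θ ∧ θ < 1 ∧ 0 ≤ K₀ ∧ ∀ x : ℝ, 1 ≤ x → |S.cnt x - A * x| ≤ K₀ * x ^ θ

/-- `ζ` is (the unique) analytic continuation of the Beurling zeta function
to `{Re s > θ} \ {1}`. -/
def IsZeta (θ : ℝ) (ζ : ℂ → ℂ) : Prop :=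
  DifferentiableOn ℂ ζ {s : ℂ | θ < s.re ∧ s ≠ 1} ∧
  ∀ s : ℂ, 1 < s.re → ζ s = ∑' n : ℕ →₀ ℕ, (S.val n : ℂ) ^ (-s)

/-- The von Mangoldt function: `log p` on prime powers `p^m`, `0` otherwise. -/
noncomputable def vonMangoldt (n : ℕ →₀ ℕ) : ℝ :=
  ∑ k ∈ n.support, if n.support = {k} then Real.log (S.p k) else 0

/-- The Chebyshev function `ψ(x)`. -/
noncomputable def psi (x : ℝ) : ℝ :=
  ∑ᶠ n ∈ {n : ℕ →₀ ℕ | S.val n ≤ x}, S.vonMangoldt n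

end BeurlingSystem

/-- The generalized divisor function: the number of ordered pairs of generalized
integers whose formal product equals `n`. -/
noncomputable def gDivisor (n : ℕ →₀ ℕ) : ℝ :=
  (Set.ncard {q : (ℕ →₀ ℕ) × (ℕ →₀ ℕ) | q.1 + q.2 = n} : ℝ)

/-- The generalized Möbius function. -/
noncomputable def gMoebius (n : ℕ →₀ ℕ) : ℝ :=
  if ∀ k ∈ n.support, n k ≤ 1 then (-1 : ℝ) ^ n.support.card else 0

/-- The zero-counting function `N(α, T)` of the (continued) zeta function. -/
noncomputable def zeroCount (ζ : ℂ → ℂ) (α T : ℝ) : ℝ :=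
  (Set.ncard {ρ : ℂ | ζ ρ = 0 ∧ ρ ≠ 1 ∧ α ≤ ρ.re ∧ |ρ.im| ≤ T} : ℝ)

section

open Filter Topology MeasureTheory Complex

/-- Shifting a vertical line of integration, for functions of at most exponential growth in the
imaginary direction. -/
theorem integral_vertical_line_eq {F : ℂ → ℂ} {τ a c C : ℝ} (hτ : τ < a) (hac : a ≤ c)
    (hd : DifferentiableOn ℂ F {s : ℂ | τ < s.re})
    (hb : ∀ s : ℂ, a ≤ s.re → s.re ≤ c → 1 ≤ |s.im| → ‖F s‖ ≤ C * Real.exp (C * |s.im|))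
    (ha : Integrable fun t : ℝ => F (a + t * I)) (hc : Integrable fun t : ℝ => F (c + t * I)) :
    ∫ t : ℝ, F (a + t * I) = ∫ t : ℝ, F (c + t * I) := by
  have hnorm : ∀ (η x t : ℝ), ‖cexp (η * ((x : ℂ) + t * I) ^ 2)‖
      = Real.exp (η * (x ^ 2 - t ^ 2)) := by
    intro η x t
    rw [Complex.norm_exp]
    congr 1
    have : (η : ℂ) * ((x : ℂ) + t * I) ^ 2 = ((η * (x ^ 2 - t ^ 2) : ℝ) : ℂ)
        + ((η * (2 * x * t) : ℝ) : ℂ) * I := by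
      push_cast
      ring_nf
      rw [I_sq]
      ring
    rw [this, add_re, re_ofReal_mul, ofReal_re, I_re, mul_zero, add_zero]
  set B : ℝ := max (a ^ 2) (c ^ 2) with hB
  have hsq : ∀ x, a ≤ x → x ≤ c → x ^ 2 ≤ B := by
    intro x h1 h2
    rcases le_total 0 x with h | h
    · exact le_max_of_le_right (by nlinarith)
    · exact le_max_of_le_left (by nlinarith)
  have hB0 : 0 ≤ B := le_max_of_le_left (sq_nonneg a)
  have hbound : ∀ (η x t : ℝ), 0 ≤ η → η ≤ 1 → a ≤ x → x ≤ c →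
      ‖cexp (η * ((x : ℂ) + t * I) ^ 2)‖ ≤ Real.exp B := by
    intro η x t h0 h1 h2 h3
    rw [hnorm, Real.exp_le_exp]
    have := hsq x h2 h3
    nlinarith [sq_nonneg t, mul_nonneg h0 (sq_nonneg t)]
  have hcont : ∀ (η x : ℝ), Continuous fun t : ℝ => cexp (η * ((x : ℂ) + t * I) ^ 2) := by
    intro η x; fun_prop
  have hint : ∀ (η x : ℝ), 0 ≤ η → η ≤ 1 → a ≤ x → x ≤ c →
      (Integrable fun t : ℝ => F (x + t * I)) →
      Integrable fun t : ℝ => F (x + t * I) * cexp (η * ((x : ℂ) + t * I) ^ 2) := by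
    intro η x h0 h1 h2 h3 hi
    exact hi.mul_bdd (hcont η x).aestronglyMeasurable
      (Eventually.of_forall fun t => hbound η x t h0 h1 h2 h3)
  have key : ∀ η : ℝ, 0 < η → η ≤ 1 →
      ∫ t : ℝ, F (a + t * I) * cexp (η * ((a : ℂ) + t * I) ^ 2)
        = ∫ t : ℝ, F (c + t * I) * cexp (η * ((c : ℂ) + t * I) ^ 2) := by
    intro η hη hη1
    set G : ℂ → ℂ := fun s => F s * cexp (η * s ^ 2) with hG
    have hGd : DifferentiableOn ℂ G {s : ℂ | τ < s.re} := by
      apply hd.mul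
      fun_prop
    have hrect : ∀ T : ℝ, (∫ x : ℝ in a..c, G (x + (-T : ℝ) * I)) - (∫ x : ℝ in a..c, G (x + T * I))
        + I • (∫ y : ℝ in (-T)..T, G (c + y * I)) - I • (∫ y : ℝ in (-T)..T, G (a + y * I)) = 0 := by
      intro T
      have := integral_boundary_rect_eq_zero_of_differentiableOn G (⟨a, -T⟩ : ℂ) (⟨c, T⟩ : ℂ) (by
        apply hGd.mono
        intro s hs
        have h1 := hs.1
        simp only [Set.mem_preimage, Set.uIcc_of_le hac] at h1
        exact lt_of_lt_of_le hτ h1.1)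
      simpa using this
    have hhor : ∀ T : ℝ, 1 ≤ |T| → ‖∫ x : ℝ in a..c, G (x + T * I)‖
        ≤ C * Real.exp B * Real.exp (C * |T| - η * |T| ^ 2) * |c - a| := by
      intro T hT
      apply intervalIntegral.norm_integral_le_of_norm_le_const
      intro x hx
      rw [Set.uIoc_of_le hac] at hx
      have h1 := hb (x + T * I) (by simpa using hx.1.le) (by simpa using hx.2) (by simpa using hT)
      have h2 := hsq x hx.1.le hx.2
      simp only [add_im, ofReal_im, mul_im, ofReal_re, I_im, mul_one, I_re, mul_zero, add_zero,
        zero_add] at h1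
      rw [hG]
      simp only [norm_mul, hnorm]
      calc _ ≤ C * Real.exp (C * |T|) * Real.exp (B - η * |T| ^ 2) := by
            apply mul_le_mul h1 _ (Real.exp_pos _).le ((norm_nonneg _).trans h1)
            rw [Real.exp_le_exp, sq_abs]
            nlinarith [mul_nonneg hη.le (sq_nonneg x)]
        _ = _ := by rw [mul_assoc, mul_assoc, ← Real.exp_add, ← Real.exp_add]; ring_nf
    have hz : Tendsto (fun T : ℝ => C * Real.exp B * Real.exp (C * T - η * T ^ 2) * |c - a|)
        atTop (𝓝 0) := by
      have h1 : Tendsto (fun T : ℝ => C * T - η * T ^ 2) atTop atBot := by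
        have : (fun T : ℝ => C * T - η * T ^ 2) = fun T => T * (C - η * T) := by
          ext T; ring
        rw [this]
        apply Tendsto.atTop_mul_atBot₀ tendsto_id
        simp only [sub_eq_add_neg]
        exact tendsto_atBot_add_const_left atTop C
          (tendsto_neg_atTop_atBot.comp (tendsto_id.const_mul_atTop hη))
      have h2 := Real.tendsto_exp_atBot.comp h1
      simpa using ((h2.const_mul (C * Real.exp B)).mul_const |c - a|)
    have hz1 : Tendsto (fun T : ℝ => ∫ x : ℝ in a..c, G (x + T * I)) atTop (𝓝 0) := by
      apply squeeze_zero_norm' _ hz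
      filter_upwards [eventually_ge_atTop 1] with T hT
      have := hhor T (hT.trans (le_abs_self T))
      rwa [abs_of_nonneg (by linarith : 0 ≤ T)] at this
    have hz2 : Tendsto (fun T : ℝ => ∫ x : ℝ in a..c, G (x + (-T : ℝ) * I)) atTop (𝓝 0) := by
      apply squeeze_zero_norm' _ hz
      filter_upwards [eventually_ge_atTop 1] with T hT
      have := hhor (-T) (by rw [abs_neg]; exact hT.trans (le_abs_self T))
      rwa [abs_neg, abs_of_nonneg (by linarith : 0 ≤ T)] at this
    have hv : ∀ x : ℝ, a ≤ x → x ≤ c → (Integrable fun t : ℝ => F (x + t * I)) →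
        Tendsto (fun T : ℝ => ∫ y : ℝ in (-T)..T, G (x + y * I)) atTop
          (𝓝 (∫ y : ℝ, G (x + y * I))) := by
      intro x h2 h3 hi
      exact intervalIntegral_tendsto_integral (hint η x hη.le hη1 h2 h3 hi)
        tendsto_neg_atTop_atBot tendsto_id
    have hlim := (((hz2.sub hz1).add ((hv c hac le_rfl hc).const_smul I)).sub
      ((hv a le_rfl hac ha).const_smul I))
    have h0 := tendsto_nhds_unique hlim (tendsto_const_nhds.congr fun T => (hrect T).symm)
    simp only [sub_self, zero_add] at h0
    rw [← smul_sub, smul_eq_zero] at h0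
    exact (sub_eq_zero.mp (h0.resolve_left I_ne_zero)).symm
  have hlim : ∀ x : ℝ, a ≤ x → x ≤ c → (Integrable fun t : ℝ => F (x + t * I)) →
      Tendsto (fun η : ℝ => ∫ t : ℝ, F (x + t * I) * cexp (η * ((x : ℂ) + t * I) ^ 2)) (𝓝[>] 0)
        (𝓝 (∫ t : ℝ, F (x + t * I))) := by
    intro x h2 h3 hi
    apply tendsto_integral_filter_of_dominated_convergence
      (fun t : ℝ => ‖F (x + t * I)‖ * Real.exp B)
    · filter_upwards [Ioo_mem_nhdsGT (zero_lt_one (α := ℝ))] with η hη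
      exact (hint η x hη.1.le hη.2.le h2 h3 hi).aestronglyMeasurable
    · filter_upwards [Ioo_mem_nhdsGT (zero_lt_one (α := ℝ))] with η hη
      refine Eventually.of_forall fun t => ?_
      rw [norm_mul]
      exact mul_le_mul_of_nonneg_left (hbound η x t hη.1.le hη.2.le h2 h3) (norm_nonneg _)
    · exact hi.norm.mul_const _
    · refine Eventually.of_forall fun t => ?_
      have : Continuous fun η : ℝ => F (x + t * I) * cexp (η * ((x : ℂ) + t * I) ^ 2) := by
        fun_prop
      have h := (this.tendsto 0).mono_left (nhdsWithin_le_nhds (s := Set.Ioi 0))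
      simpa using h
  refine tendsto_nhds_unique ((hlim a le_rfl hac ha).congr' ?_) (hlim c hac le_rfl hc)
  filter_upwards [Ioo_mem_nhdsGT (zero_lt_one (α := ℝ))] with η hη
  exact key η hη.1 hη.2.le

end

section

open Filter Topology MeasureTheory Complex

theorem integrable_inv_mul_vertical {a c : ℝ} (ha : 0 < a) (hc : 0 < c) :
    Integrable fun t : ℝ => (((c : ℂ) + t * I) * ((c : ℂ) + t * I + a))⁻¹ := by
  have hb : Integrable fun t : ℝ => (max 1 (c⁻¹ ^ 2)) * (1 + t ^ 2)⁻¹ :=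
    integrable_inv_one_add_sq.const_mul _
  refine hb.mono' ?_ (Eventually.of_forall fun t => ?_)
  · apply Continuous.aestronglyMeasurable
    apply Continuous.inv₀ (by fun_prop)
    intro t
    refine mul_ne_zero ?_ ?_ <;> intro h <;> have := congrArg re h <;> simp at this <;> linarith
  · have h1 : ∀ d : ℝ, c ≤ d → √(c ^ 2 + t ^ 2) ≤ ‖(d : ℂ) + t * I‖ := by
      intro d hd
      rw [Complex.norm_add_mul_I]
      apply Real.sqrt_le_sqrt
      nlinarith
    have hp : 0 < c ^ 2 + t ^ 2 := by positivity
    have h2 := h1 c le_rfl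
    have h3 := h1 (c + a) (by linarith)
    have h4 : (c : ℂ) + t * I + a = ((c + a : ℝ) : ℂ) + t * I := by push_cast; ring
    rw [h4, norm_inv, norm_mul]
    have h5 : c ^ 2 + t ^ 2 ≤ ‖(c : ℂ) + t * I‖ * ‖((c + a : ℝ) : ℂ) + t * I‖ := by
      calc c ^ 2 + t ^ 2 = √(c ^ 2 + t ^ 2) * √(c ^ 2 + t ^ 2) := (Real.mul_self_sqrt hp.le).symm
        _ ≤ _ := mul_le_mul h2 h3 (Real.sqrt_nonneg _) (norm_nonneg _)
    calc _ ≤ (c ^ 2 + t ^ 2)⁻¹ := inv_anti₀ hp h5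
      _ ≤ _ := by
        rw [← div_eq_mul_inv, inv_eq_one_div, div_le_div_iff₀ hp (by positivity)]
        have m1 := le_max_left 1 (c⁻¹ ^ 2)
        have m2 := le_max_right 1 (c⁻¹ ^ 2)
        have : c⁻¹ ^ 2 * c ^ 2 = 1 := by field_simp
        nlinarith [sq_nonneg t, mul_le_mul_of_nonneg_right m2 (sq_nonneg c)]

/-- The Perron kernel `y ^ s / (s (s + a))`. -/
theorem perron_kernel {a c y : ℝ} (ha : 0 < a) (hc : 0 < c) (hy : 0 < y) :
    ∫ t : ℝ, (y : ℂ) ^ ((c : ℂ) + t * I) * (((c : ℂ) + t * I) * ((c : ℂ) + t * I + a))⁻¹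
      = ((2 * Real.pi * (max (1 - y ^ (-a)) 0 / a) : ℝ) : ℂ) := by
  set f : ℝ → ℂ := fun u => (Set.Ioc (0 : ℝ) 1).indicator (fun _ => (1 : ℂ)) u
    - (Set.Ioc (0 : ℝ) 1).indicator (fun u : ℝ => (u : ℂ) ^ (a : ℂ)) u with hf
  have hm : ∀ s : ℂ, 0 < s.re → HasMellin f s (a * (s * (s + a))⁻¹) := by
    intro s hs
    have h1 := hasMellin_one_Ioc hs
    have h2 := hasMellin_cpow_Ioc (a : ℂ) (s := s) (by simp; linarith)
    have := (hasMellin_sub h1.1 h2.1).1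
    have hs0 : s ≠ 0 := by rintro rfl; simp at hs
    have hs1 : s + a ≠ 0 := by
      intro h; have := congrArg re h; simp at this; linarith
    refine ⟨this, ?_⟩
    rw [hf, (hasMellin_sub h1.1 h2.1).2, h1.2, h2.2]
    field_simp
    ring
  have hre : ∀ t : ℝ, 0 < ((c : ℂ) + t * I).re := by intro t; simpa
  have hinv := mellinInv_mellin_eq c f (x := y⁻¹) (inv_pos.mpr hy) (hm c (by simpa)).1 (by
      unfold Complex.VerticalIntegrable
      refine ((integrable_inv_mul_vertical ha hc).const_mul (a : ℂ)).congr ?_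
      exact Eventually.of_forall fun t => ((hm _ (hre t)).2).symm) (by
    have hg : Continuous fun u : ℝ => ((max (1 - (max u 0) ^ a) 0 : ℝ) : ℂ) := by
      refine continuous_ofReal.comp ((continuous_const.sub ?_).max continuous_const)
      exact (continuous_id.max continuous_const).rpow_const fun _ => Or.inr ha.le
    refine hg.continuousAt.congr ?_
    filter_upwards [lt_mem_nhds (inv_pos.mpr hy)] with u hu
    simp only [hf, Set.indicator_apply, Set.mem_Ioc, hu, true_and, max_eq_left hu.le]
    split_ifs with h
    · rw [max_eq_left (by simpa using Real.rpow_le_one hu.le h ha.le)]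
      push_cast [Complex.ofReal_cpow hu.le]; rfl
    · rw [max_eq_right (by simpa using Real.one_le_rpow (by linarith) ha.le)]
      simp)
  have hfy : f y⁻¹ = ((max (1 - y ^ (-a)) 0 : ℝ) : ℂ) := by
    have hu := inv_pos.mpr hy
    rw [Real.rpow_neg hy.le, ← Real.inv_rpow hy.le]
    simp only [hf, Set.indicator_apply, Set.mem_Ioc, hu, true_and]
    split_ifs with h
    · rw [max_eq_left (by simpa using Real.rpow_le_one hu.le h ha.le)]
      push_cast [Complex.ofReal_cpow hu.le]; rfl
    · rw [max_eq_right (by simpa using Real.one_le_rpow (by linarith) ha.le)]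
      simp
  rw [hfy, mellinInv] at hinv
  have h3 : ∀ t : ℝ, ((y⁻¹ : ℝ) : ℂ) ^ (-((c : ℂ) + t * I)) • mellin f ((c : ℂ) + t * I)
      = a * ((y : ℂ) ^ ((c : ℂ) + t * I) * (((c : ℂ) + t * I) * ((c : ℂ) + t * I + a))⁻¹) := by
    intro t
    rw [(hm _ (hre t)).2, smul_eq_mul, ofReal_inv, Complex.inv_cpow _ _ (by
      rw [Complex.arg_ofReal_of_nonneg hy.le]; exact Real.pi_pos.ne), Complex.cpow_neg, inv_inv]
    ring
  simp_rw [h3] at hinv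
  rw [integral_const_mul, Complex.real_smul] at hinv
  have hpi : (Real.pi : ℂ) ≠ 0 := by exact_mod_cast Real.pi_ne_zero
  have ha' : (a : ℂ) ≠ 0 := by exact_mod_cast ha.ne'
  generalize (∫ t : ℝ, (y : ℂ) ^ ((c : ℂ) + t * I) * (((c : ℂ) + t * I) * ((c : ℂ) + t * I + a))⁻¹)
    = J at hinv ⊢
  rw [ofReal_mul, ofReal_div, ← hinv]
  push_cast
  field_simp

end

section

open Filter Topology MeasureTheory Complex

section Riesz

variable {ι : Type*} {v : ι → ℝ}

theorem finite_setOf_le_of_summable (hv : ∀ n, 1 ≤ v n) (hs : Summable fun n => v n ^ (-2 : ℝ))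
    (x : ℝ) : {n | v n ≤ x}.Finite := by
  rcases lt_or_ge x 1 with hx | hx
  · convert Set.finite_empty (α := ι)
    ext n
    simpa using hx.trans_le (hv n)
  have h := hs.tendsto_cofinite_zero
  have h2 : ∀ᶠ n in cofinite, v n ^ (-2 : ℝ) < x ^ (-2 : ℝ) :=
    h.eventually (gt_mem_nhds (by positivity))
  refine (Filter.eventually_cofinite.mp h2).subset fun n hn => ?_
  have h0 := hv n
  simp only [Set.mem_ofPred_eq, not_lt] at hn ⊢
  exact Real.rpow_le_rpow_of_nonpos (by linarith) hn (by norm_num)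

theorem tsum_max_eq_sum (hv : ∀ n, 1 ≤ v n) (hs : Summable fun n => v n ^ (-2 : ℝ)) {x y : ℝ}
    (h : y ≤ x) : ∑' n, max (y - v n) 0
      = ∑ n ∈ (finite_setOf_le_of_summable hv hs x).toFinset, max (y - v n) 0 := by
  apply tsum_eq_sum
  intro n hn
  simp only [Set.Finite.mem_toFinset, Set.mem_ofPred_eq, not_le] at hn
  exact max_eq_right (by linarith)

theorem ncard_eq_sum (hv : ∀ n, 1 ≤ v n) (hs : Summable fun n => v n ^ (-2 : ℝ)) {x y : ℝ}
    (h : y ≤ x) : (Set.ncard {n | v n ≤ y} : ℝ)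
      = ∑ n ∈ (finite_setOf_le_of_summable hv hs x).toFinset, if v n ≤ y then (1 : ℝ) else 0 := by
  classical
  rw [Finset.sum_ite, Finset.sum_const_zero, add_zero, Finset.sum_const, nsmul_eq_mul, mul_one,
    Set.ncard_eq_toFinset_card _ (finite_setOf_le_of_summable hv hs y)]
  congr 2
  ext n
  simp only [Set.Finite.mem_toFinset, Set.mem_ofPred_eq, Finset.mem_filter]
  exact ⟨fun h1 => ⟨h1.trans h, h1⟩, fun h1 => h1.2⟩

theorem ncard_mul_le_tsum_max_sub (hv : ∀ n, 1 ≤ v n) (hs : Summable fun n => v n ^ (-2 : ℝ))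
    {x h : ℝ} (hh : 0 ≤ h) :
    (Set.ncard {n | v n ≤ x} : ℝ) * h ≤ ∑' n, max (x + h - v n) 0 - ∑' n, max (x - v n) 0 := by
  rw [tsum_max_eq_sum hv hs (le_refl (x + h)), tsum_max_eq_sum hv hs (by linarith : x ≤ x + h),
    ncard_eq_sum hv hs (by linarith : x ≤ x + h), ← Finset.sum_sub_distrib, Finset.sum_mul]
  refine Finset.sum_le_sum fun n _ => ?_
  split_ifs with h1
  · rw [max_eq_left (by linarith), max_eq_left (by linarith)]; linarith
  · rw [zero_mul, sub_nonneg]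
    exact max_le_max (by linarith) le_rfl

theorem tsum_max_sub_le_ncard_mul (hv : ∀ n, 1 ≤ v n) (hs : Summable fun n => v n ^ (-2 : ℝ))
    {x h : ℝ} (hh : 0 ≤ h) :
    ∑' n, max (x - v n) 0 - ∑' n, max (x - h - v n) 0 ≤ (Set.ncard {n | v n ≤ x} : ℝ) * h := by
  rw [tsum_max_eq_sum hv hs (le_refl x), tsum_max_eq_sum hv hs (by linarith : x - h ≤ x),
    ncard_eq_sum hv hs (le_refl x), ← Finset.sum_sub_distrib, Finset.sum_mul]
  refine Finset.sum_le_sum fun n _ => ?_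
  split_ifs with h1
  · rw [max_eq_left (by linarith)]
    have := le_max_left (x - h - v n) 0
    linarith
  · rw [max_eq_right (by linarith)]
    have := le_max_right (x - h - v n) 0
    linarith

theorem integral_dirichlet_mul_kernel [Countable ι] (hv : ∀ n, 1 ≤ v n)
    (hs : Summable fun n => v n ^ (-2 : ℝ)) {x : ℝ} (hx : 0 < x) :
    ∫ t : ℝ, (∑' n, (v n : ℂ) ^ (-((2 : ℝ) + t * I))) *
        ((x : ℂ) ^ ((2 : ℝ) + t * I + 1) * (((2 : ℝ) + t * I) * ((2 : ℝ) + t * I + 1))⁻¹)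
      = ((2 * Real.pi * ∑' n, max (x - v n) 0 : ℝ) : ℂ) := by
  have hv0 : ∀ n, 0 < v n := fun n => by linarith [hv n]
  have hre : ∀ t : ℝ, (((2 : ℝ) : ℂ) + t * I).re = 2 := by intro t; simp
  have hre1 : ∀ t : ℝ, (((2 : ℝ) : ℂ) + t * I + 1).re = 3 := by intro t; simp; norm_num
  have hker := integrable_inv_mul_vertical (a := 1) (c := 2) one_pos two_pos
  simp only [ofReal_one] at hker
  set F : ι → ℝ → ℂ := fun n t => (v n : ℂ) ^ (-((2 : ℝ) + t * I)) *
        ((x : ℂ) ^ ((2 : ℝ) + t * I + 1) * (((2 : ℝ) + t * I) * ((2 : ℝ) + t * I + 1))⁻¹) with hF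
  have hFn : ∀ n t, ‖F n t‖ = v n ^ (-2 : ℝ) * (x ^ (3 : ℝ) *
      ‖((((2 : ℝ) : ℂ) + t * I) * ((2 : ℝ) + t * I + 1))⁻¹‖) := by
    intro n t
    simp only [hF]
    rw [norm_mul, norm_mul, Complex.norm_cpow_eq_rpow_re_of_pos (hv0 n),
      Complex.norm_cpow_eq_rpow_re_of_pos hx, neg_re, hre, hre1]
  have hFi : ∀ n, Integrable (F n) := by
    intro n
    refine ((hker.norm.const_mul (x ^ (3 : ℝ))).const_mul (v n ^ (-2 : ℝ))).mono' ?_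
      (Eventually.of_forall fun t => (hFn n t).le)
    simp only [hF]
    have hx' : (x : ℂ) ≠ 0 := by exact_mod_cast hx.ne'
    have hv' : (v n : ℂ) ≠ 0 := by exact_mod_cast (hv0 n).ne'
    have h1 : Continuous fun t : ℝ => (v n : ℂ) ^ (-((2 : ℝ) + t * I)) :=
      Continuous.const_cpow (by fun_prop) (Or.inl hv')
    have h2 : Continuous fun t : ℝ => (x : ℂ) ^ ((2 : ℝ) + t * I + 1) :=
      Continuous.const_cpow (by fun_prop) (Or.inl hx')
    exact h1.aestronglyMeasurable.mul (h2.aestronglyMeasurable.mul hker.aestronglyMeasurable)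
  have hsumm : Summable fun n => ∫ t, ‖F n t‖ := by
    simp_rw [hFn, integral_const_mul]
    exact hs.mul_right _
  have hFint : ∀ n, ∫ t, F n t = ((2 * Real.pi * max (x - v n) 0 : ℝ) : ℂ) := by
    intro n
    have h1 := perron_kernel (a := 1) (c := 2) (y := x / v n) one_pos two_pos
      (div_pos hx (hv0 n))
    have h2 : ∀ t : ℝ, F n t = x * (((x / v n : ℝ) : ℂ) ^ (((2 : ℝ) : ℂ) + t * I) *
        ((((2 : ℝ) : ℂ) + t * I) * (((2 : ℝ) : ℂ) + t * I + (1 : ℝ)))⁻¹) := by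
      intro t
      simp only [hF]
      have hx' : (x : ℂ) ≠ 0 := by exact_mod_cast hx.ne'
      rw [div_eq_mul_inv, ofReal_mul, Complex.mul_cpow_ofReal_nonneg hx.le (inv_pos.mpr (hv0 n)).le,
        ofReal_inv, Complex.inv_cpow _ _ (by
          rw [Complex.arg_ofReal_of_nonneg (hv0 n).le]; exact Real.pi_pos.ne), Complex.cpow_neg,
        Complex.cpow_add _ _ hx', Complex.cpow_one, ofReal_one]
      ring
    simp_rw [h2]
    rw [integral_const_mul, h1, ← ofReal_mul]
    congr 1
    rw [Real.rpow_neg_one, inv_div, div_one]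
    rw [mul_comm x, mul_assoc, max_mul_of_nonneg _ _ hx.le, zero_mul]
    congr 3
    field_simp
  have h := hasSum_integral_of_summable_integral_norm hFi hsumm
  have htsum : ∀ t, ∑' n, F n t = (∑' n, (v n : ℂ) ^ (-((2 : ℝ) + t * I))) *
        ((x : ℂ) ^ ((2 : ℝ) + t * I + 1) * (((2 : ℝ) + t * I) * ((2 : ℝ) + t * I + 1))⁻¹) := by
    intro t
    exact tsum_mul_right
  simp_rw [← htsum]
  rw [← h.tsum_eq]
  simp_rw [hFint]
  rw [← ofReal_tsum, tsum_mul_left]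

theorem norm_ofReal_cpow_sub_le {y z : ℝ} {s : ℂ} (hy : 0 < y) (hyz : y ≤ z) (hs : 0 ≤ s.re) :
    ‖(z : ℂ) ^ (s + 1) - (y : ℂ) ^ (s + 1)‖ ≤ ‖s + 1‖ * z ^ s.re * (z - y) := by
  have hs1 : s ≠ -1 := by rintro rfl; simp at hs; linarith
  have hs2 : s + 1 ≠ 0 := fun h => hs1 (eq_neg_of_add_eq_zero_left h)
  have h := (convex_Icc y z).norm_image_sub_le_of_norm_hasDerivWithin_le
    (f := fun u : ℝ => (u : ℂ) ^ (s + 1)) (f' := fun u : ℝ => (s + 1) * (u : ℂ) ^ s)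
    (C := ‖s + 1‖ * z ^ s.re) (fun u hu => ?_) (fun u hu => ?_)
    (Set.left_mem_Icc.mpr hyz) (Set.right_mem_Icc.mpr hyz)
  · rwa [Real.norm_of_nonneg (by linarith)] at h
  · have hu0 : u ≠ 0 := by linarith [hu.1]
    simpa using (hasDerivAt_ofReal_cpow_const hu0 hs2).hasDerivWithinAt
  · have hu0 : 0 < u := by linarith [hu.1]
    rw [norm_mul, Complex.norm_cpow_eq_rpow_re_of_pos hu0]
    gcongr
    exact hu.2

theorem norm_ofReal_cpow_sub_le_interpolated {y z t a δ : ℝ} (hy : 0 < y) (hyz : y ≤ z)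
    (ha : 0 ≤ a) (ha1 : a ≤ 1) (hδ : 0 ≤ δ) (hδ1 : δ ≤ 1) :
    ‖(z : ℂ) ^ ((a : ℂ) + t * I + 1) - (y : ℂ) ^ ((a : ℂ) + t * I + 1)‖
      ≤ 2 * z ^ (a + δ) * (z - y) ^ (1 - δ) * (1 + |t|) ^ (1 - δ) := by
  have hz : 0 < z := by linarith
  have ht := abs_nonneg t
  have hre : ((a : ℂ) + t * I).re = a := by simp
  have hre1 : ((a : ℂ) + t * I + 1).re = a + 1 := by simp
  set w := ‖(z : ℂ) ^ ((a : ℂ) + t * I + 1) - (y : ℂ) ^ ((a : ℂ) + t * I + 1)‖ with hw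
  have h1 : w ≤ 2 * z ^ (a + 1) := by
    refine (norm_sub_le _ _).trans ?_
    rw [Complex.norm_cpow_eq_rpow_re_of_pos hz, Complex.norm_cpow_eq_rpow_re_of_pos hy, hre1]
    have := Real.rpow_le_rpow hy.le hyz (by linarith : 0 ≤ a + 1)
    linarith
  have h2 : w ≤ 2 * (1 + |t|) * z ^ a * (z - y) := by
    refine (norm_ofReal_cpow_sub_le hy hyz (by rw [hre]; exact ha)).trans ?_
    rw [hre]
    have : ‖(a : ℂ) + t * I + 1‖ ≤ 2 * (1 + |t|) := by
      refine (norm_add_le _ _).trans ?_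
      have := norm_add_le (a : ℂ) (t * I)
      simp only [norm_mul, Complex.norm_real, Complex.norm_I, mul_one, norm_one,
        Real.norm_eq_abs, abs_of_nonneg ha] at this ⊢
      linarith
    gcongr
  have hw0 : 0 ≤ w := norm_nonneg _
  rcases hw0.eq_or_lt with h0 | h0
  · rw [← h0]; have : 0 ≤ z - y := by linarith
    positivity
  have hzy : 0 ≤ z - y := by linarith
  calc w = w ^ δ * w ^ (1 - δ) := by rw [← Real.rpow_add h0]; simp
    _ ≤ (2 * z ^ (a + 1)) ^ δ * (2 * (1 + |t|) * z ^ a * (z - y)) ^ (1 - δ) := by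
      gcongr
    _ = _ := by
      rw [Real.mul_rpow (by positivity) (by positivity), Real.mul_rpow (by positivity) hzy,
        Real.mul_rpow (by positivity) (by positivity), Real.mul_rpow (by positivity) (by positivity),
        ← Real.rpow_mul hz.le, ← Real.rpow_mul hz.le]
      have e1 : (2 : ℝ) ^ δ * 2 ^ (1 - δ) = 2 := by rw [← Real.rpow_add two_pos]; simp
      have e2 : z ^ ((a + 1) * δ) * z ^ (a * (1 - δ)) = z ^ (a + δ) := by
        rw [← Real.rpow_add hz]; congr 1; ring
      rw [← e2]
      nth_rewrite 3 [← e1]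
      ring

end Riesz

end

section

open Filter Topology MeasureTheory Complex

section Perron

/-- The quotient of `H s - A s` by `s - 1`, with the singularity removed. -/
noncomputable def polarQuotient (H : ℂ → ℂ) (A : ℝ) : ℂ → ℂ := dslope (fun s => H s - A * s) 1

theorem polarQuotient_of_ne {H : ℂ → ℂ} {A : ℝ} (hA : H 1 = A) {s : ℂ} (hs : s ≠ 1) :
    polarQuotient H A s = (s - 1)⁻¹ * (H s - A * s) := by
  rw [polarQuotient, dslope_of_ne _ hs, slope_def_field, hA]
  rw [mul_one, sub_self, sub_zero, div_eq_inv_mul]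

theorem polarQuotient_differentiableOn {H : ℂ → ℂ} {A τ : ℝ} (hτ : τ < 1)
    (hH : DifferentiableOn ℂ H {s | τ < s.re}) :
    DifferentiableOn ℂ (polarQuotient H A) {s | τ < s.re} := by
  refine (differentiableOn_dslope ?_).mpr (hH.sub (by fun_prop))
  exact (isOpen_lt continuous_const Complex.continuous_re).mem_nhds (by simpa using hτ)

theorem continuous_vertical {H : ℂ → ℂ} {a τ : ℝ} (ha : τ < a)
    (hH : DifferentiableOn ℂ H {s | τ < s.re}) : Continuous fun t : ℝ => H (a + t * I) :=
  hH.continuousOn.comp_continuous (by fun_prop) (fun t => by simpa using ha)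

theorem one_add_abs_le_mul_norm {b : ℝ} (hb : b ≠ 0) (t : ℝ) :
    1 + |t| ≤ (|b|⁻¹ + 1) * ‖(b : ℂ) + t * I‖ := by
  have h1 : |b| ≤ ‖(b : ℂ) + t * I‖ := by simpa using abs_re_le_norm ((b : ℂ) + t * I)
  have h2 : |t| ≤ ‖(b : ℂ) + t * I‖ := by simpa using abs_im_le_norm ((b : ℂ) + t * I)
  have h3 : 0 < |b| := abs_pos.mpr hb
  have : 1 ≤ |b|⁻¹ * ‖(b : ℂ) + t * I‖ := by
    rw [← div_eq_inv_mul, le_div_iff₀ h3]; linarith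
  linarith

theorem integrable_polarQuotient {H : ℂ → ℂ} {τ a δ A : ℝ} (hτ : 0 < τ) (hτa : τ < a) (ha : a < 1)
    (hδ : 0 < δ) (hH : DifferentiableOn ℂ H {s | τ < s.re}) (hA : H 1 = A)
    (hint : Integrable fun t : ℝ => ‖H (a + t * I)‖ * (1 + |t|) ^ (-2 - δ)) :
    Integrable fun t : ℝ => ‖polarQuotient H A (a + t * I) *
      (((a : ℂ) + t * I) * ((a : ℂ) + t * I + 1))⁻¹‖ * (1 + |t|) ^ (1 - δ) := by
  have hD := continuous_vertical hτa (polarQuotient_differentiableOn (A := A) (hτa.trans ha) hH)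
  have hpow : Integrable fun t : ℝ => (1 + |t|) ^ (-(1 + δ)) := by
    simpa using integrable_one_add_norm (E := ℝ) (μ := volume) (r := 1 + δ) (by simpa using hδ)
  set M : ℝ := (|a - 1|⁻¹ + 1) * ((|a|⁻¹ + 1) * (|a + 1|⁻¹ + 1)) with hM
  refine ((hint.add (hpow.const_mul |A|)).const_mul M).mono' ?_ (Eventually.of_forall fun t => ?_)
  · refine Continuous.aestronglyMeasurable ?_
    refine Continuous.mul (hD.mul (Continuous.inv₀ (by fun_prop) ?_)).norm ?_
    · intro t
      refine mul_ne_zero ?_ ?_ <;> intro h <;> have := congrArg re h <;> simp at this <;> linarith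
    · exact Continuous.rpow_const (by fun_prop) fun t => Or.inl (by positivity)
  · have ht := abs_nonneg t
    have hne : (a : ℂ) + t * I ≠ 1 := by
      intro h; have := congrArg re h; simp at this; linarith
    have e1 : (a : ℂ) + t * I - 1 = ((a - 1 : ℝ) : ℂ) + t * I := by push_cast; ring
    have e2 : (a : ℂ) + t * I + 1 = ((a + 1 : ℝ) : ℂ) + t * I := by push_cast; ring
    have b1 := one_add_abs_le_mul_norm (b := a - 1) (by linarith) t
    have b2 := one_add_abs_le_mul_norm (b := a) (by linarith) t
    have b3 := one_add_abs_le_mul_norm (b := a + 1) (by linarith) t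
    have hna : ‖(a : ℂ) + t * I‖ ≤ 1 + |t| := by
      have := norm_add_le (a : ℂ) (t * I)
      simp only [norm_mul, Complex.norm_real, Complex.norm_I, mul_one,
        Real.norm_eq_abs, abs_of_pos (hτ.trans hτa)] at this
      linarith
    rw [polarQuotient_of_ne hA hne, e1, e2]
    simp only [norm_mul, norm_inv, norm_norm, Pi.add_apply]
    rw [Real.norm_of_nonneg (by positivity : 0 ≤ (1 + |t|) ^ (1 - δ))]
    have hnum : ‖H (a + t * I) - A * (a + t * I)‖ ≤ ‖H (a + t * I)‖ + |A| * (1 + |t|) := by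
      refine (norm_sub_le _ _).trans ?_
      rw [norm_mul, Complex.norm_real, Real.norm_eq_abs]
      gcongr
    have hinv : ∀ b : ℝ, b ≠ 0 → ‖(b : ℂ) + t * I‖⁻¹ ≤ (|b|⁻¹ + 1) * (1 + |t|)⁻¹ := by
      intro b hb
      have hb1 := one_add_abs_le_mul_norm hb t
      have hpos : 0 < ‖(b : ℂ) + t * I‖ := by
        by_contra hcon
        have : ‖(b : ℂ) + t * I‖ = 0 := le_antisymm (not_lt.mp hcon) (norm_nonneg _)
        rw [this] at hb1; linarith
      rw [← div_eq_mul_inv, le_div_iff₀ (by positivity), ← div_eq_inv_mul, div_le_iff₀ hpos]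
      exact hb1
    have hexp1 : (1 + |t|) ^ (-2 - δ) = (1 + |t|)⁻¹ * ((1 + |t|)⁻¹ * (1 + |t|)⁻¹) * (1 + |t|) ^ (1 - δ) := by
      have h0 : 0 < 1 + |t| := by linarith
      rw [← Real.rpow_neg_one, ← Real.rpow_add h0, ← Real.rpow_add h0, ← Real.rpow_add h0]
      congr 1; ring
    have hexp2 : (1 + |t|) ^ (-(1 + δ)) = (1 + |t|) * ((1 + |t|)⁻¹ * ((1 + |t|)⁻¹ * (1 + |t|)⁻¹) * (1 + |t|) ^ (1 - δ)) := by
      rw [← hexp1, ← Real.rpow_one_add' (by linarith) (by linarith)]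
      congr 1; ring
    rw [hexp2, hexp1]
    calc _ ≤ ((|a - 1|⁻¹ + 1) * (1 + |t|)⁻¹) * (‖H (a + t * I)‖ + |A| * (1 + |t|)) *
          (((|a|⁻¹ + 1) * (1 + |t|)⁻¹) * ((|a + 1|⁻¹ + 1) * (1 + |t|)⁻¹)) * (1 + |t|) ^ (1 - δ) := by
          have := hinv _ (by linarith : a - 1 ≠ 0)
          have := hinv _ (by linarith : a ≠ 0)
          have := hinv _ (by linarith : a + 1 ≠ 0)
          rw [mul_inv]
          gcongr
      _ = _ := by rw [hM]; ring

/-- The first Riesz mean of the counting function, minus its main term, as a contour integral. -/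
theorem riesz_mean_eq_integral {ι : Type*} [Countable ι] {v : ι → ℝ} (hv : ∀ n, 1 ≤ v n)
    (hs : Summable fun n => v n ^ (-2 : ℝ)) {H : ℂ → ℂ} {τ a δ A C : ℝ} (hτ : 0 < τ) (hτa : τ < a)
    (ha : a < 1) (hδ : 0 < δ) (hδ1 : δ < 1) (hH : DifferentiableOn ℂ H {s | τ < s.re})
    (hA : H 1 = A)
    (hζ : ∀ s : ℂ, s.re = 2 → H s = (s - 1) * ∑' n, (v n : ℂ) ^ (-s))
    (hb : ∀ s : ℂ, a ≤ s.re → s.re ≤ 2 → ‖H s‖ ≤ C * Real.exp (C * |s.im|))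
    (hint : Integrable fun t : ℝ => ‖H (a + t * I)‖ * (1 + |t|) ^ (-2 - δ)) {x : ℝ} (hx : 1 ≤ x) :
    (Integrable fun t : ℝ => polarQuotient H A (a + t * I) *
      ((x : ℂ) ^ ((a : ℂ) + t * I + 1) * (((a : ℂ) + t * I) * ((a : ℂ) + t * I + 1))⁻¹)) ∧
    ((2 * Real.pi * (∑' n, max (x - v n) 0 - A * ((x ^ 2 - 1) / 2)) : ℝ) : ℂ)
      = ∫ t : ℝ, polarQuotient H A (a + t * I) *
      ((x : ℂ) ^ ((a : ℂ) + t * I + 1) * (((a : ℂ) + t * I) * ((a : ℂ) + t * I + 1))⁻¹) := by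
  have hx0 : 0 < x := by linarith
  have hx' : (x : ℂ) ≠ 0 := by exact_mod_cast hx0.ne'
  have hv0 : ∀ n, 0 < v n := fun n => by linarith [hv n]
  set F : ℂ → ℂ := fun s => polarQuotient H A s * ((x : ℂ) ^ (s + 1) * (s * (s + 1))⁻¹) with hF
  have hDd := polarQuotient_differentiableOn (A := A) (hτa.trans ha) hH
  have hFd : DifferentiableOn ℂ F {s | τ < s.re} := by
    refine hDd.mul (DifferentiableOn.mul ?_ (DifferentiableOn.inv (by fun_prop) ?_))
    · exact fun s _ => (DifferentiableAt.const_cpow (by fun_prop)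
        (Or.inl hx')).differentiableWithinAt
    · intro s hs
      simp only [Set.mem_ofPred_eq] at hs
      refine mul_ne_zero ?_ ?_ <;> intro h <;> have := congrArg re h <;> simp at this <;> linarith
  have hFa : Integrable fun t : ℝ => F (a + t * I) := by
    refine ((integrable_polarQuotient hτ hτa ha hδ hH hA hint).const_mul (x ^ (a + 1))).mono'
      (continuous_vertical hτa hFd).aestronglyMeasurable (Eventually.of_forall fun t => ?_)
    have h1 : ‖(x : ℂ) ^ ((a : ℂ) + t * I + 1)‖ = x ^ (a + 1) := by
      rw [Complex.norm_cpow_eq_rpow_re_of_pos hx0]; simp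
    have h2 : (1 : ℝ) ≤ (1 + |t|) ^ (1 - δ) :=
      Real.one_le_rpow (by linarith [abs_nonneg t]) (by linarith)
    simp only [hF]
    rw [norm_mul, norm_mul, h1, norm_mul]
    have h3 := norm_nonneg (polarQuotient H A (a + t * I))
    have h4 := norm_nonneg ((((a : ℂ) + t * I) * ((a : ℂ) + t * I + 1))⁻¹)
    have h5 : 0 ≤ x ^ (a + 1) := by positivity
    calc _ = x ^ (a + 1) * (‖polarQuotient H A (a + t * I)‖ *
          ‖(((a : ℂ) + t * I) * ((a : ℂ) + t * I + 1))⁻¹‖ * 1) := by ring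
      _ ≤ _ := by gcongr
  refine ⟨hFa, ?_⟩
  have hbF : ∀ s : ℂ, a ≤ s.re → s.re ≤ 2 → 1 ≤ |s.im| →
      ‖F s‖ ≤ ((|C| + 2 * |A|) * x ^ (3 : ℝ) + |C| + 1) *
        Real.exp (((|C| + 2 * |A|) * x ^ (3 : ℝ) + |C| + 1) * |s.im|) := by
    intro s h1 h2 h3
    have hne : s ≠ 1 := by rintro rfl; simp at h3; linarith
    have h4 : 1 ≤ ‖s - 1‖ := h3.trans (by simpa using abs_im_le_norm (s - 1))
    have h5 : 1 ≤ ‖s‖ := h3.trans (by simpa using abs_im_le_norm s)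
    have h6 : 1 ≤ ‖s + 1‖ := h3.trans (by simpa using abs_im_le_norm (s + 1))
    simp only [hF]
    rw [polarQuotient_of_ne hA hne, norm_mul, norm_mul, norm_mul, norm_inv, norm_inv, norm_mul,
      Complex.norm_cpow_eq_rpow_re_of_pos hx0]
    have h7 : ‖s‖ ≤ 2 + |s.im| := by
      refine (norm_le_abs_re_add_abs_im s).trans ?_
      rw [abs_of_nonneg (by linarith : 0 ≤ s.re)]; linarith
    have h8 : 2 + |s.im| ≤ 2 * Real.exp |s.im| := by
      linarith [Real.add_one_le_exp |s.im|]
    have h9 : ‖H s - A * s‖ ≤ (|C| + 2 * |A|) * Real.exp ((|C| + 1) * |s.im|) := by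
      refine (norm_sub_le _ _).trans ?_
      rw [norm_mul, Complex.norm_real, Real.norm_eq_abs, add_mul]
      refine add_le_add ((hb s h1 h2).trans ?_) ?_
      · have : C ≤ |C| := le_abs_self C
        have : C * |s.im| ≤ (|C| + 1) * |s.im| := by nlinarith
        gcongr
      · have : Real.exp |s.im| ≤ Real.exp ((|C| + 1) * |s.im|) := by
          gcongr; nlinarith [abs_nonneg C, abs_nonneg s.im]
        nlinarith [abs_nonneg A]
    have h10 : x ^ (s + 1).re ≤ x ^ (3 : ℝ) := by
      apply Real.rpow_le_rpow_of_exponent_le hx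
      simp; linarith
    have h11 : ‖s - 1‖⁻¹ ≤ 1 := inv_le_one_of_one_le₀ h4
    have h12 : (‖s‖ * ‖s + 1‖)⁻¹ ≤ 1 := inv_le_one_of_one_le₀ (by nlinarith)
    have hx3 : 0 ≤ x ^ (3 : ℝ) := by positivity
    calc _ ≤ 1 * ((|C| + 2 * |A|) * Real.exp ((|C| + 1) * |s.im|)) * (x ^ (3 : ℝ) * 1) := by
          gcongr
      _ = ((|C| + 2 * |A|) * x ^ (3 : ℝ)) * Real.exp ((|C| + 1) * |s.im|) := by ring
      _ ≤ _ := by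
        have : 0 ≤ (|C| + 2 * |A|) * x ^ (3 : ℝ) := by positivity
        gcongr
        · linarith [abs_nonneg C]
        · linarith [abs_nonneg C]
  -- the line `Re s = 2`
  have hker := integrable_inv_mul_vertical (a := 1) (c := 2) one_pos two_pos
  have hker2 := integrable_inv_mul_vertical (a := 2) (c := 1) two_pos one_pos
  simp only [ofReal_one] at hker hker2
  have hne2 : ∀ t : ℝ, ((2 : ℝ) : ℂ) + t * I ≠ 1 := by
    intro t h; have := congrArg re h; simp at this
  have hxn : ∀ t : ℝ, ‖(x : ℂ) ^ (((2 : ℝ) : ℂ) + t * I + 1)‖ = x ^ (3 : ℝ) := by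
    intro t; rw [Complex.norm_cpow_eq_rpow_re_of_pos hx0]; simp; norm_num
  have hH2 : ∀ t : ℝ, ∑' n, (v n : ℂ) ^ (-(((2 : ℝ) : ℂ) + t * I))
      = (((2 : ℝ) : ℂ) + t * I - 1)⁻¹ * H ((2 : ℝ) + t * I) := by
    intro t
    rw [hζ _ (by simp), inv_mul_cancel_left₀ (sub_ne_zero.mpr (hne2 t))]
  have hcx : Continuous fun t : ℝ => (x : ℂ) ^ (((2 : ℝ) : ℂ) + t * I + 1) :=
    Continuous.const_cpow (by fun_prop) (Or.inl hx')
  have i1 : Integrable fun t : ℝ => (∑' n, (v n : ℂ) ^ (-(((2 : ℝ) : ℂ) + t * I))) *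
        ((x : ℂ) ^ (((2 : ℝ) : ℂ) + t * I + 1) *
          ((((2 : ℝ) : ℂ) + t * I) * ((2 : ℝ) + t * I + 1))⁻¹) := by
    refine ((hker.norm.const_mul (x ^ (3 : ℝ))).const_mul (∑' n, v n ^ (-2 : ℝ))).mono' ?_
      (Eventually.of_forall fun t => ?_)
    · refine AEStronglyMeasurable.mul ?_ (hcx.aestronglyMeasurable.mul hker.aestronglyMeasurable)
      simp_rw [hH2]
      refine Continuous.aestronglyMeasurable (Continuous.mul (Continuous.inv₀ (by fun_prop) ?_) ?_)
      · intro t; exact sub_ne_zero.mpr (hne2 t)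
      · exact continuous_vertical (by linarith) hH
    · have hn : ∀ n, ‖(v n : ℂ) ^ (-(((2 : ℝ) : ℂ) + t * I))‖ = v n ^ (-2 : ℝ) := by
        intro n; rw [Complex.norm_cpow_eq_rpow_re_of_pos (hv0 n)]; simp
      rw [norm_mul, norm_mul, hxn]
      refine mul_le_mul_of_nonneg_right ?_ (by positivity)
      simp_rw [← hn]
      exact norm_tsum_le_tsum_norm (by simp_rw [hn]; exact hs)
  have i2 : Integrable fun t : ℝ => (x : ℂ) ^ 2 * ((x : ℂ) ^ (((1 : ℝ) : ℂ) + t * I) *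
      ((((1 : ℝ) : ℂ) + t * I) * (((1 : ℝ) : ℂ) + t * I + ((2 : ℝ) : ℂ)))⁻¹) := by
    refine ((hker2.norm.const_mul x).const_mul (x ^ 2)).mono' ?_ (Eventually.of_forall fun t => ?_)
    · have : Continuous fun t : ℝ => (x : ℂ) ^ (((1 : ℝ) : ℂ) + t * I) :=
        Continuous.const_cpow (by fun_prop) (Or.inl hx')
      refine (this.aestronglyMeasurable.mul ?_).const_mul _
      simpa using hker2.aestronglyMeasurable
    · rw [norm_mul, norm_mul, Complex.norm_cpow_eq_rpow_re_of_pos hx0]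
      simp [abs_of_pos hx0]
  have e1 : ∀ t : ℝ, F (((2 : ℝ) : ℂ) + t * I)
      = (∑' n, (v n : ℂ) ^ (-(((2 : ℝ) : ℂ) + t * I))) *
        ((x : ℂ) ^ (((2 : ℝ) : ℂ) + t * I + 1) *
          ((((2 : ℝ) : ℂ) + t * I) * ((2 : ℝ) + t * I + 1))⁻¹)
        - A * ((x : ℂ) ^ 2 * ((x : ℂ) ^ (((1 : ℝ) : ℂ) + t * I) *
      ((((1 : ℝ) : ℂ) + t * I) * (((1 : ℝ) : ℂ) + t * I + ((2 : ℝ) : ℂ)))⁻¹)) := by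
    intro t
    rw [hH2]
    simp only [hF]
    rw [polarQuotient_of_ne hA (hne2 t)]
    have e2 : (x : ℂ) ^ (((2 : ℝ) : ℂ) + t * I + 1)
        = (x : ℂ) ^ 2 * (x : ℂ) ^ (((1 : ℝ) : ℂ) + t * I) := by
      rw [← Complex.cpow_ofNat, ← Complex.cpow_add _ _ hx']
      congr 1; push_cast; ring
    have n1 : ((1 : ℝ) : ℂ) + t * I ≠ 0 := by
      intro h; have := congrArg re h; simp at this
    have n2 : ((2 : ℝ) : ℂ) + t * I ≠ 0 := by
      intro h; have := congrArg re h; simp at this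
    have n3 : ((2 : ℝ) : ℂ) + t * I + 1 ≠ 0 := by
      intro h; have := congrArg re h; simp at this; linarith
    have e3 : ((2 : ℝ) : ℂ) + t * I - 1 = ((1 : ℝ) : ℂ) + t * I := by push_cast; ring
    have e4 : ((1 : ℝ) : ℂ) + t * I + ((2 : ℝ) : ℂ) = ((2 : ℝ) : ℂ) + t * I + 1 := by
      push_cast; ring
    rw [e2, e3, e4, mul_inv, mul_inv, mul_sub, sub_mul]
    congr 1
    field_simp
  have hF2 : Integrable fun t : ℝ => F ((2 : ℝ) + t * I) := by
    simp_rw [e1]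
    exact i1.sub (i2.const_mul _)
  have hshift := integral_vertical_line_eq hτa (by linarith : a ≤ 2) hFd hbF hFa hF2
  have hgoal : ∫ t : ℝ, polarQuotient H A (a + t * I) *
      ((x : ℂ) ^ ((a : ℂ) + t * I + 1) * (((a : ℂ) + t * I) * ((a : ℂ) + t * I + 1))⁻¹)
      = ∫ t : ℝ, F (a + t * I) := rfl
  rw [hgoal, hshift]
  simp_rw [e1]
  rw [integral_sub i1 (i2.const_mul _), integral_const_mul, integral_const_mul,
    integral_dirichlet_mul_kernel hv hs hx0, perron_kernel two_pos one_pos hx0]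
  have e5 : max (1 - x ^ (-2 : ℝ)) 0 = 1 - (x ^ 2)⁻¹ := by
    rw [Real.rpow_neg hx0.le, Real.rpow_two, max_eq_left]
    have : (x ^ 2)⁻¹ ≤ 1 := inv_le_one_of_one_le₀ (by nlinarith)
    linarith
  rw [e5]
  push_cast
  field_simp

end Perron

end

section

open Filter Topology MeasureTheory Complex

section PerronMain

theorem mul_mul_le_abs_mul {A X h : ℝ} (hh : 0 < h) (hX : h ≤ X) : A * h * h ≤ |A| * X * h := by
  refine mul_le_mul_of_nonneg_right ?_ hh.le
  exact (mul_le_mul_of_nonneg_right (le_abs_self A) hh.le).trans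
    (mul_le_mul_of_nonneg_left hX (abs_nonneg A))

theorem le_of_difference_le {N W₁ W₀ A K X x h : ℝ} (hh : 0 < h) (hX : h ≤ X)
    (hN : N * h ≤ W₁ - W₀)
    (hW : W₁ - A * (((x + h) ^ 2 - 1) / 2) - (W₀ - A * ((x ^ 2 - 1) / 2)) ≤ K * X * h) :
    N - A * x ≤ (|A| + K) * X := by
  refine le_of_mul_le_mul_right ?_ hh
  have h1 := mul_mul_le_abs_mul (A := A) hh hX
  have h2 : 0 ≤ |A| * X * h := by have := abs_nonneg A; have : 0 ≤ X := hh.le.trans hX; positivity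
  linarith

theorem ge_of_difference_ge {N W₁ W₀ A K X x h : ℝ} (hh : 0 < h) (hX : h ≤ X)
    (hN : W₁ - W₀ ≤ N * h)
    (hW : -(K * X * h) ≤ W₁ - A * ((x ^ 2 - 1) / 2) - (W₀ - A * (((x - h) ^ 2 - 1) / 2))) :
    -((|A| + K) * X) ≤ N - A * x := by
  refine le_of_mul_le_mul_right ?_ hh
  have h1 := mul_mul_le_abs_mul (A := A) hh hX
  have h2 : 0 ≤ |A| * X * h := by have := abs_nonneg A; have : 0 ≤ X := hh.le.trans hX; positivity
  linarith

theorem ncard_sub_linear_bound {ι : Type*} [Countable ι] {v : ι → ℝ} (hv : ∀ n, 1 ≤ v n)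
    (hs : Summable fun n => v n ^ (-2 : ℝ)) {H : ℂ → ℂ} {τ a δ θ A C : ℝ} (hτ : 0 < τ)
    (hτa : τ < a) (hδ : 0 < δ) (haθ : a + δ ≤ θ) (hθ : θ < 1)
    (hH : DifferentiableOn ℂ H {s | τ < s.re}) (hA : H 1 = A)
    (hζ : ∀ s : ℂ, s.re = 2 → H s = (s - 1) * ∑' n, (v n : ℂ) ^ (-s))
    (hb : ∀ s : ℂ, a ≤ s.re → s.re ≤ 2 → ‖H s‖ ≤ C * Real.exp (C * |s.im|))
    (hint : Integrable fun t : ℝ => ‖H (a + t * I)‖ * (1 + |t|) ^ (-2 - δ)) :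
    ∃ K : ℝ, ∀ x : ℝ, 1 ≤ x → |(Set.ncard {n | v n ≤ x} : ℝ) - A * x| ≤ K * x ^ θ := by
  have ha : a < 1 := by linarith
  have hδ1 : δ < 1 := by linarith
  set k : ℝ → ℂ := fun t => polarQuotient H A (a + t * I) *
      (((a : ℂ) + t * I) * ((a : ℂ) + t * I + 1))⁻¹ with hk
  have hki := integrable_polarQuotient hτ hτa ha hδ hH hA hint
  set J : ℝ := ∫ t : ℝ, ‖k t‖ * (1 + |t|) ^ (1 - δ) with hJ
  have hJ0 : 0 ≤ J := integral_nonneg fun t => by positivity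
  set E : ℝ → ℝ := fun x => ∑' n, max (x - v n) 0 - A * ((x ^ 2 - 1) / 2) with hE
  have hE1 : ∀ y z : ℝ, 1 ≤ y → y ≤ z → |E z - E y| ≤ J * (2 * z ^ (a + δ) * (z - y) ^ (1 - δ)) := by
    intro y z hy hyz
    have h1 := riesz_mean_eq_integral hv hs hτ hτa ha hδ hδ1 hH hA hζ hb hint hy
    have h2 := riesz_mean_eq_integral hv hs hτ hτa ha hδ hδ1 hH hA hζ hb hint (hy.trans hyz)
    have h3 : ((2 * Real.pi * (E z - E y) : ℝ) : ℂ) = ∫ t : ℝ, k t *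
        ((z : ℂ) ^ ((a : ℂ) + t * I + 1) - (y : ℂ) ^ ((a : ℂ) + t * I + 1)) := by
      rw [mul_sub, ofReal_sub, h1.2, h2.2, ← integral_sub h2.1 h1.1]
      congr 1; ext t; simp only [hk]; ring
    have h4 : ‖((2 * Real.pi * (E z - E y) : ℝ) : ℂ)‖
        ≤ ∫ t : ℝ, (‖k t‖ * (1 + |t|) ^ (1 - δ)) * (2 * z ^ (a + δ) * (z - y) ^ (1 - δ)) := by
      rw [h3]
      refine norm_integral_le_of_norm_le (hki.mul_const _) (Eventually.of_forall fun t => ?_)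
      rw [norm_mul]
      have := norm_ofReal_cpow_sub_le_interpolated (t := t) (by linarith : 0 < y) hyz
        (by linarith : 0 ≤ a) ha.le hδ.le hδ1.le
      calc _ ≤ ‖k t‖ * (2 * z ^ (a + δ) * (z - y) ^ (1 - δ) * (1 + |t|) ^ (1 - δ)) := by gcongr
        _ = _ := by ring
    rw [integral_mul_const, Complex.norm_real, Real.norm_eq_abs, abs_mul,
      abs_of_pos Real.two_pi_pos] at h4
    have h5 : 1 * |E z - E y| ≤ 2 * Real.pi * |E z - E y| := by
      gcongr; linarith [Real.pi_gt_three]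
    linarith
  set N : ℝ → ℝ := fun x => (Set.ncard {n | v n ≤ x} : ℝ) with hN
  set K₁ : ℝ := J * (2 * 2 ^ θ * 2) with hK1
  have hθ0 : 0 < θ := by linarith
  have hK10 : 0 ≤ K₁ := by positivity
  refine ⟨N 2 + 2 * |A| + K₁, fun x hx => ?_⟩
  have hxθ1 : 1 ≤ x ^ θ := Real.one_le_rpow hx hθ0.le
  rcases le_total x 2 with hx2 | hx2
  · have h1 : N x ≤ N 2 := by
      simp only [hN]
      exact_mod_cast Set.ncard_le_ncard (fun n (hn : v n ≤ x) => hn.trans hx2)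
        (finite_setOf_le_of_summable hv hs 2)
    have h0 : 0 ≤ N x := Nat.cast_nonneg _
    calc |N x - A * x| ≤ |N x| + |A * x| := abs_sub _ _
      _ ≤ N 2 + 2 * |A| := by
        rw [abs_of_nonneg h0, abs_mul, abs_of_nonneg (by linarith : 0 ≤ x)]
        nlinarith [abs_nonneg A]
      _ ≤ (N 2 + 2 * |A| + K₁) * 1 := by linarith
      _ ≤ _ := by
        have : 0 ≤ N 2 + 2 * |A| + K₁ := by have := abs_nonneg A; linarith
        gcongr
  · set h : ℝ := x ^ θ / 2 with hh
    have hx0 : 0 < x := by linarith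
    have hxθ : x ^ θ ≤ x := by
      simpa using Real.rpow_le_rpow_of_exponent_le hx hθ.le
    have hh0 : 0 < h := by positivity
    have hh2 : h ≤ x / 2 := by rw [hh]; linarith
    have hbd : ∀ z, 1 ≤ z → z ≤ 2 * x → J * (2 * z ^ (a + δ) * h ^ (1 - δ)) ≤ K₁ * x ^ θ * h := by
      intro z hz1 hz
      have e1 : z ^ (a + δ) ≤ 2 ^ θ * x ^ θ := by
        rw [← Real.mul_rpow two_pos.le hx0.le]
        calc z ^ (a + δ) ≤ z ^ θ := Real.rpow_le_rpow_of_exponent_le hz1 haθ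
          _ ≤ _ := by gcongr
      have e2 : h ^ (1 - δ) ≤ 2 * h := by
        rw [sub_eq_add_neg, Real.rpow_add hh0, Real.rpow_one, mul_comm 2]
        gcongr
        calc h ^ (-δ) ≤ (1 / 2 : ℝ) ^ (-δ) := by
              apply Real.rpow_le_rpow_of_nonpos (by norm_num) _ (by linarith)
              rw [hh]; linarith
          _ = 2 ^ δ := by rw [Real.rpow_neg (by norm_num), one_div, Real.inv_rpow (by norm_num), inv_inv]
          _ ≤ 2 ^ (1 : ℝ) := Real.rpow_le_rpow_of_exponent_le (by norm_num) hδ1.le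
          _ = 2 := Real.rpow_one 2
      calc _ ≤ J * (2 * (2 ^ θ * x ^ θ) * (2 * h)) := by gcongr
        _ = _ := by rw [hK1]; ring
    have u1 := hE1 x (x + h) hx (by linarith)
    have u2 := hE1 (x - h) x (by linarith) (by linarith)
    have u3 := hbd (x + h) (by linarith) (by linarith)
    have u4 := hbd x hx (by linarith)
    rw [add_sub_cancel_left] at u1
    rw [sub_sub_cancel] at u2
    have w1 := (abs_le.mp (u1.trans u3)).2
    have w2 := (abs_le.mp (u2.trans u4)).1
    have n1 := ncard_mul_le_tsum_max_sub hv hs (x := x) hh0.le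
    have n2 := tsum_max_sub_le_ncard_mul hv hs (x := x) hh0.le
    change N x * h ≤ _ at n1
    change _ ≤ N x * h at n2
    simp only [hE] at w1 w2
    have hhx : h ≤ x ^ θ := by rw [hh]; linarith
    have g1 := le_of_difference_le hh0 hhx n1 w1
    have g2 := ge_of_difference_ge hh0 hhx n2 w2
    have h0 : 0 ≤ N 2 := Nat.cast_nonneg _
    have hfin : (|A| + K₁) * x ^ θ ≤ (N 2 + 2 * |A| + K₁) * x ^ θ := by
      have := abs_nonneg A
      gcongr; linarith
    exact abs_le.mpr ⟨by linarith, by linarith⟩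

end PerronMain

end

section

open Filter Topology

section EulerProduct

theorem hasSum_fin_prod_pow {J : ℕ} (a : Fin J → ℂ) (ha : ∀ i, ‖a i‖ < 1) :
    (Summable fun x : Fin J → ℕ => ‖∏ i, a i ^ x i‖) ∧
    HasSum (fun x : Fin J → ℕ => ∏ i, a i ^ x i) (∏ i, (1 - a i)⁻¹) := by
  induction J with
  | zero =>
    refine ⟨(hasSum_unique fun x : Fin 0 → ℕ => ‖∏ i, a i ^ x i‖).summable, ?_⟩
    simp
  | succ J ih =>
    obtain ⟨h1, h2⟩ := ih (fun i => a i.succ) fun i => ha _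
    have g1 : Summable fun n : ℕ => ‖a 0 ^ n‖ := by
      simpa using summable_geometric_of_lt_one (norm_nonneg _) (ha 0)
    have g2 := hasSum_geometric_of_norm_lt_one (ha 0)
    have h3 : ∀ p : ℕ × (Fin J → ℕ), ∏ i, a i ^ (Fin.consEquiv (fun _ => ℕ) p) i
        = a 0 ^ p.1 * ∏ i, a (Fin.succ i) ^ p.2 i := by
      intro p
      rw [Fin.prod_univ_succ]
      simp [Fin.consEquiv]
    refine ⟨?_, ?_⟩
    · rw [← (Fin.consEquiv fun _ => ℕ).summable_iff]
      refine (summable_mul_of_summable_norm g1.norm h1.norm).congr fun p => ?_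
      simp only [Function.comp, h3, norm_mul]
    · rw [← (Fin.consEquiv fun _ => ℕ).hasSum_iff, Fin.prod_univ_succ]
      have hm : HasSum (fun p : ℕ × (Fin J → ℕ) => a 0 ^ p.1 * ∏ i, a (Fin.succ i) ^ p.2 i)
          ((1 - a 0)⁻¹ * ∏ i : Fin J, (1 - a i.succ)⁻¹) :=
        HasSum.mul (f := fun n : ℕ => a 0 ^ n) (g := fun x : Fin J → ℕ => ∏ i, a (Fin.succ i) ^ x i)
          g2 h2 (summable_mul_of_summable_norm (f := fun n : ℕ => a 0 ^ n)
            (g := fun x : Fin J → ℕ => ∏ i, a (Fin.succ i) ^ x i) g1 h1)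
      have he : (fun x : Fin (J + 1) → ℕ => ∏ i, a i ^ x i) ∘ (Fin.consEquiv fun _ => ℕ)
          = fun p : ℕ × (Fin J → ℕ) => a 0 ^ p.1 * ∏ i, a (Fin.succ i) ^ p.2 i := funext h3
      rw [he]
      exact hm

/-- The monomial with exponent vector `n` in the variables `a`. -/
noncomputable def monomialVal (a : ℕ → ℂ) (n : ℕ →₀ ℕ) : ℂ := n.prod fun k e => a k ^ e

theorem monomialVal_embDomain (a : ℕ → ℂ) {J : ℕ} (x : Fin J → ℕ) :
    monomialVal a ((Finsupp.equivFunOnFinite.symm x).embDomain Fin.valEmbedding)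
      = ∏ i : Fin J, a i ^ x i := by
  rw [monomialVal, Finsupp.prod_embDomain, Finsupp.prod_fintype _ _ (by simp)]
  simp

theorem mem_range_embDomain_fin {J : ℕ} {n : ℕ →₀ ℕ} (hn : n.support ⊆ Finset.range J) :
    n ∈ Set.range fun x : Fin J → ℕ =>
      (Finsupp.equivFunOnFinite.symm x).embDomain Fin.valEmbedding := by
  refine ⟨fun i => n i, ?_⟩
  ext k
  by_cases hk : k < J
  · exact Finsupp.embDomain_apply_self Fin.valEmbedding _ (⟨k, hk⟩ : Fin J)
  · rw [Finsupp.embDomain_of_notMem_range]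
    · by_contra h
      exact hk (Finset.mem_range.mp (hn (Finsupp.mem_support_iff.mpr fun h0 => h h0.symm)))
    · rintro ⟨i, rfl⟩
      exact hk i.2

theorem embDomain_fin_injective (J : ℕ) : Function.Injective fun x : Fin J → ℕ =>
    (Finsupp.equivFunOnFinite.symm x).embDomain Fin.valEmbedding :=
  (Finsupp.embDomain_injective _).comp Finsupp.equivFunOnFinite.symm.injective

theorem support_embDomain_fin {J : ℕ} (x : Fin J → ℕ) :
    ((Finsupp.equivFunOnFinite.symm x).embDomain Fin.valEmbedding).support ⊆ Finset.range J := by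
  intro k hk
  rw [Finsupp.support_embDomain, Finset.mem_map] at hk
  obtain ⟨i, -, rfl⟩ := hk
  exact Finset.mem_range.mpr i.2

theorem norm_monomialVal (a : ℕ → ℂ) (n : ℕ →₀ ℕ) :
    (‖monomialVal a n‖ : ℂ) = monomialVal (fun k => (‖a k‖ : ℂ)) n := by
  simp [monomialVal, Finsupp.prod]

theorem hasSum_indicator_monomialVal {a : ℕ → ℂ} (ha : ∀ i, ‖a i‖ < 1) (J : ℕ) :
    HasSum ({n : ℕ →₀ ℕ | n.support ⊆ Finset.range J}.indicator (monomialVal a))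
      (∏ i ∈ Finset.range J, (1 - a i)⁻¹) := by
  rw [← (embDomain_fin_injective J).hasSum_iff]
  · rw [Finset.prod_range]
    refine (hasSum_fin_prod_pow (fun i : Fin J => a i) fun i => ha i).2.congr_fun fun x => ?_
    rw [Function.comp, Set.indicator_of_mem (support_embDomain_fin x), monomialVal_embDomain]
  · intro n hn
    exact Set.indicator_of_notMem (fun h => hn (mem_range_embDomain_fin h)) _

theorem summable_neg_log_one_sub {a : ℕ → ℂ} (hs : Summable fun i => ‖a i‖) :
    Summable fun i => -Complex.log (1 - a i) := by
  have := Complex.summable_log_one_add_of_summable (f := fun i => -a i) (by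
    exact hs.of_norm.neg)
  simpa [sub_eq_add_neg] using this.neg

theorem prod_inv_one_sub {a : ℕ → ℂ} (ha : ∀ i, ‖a i‖ < 1) (J : ℕ) :
    ∏ i ∈ Finset.range J, (1 - a i)⁻¹
      = Complex.exp (∑ i ∈ Finset.range J, -Complex.log (1 - a i)) := by
  rw [Complex.exp_sum]
  refine Finset.prod_congr rfl fun i _ => ?_
  rw [Complex.exp_neg, Complex.exp_log]
  intro h
  have := ha i
  rw [← sub_eq_zero.mp h] at this
  simp at this

theorem tendsto_prod_inv_one_sub {a : ℕ → ℂ} (ha : ∀ i, ‖a i‖ < 1)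
    (hs : Summable fun i => ‖a i‖) :
    Tendsto (fun J => ∏ i ∈ Finset.range J, (1 - a i)⁻¹) atTop
      (𝓝 (Complex.exp (∑' i, -Complex.log (1 - a i)))) := by
  simp_rw [prod_inv_one_sub ha]
  exact (Complex.continuous_exp.tendsto _).comp (summable_neg_log_one_sub hs).hasSum.tendsto_sum_nat

theorem summable_norm_monomialVal {a : ℕ → ℂ} (ha : ∀ i, ‖a i‖ < 1)
    (hs : Summable fun i => ‖a i‖) : Summable fun n => ‖monomialVal a n‖ := by
  set r : ℕ → ℂ := fun k => (‖a k‖ : ℂ) with hr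
  have hr1 : ∀ i, ‖r i‖ < 1 := by intro i; simpa [hr] using ha i
  have hrs : Summable fun i => ‖r i‖ := by simpa [hr] using hs
  obtain ⟨B, hB⟩ := (tendsto_prod_inv_one_sub hr1 hrs).norm.bddAbove_range
  refine summable_of_sum_le (c := B) (fun n => norm_nonneg _) fun u => ?_
  obtain ⟨J, hJ⟩ : ∃ J, ∀ n ∈ u, n.support ⊆ Finset.range J := by
    obtain ⟨J, hJ⟩ := Finset.exists_nat_subset_range (u.biUnion fun n => n.support)
    exact ⟨J, fun n hn => (Finset.subset_biUnion_of_mem (fun n : ℕ →₀ ℕ => n.support) hn).trans hJ⟩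
  have h1 := hasSum_indicator_monomialVal hr1 J
  have h2 : HasSum ({n : ℕ →₀ ℕ | n.support ⊆ Finset.range J}.indicator fun n => ‖monomialVal a n‖)
      (∏ i ∈ Finset.range J, (1 - r i)⁻¹).re := by
    refine (Complex.hasSum_re h1).congr_fun fun n => ?_
    by_cases hn : n.support ⊆ Finset.range J
    · rw [Set.indicator_of_mem (by exact hn), Set.indicator_of_mem (by exact hn),
        ← norm_monomialVal, Complex.ofReal_re]
    · rw [Set.indicator_of_notMem (by exact hn), Set.indicator_of_notMem (by exact hn),
        Complex.zero_re]
  calc ∑ n ∈ u, ‖monomialVal a n‖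
      = ∑ n ∈ u, {n : ℕ →₀ ℕ | n.support ⊆ Finset.range J}.indicator
          (fun n => ‖monomialVal a n‖) n :=
        Finset.sum_congr rfl fun n hn => (Set.indicator_of_mem
          (show n ∈ {n : ℕ →₀ ℕ | n.support ⊆ Finset.range J} from hJ n hn)
          (fun n => ‖monomialVal a n‖)).symm
    _ ≤ (∏ i ∈ Finset.range J, (1 - r i)⁻¹).re :=
        sum_le_hasSum _ (fun n _ => Set.indicator_nonneg (fun _ _ => norm_nonneg _) _) h2
    _ ≤ _ := Complex.re_le_norm _
    _ ≤ B := hB ⟨J, rfl⟩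

theorem tsum_monomialVal {a : ℕ → ℂ} (ha : ∀ i, ‖a i‖ < 1) (hs : Summable fun i => ‖a i‖) :
    ∑' n, monomialVal a n = Complex.exp (∑' i, -Complex.log (1 - a i)) := by
  refine tendsto_nhds_unique ?_ (tendsto_prod_inv_one_sub ha hs)
  have h := tendsto_tsum_of_dominated_convergence (𝓕 := atTop)
    (f := fun J : ℕ => {n : ℕ →₀ ℕ | n.support ⊆ Finset.range J}.indicator (monomialVal a))
    (g := monomialVal a) (summable_norm_monomialVal ha hs) (fun n => ?_)
    (Eventually.of_forall fun J n => norm_indicator_le_norm_self _ _)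
  · refine h.congr fun J => (hasSum_indicator_monomialVal ha J).tsum_eq
  · obtain ⟨J, hJ⟩ := Finset.exists_nat_subset_range n.support
    refine tendsto_const_nhds.congr' ?_
    filter_upwards [eventually_ge_atTop J] with K hK
    exact (Set.indicator_of_mem (by exact hJ.trans (Finset.range_mono hK)) _).symm

end EulerProduct

end

section

open Filter Topology MeasureTheory
open scoped ENNReal

section Averaging

theorem exists_lintegral_mul_le {W : ℝ → ℝ≥0∞} (hW : Measurable W) (μ : Measure ℝ)
    [IsProbabilityMeasure μ] [NullSingletonClass μ] {s : Set ℝ} (hs : μ sᶜ = 0) (F : Finset ℝ)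
    {V : ℝ → ℝ → ℝ≥0∞} (hV : Measurable (Function.uncurry V)) {c : ℝ≥0∞}
    (hc : ∀ t, ∫⁻ u, V u t ∂μ ≤ c) :
    ∃ u, u ∈ s ∧ u ∉ F ∧ ∫⁻ t, W t * V u t ≤ c * ∫⁻ t, W t := by
  have hm : Measurable (Function.uncurry fun u t : ℝ => W t * V u t) :=
    (hW.comp measurable_snd).mul hV
  have hN : μ (sᶜ ∪ (F : Set ℝ)) = 0 :=
    measure_union_null hs (Set.Countable.measure_zero F.countable_toSet μ)
  obtain ⟨u, hu, hle⟩ := exists_notMem_null_le_lintegral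
    (hm.lintegral_prod_right' (ν := volume)).aemeasurable hN
  simp only [Set.mem_union, Set.mem_compl_iff, not_or, not_not, Finset.mem_coe] at hu
  refine ⟨u, hu.1, hu.2, hle.trans ?_⟩
  calc ∫⁻ u, ∫⁻ t, Function.uncurry (fun u t : ℝ => W t * V u t) (u, t) ∂volume ∂μ
      = ∫⁻ t, ∫⁻ u, W t * V u t ∂μ := lintegral_lintegral_swap hm.aemeasurable
    _ ≤ ∫⁻ t, c * W t := by
      refine lintegral_mono fun t => ?_
      have hVt : Measurable fun u => V u t := hV.comp measurable_prodMk_right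
      rw [lintegral_const_mul _ hVt, mul_comm]
      gcongr
      exact hc t
    _ = _ := lintegral_const_mul _ hW

/-- Sequentially choosing the parameters of a random product so that its weighted integral is
bounded by the product of the averages. -/
theorem exists_seq_lintegral_prod_le {W : ℝ → ℝ≥0∞} (hW : Measurable W) (μ : ℕ → Measure ℝ)
    [∀ j, IsProbabilityMeasure (μ j)] [∀ j, NullSingletonClass (μ j)] {s : ℕ → Set ℝ}
    (hs : ∀ j, μ j (s j)ᶜ = 0) {V : ℕ → ℝ → ℝ → ℝ≥0∞}
    (hV : ∀ j, Measurable (Function.uncurry (V j))) {c : ℕ → ℝ≥0∞}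
    (hc : ∀ j t, ∫⁻ u, V j u t ∂μ j ≤ c j) :
    ∃ u : ℕ → ℝ, Function.Injective u ∧ (∀ j, u j ∈ s j) ∧
      ∀ J, ∫⁻ t, W t * ∏ j ∈ Finset.range J, V j (u j) t
        ≤ (∏ j ∈ Finset.range J, c j) * ∫⁻ t, W t := by
  classical
  have hstep : ∀ (j : ℕ) (st : {W : ℝ → ℝ≥0∞ // Measurable W} × Finset ℝ),
      ∃ u, u ∈ s j ∧ u ∉ st.2 ∧ ∫⁻ t, st.1.1 t * V j u t ≤ c j * ∫⁻ t, st.1.1 t :=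
    fun j st => exists_lintegral_mul_le st.1.2 (μ j) (hs j) st.2 (hV j) (hc j)
  choose g hg1 hg2 hg3 using hstep
  let st : ℕ → {W : ℝ → ℝ≥0∞ // Measurable W} × Finset ℝ := fun n =>
    Nat.rec (⟨W, hW⟩, ∅) (fun j st => (⟨fun t => st.1.1 t * V j (g j st) t,
      st.1.2.mul ((hV j).comp measurable_prodMk_left)⟩, insert (g j st) st.2)) n
  let u : ℕ → ℝ := fun j => g j (st j)
  have hst1 : ∀ n t, (st (n + 1)).1.1 t = (st n).1.1 t * V n (u n) t := fun n t => rfl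
  have hst2 : ∀ n, (st (n + 1)).2 = insert (u n) (st n).2 := fun n => rfl
  have hW' : ∀ n t, (st n).1.1 t = W t * ∏ j ∈ Finset.range n, V j (u j) t := by
    intro n t
    induction n with
    | zero => simp [st]
    | succ n ih => rw [hst1, ih, Finset.prod_range_succ, mul_assoc]
  have hF : ∀ n, ∀ j < n, u j ∈ (st n).2 := by
    intro n
    induction n with
    | zero => intro j hj; omega
    | succ n ih =>
      intro j hj
      rw [hst2, Finset.mem_insert]
      rcases Nat.lt_succ_iff_lt_or_eq.mp hj with h | h
      · exact Or.inr (ih j h)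
      · exact Or.inl (by rw [h])
  refine ⟨u, ?_, fun j => hg1 j _, ?_⟩
  · intro i j hij
    by_contra hne
    rcases Nat.lt_or_gt_of_ne hne with h | h
    · exact hg2 j (st j) (by have := hF j i h; rwa [hij] at this)
    · exact hg2 i (st i) (by have := hF i j h; rwa [← hij] at this)
  · intro J
    induction J with
    | zero => simp
    | succ J ih =>
      have h1 := hg3 J (st J)
      simp_rw [hW'] at h1
      rw [Finset.prod_range_succ]
      calc _ = ∫⁻ t, W t * (∏ j ∈ Finset.range J, V j (u j) t) * V J (u J) t := by
            simp_rw [Finset.prod_range_succ, mul_assoc]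
        _ ≤ _ := h1
        _ ≤ c J * ((∏ j ∈ Finset.range J, c j) * ∫⁻ t, W t) := by gcongr
        _ = _ := by ring

theorem lintegral_mul_le_of_tendsto_prod {W : ℝ → ℝ≥0∞} (hW : Measurable W) {B : ℝ≥0∞}
    {V : ℕ → ℝ → ℝ≥0∞} (hV : ∀ j, Measurable (V j)) {P : ℝ → ℝ≥0∞}
    (hB : ∀ J, ∫⁻ t, W t * ∏ j ∈ Finset.range J, V j t ≤ B)
    (hP : ∀ t, Tendsto (fun J => W t * ∏ j ∈ Finset.range J, V j t) atTop (𝓝 (P t))) :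
    ∫⁻ t, P t ≤ B := by
  have h := lintegral_liminf_le (μ := volume) (u := (atTop : Filter ℕ))
    (f := fun J t => W t * ∏ j ∈ Finset.range J, V j t)
    fun J => hW.mul (Finset.measurable_prod _ fun j _ => hV j)
  simp_rw [fun t => (hP t).liminf_eq] at h
  exact h.trans (liminf_le_of_le (by isBoundedDefault) fun b hb => by
    obtain ⟨J, hJ⟩ := hb.exists
    exact hJ.trans (hB J))

end Averaging

end

section

open Filter Topology MeasureTheory

section Box

/-- The density of the uniform distribution on `[1/2, (1+η)/2]`. -/
noncomputable def box (η : ℝ) : ℝ → ℝ := (Set.Icc (1 / 2) ((1 + η) / 2)).indicator fun _ => 2 / η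

/-- The `m + 1`-fold convolution power of `box η`. -/
noncomputable def boxPow (η : ℝ) : ℕ → ℝ → ℝ
  | 0 => box η
  | m + 1 => fun u => ∫ w, box η w * boxPow η m (u - w)

/-- The Laplace transform of `box η`. -/
noncomputable def boxHat (η : ℝ) : ℂ → ℂ :=
  dslope (fun z => (2 / η : ℂ) * (Complex.exp (-(z / 2)) - Complex.exp (-((1 + η) / 2 * z)))) 0

/-- The entire function `g` with `g 0 = 1` and `‖g z‖ < 1` for `0 < re z`. -/
noncomputable def gFun (η : ℝ) (z : ℂ) : ℂ := boxHat η z ^ 2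

theorem box_nonneg {η : ℝ} (hη : 0 < η) (u : ℝ) : 0 ≤ box η u :=
  Set.indicator_nonneg (fun _ _ => by positivity) u

theorem box_le {η : ℝ} (hη : 0 < η) (u : ℝ) : box η u ≤ 2 / η := by
  rw [box, Set.indicator_apply]
  split_ifs
  · exact le_rfl
  · positivity

theorem measurable_box (η : ℝ) : Measurable (box η) :=
  measurable_const.indicator measurableSet_Icc

theorem box_eq_zero {η u : ℝ} (h : u ∉ Set.Icc (1 / 2) ((1 + η) / 2)) : box η u = 0 :=
  Set.indicator_of_notMem h _

theorem integral_box_mul {η : ℝ} (hη : 0 < η) (f : ℝ → ℂ) :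
    ∫ u, f u * box η u = (2 / η : ℂ) * ∫ u in (1 / 2)..((1 + η) / 2), f u := by
  rw [intervalIntegral.integral_of_le (by linarith), ← integral_Icc_eq_integral_Ioc,
    ← integral_indicator measurableSet_Icc, ← integral_const_mul]
  congr 1
  ext u
  simp only [box, Set.indicator_apply]
  split_ifs
  · push_cast; ring
  · simp

theorem boxHat_eq_integral {η : ℝ} (hη : 0 < η) (z : ℂ) :
    boxHat η z = ∫ u : ℝ, Complex.exp (-(u * z)) * box η u := by
  have hη' : (η : ℂ) ≠ 0 := by exact_mod_cast hη.ne'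
  rw [integral_box_mul hη (fun u => Complex.exp (-(u * z)))]
  rcases eq_or_ne z 0 with rfl | hz
  · rw [boxHat, dslope_same]
    have h1 : HasDerivAt (fun z : ℂ => (2 / η : ℂ) * (Complex.exp (-(z / 2))
        - Complex.exp (-((1 + η) / 2 * z)))) ((2 / η : ℂ) * (Complex.exp (-((0:ℂ) / 2)) * (-(1 / 2))
        - Complex.exp (-((1 + η) / 2 * (0:ℂ))) * (-((1 + η) / 2 * 1)))) 0 :=
      ((((hasDerivAt_id (0 : ℂ)).div_const 2).neg.cexp).sub
        (((hasDerivAt_id (0 : ℂ)).const_mul _).neg.cexp)).const_mul _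
    rw [h1.deriv]
    simp only [intervalIntegral.integral_const, zero_div, mul_zero, neg_zero, Complex.exp_zero]
    rw [Complex.real_smul]
    push_cast
    ring
  · rw [boxHat, dslope_of_ne _ hz, slope_def_field]
    have h2 : ∀ u : ℝ, Complex.exp (-(u * z)) = Complex.exp (-z * u) := fun u => by
      congr 1; ring
    simp_rw [h2]
    rw [integral_exp_mul_complex (neg_ne_zero.mpr hz)]
    have e1 : -z * (((1 + η) / 2 : ℝ) : ℂ) = -((1 + η) / 2 * z) := by push_cast; ring
    have e2 : -z * ((1 / 2 : ℝ) : ℂ) = -(z / 2) := by push_cast; ring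
    rw [e1, e2]
    simp only [zero_div, mul_zero, neg_zero, Complex.exp_zero, sub_self, sub_zero]
    field_simp
    ring

theorem boxHat_differentiable (η : ℝ) : Differentiable ℂ (boxHat η) := by
  rw [← differentiableOn_univ]
  refine (Complex.differentiableOn_dslope (by simp)).mpr ?_
  fun_prop

theorem boxHat_zero {η : ℝ} (hη : 0 < η) : boxHat η 0 = 1 := by
  have hη' : (η : ℂ) ≠ 0 := by exact_mod_cast hη.ne'
  rw [boxHat_eq_integral hη, integral_box_mul hη (fun u => Complex.exp (-(u * 0)))]
  simp
  field_simp
  ring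

theorem integrable_box (η : ℝ) : Integrable (box η) := by
  unfold box
  exact (integrable_indicator_iff measurableSet_Icc).mpr (integrableOn_const (by simp))

theorem integral_box {η : ℝ} (hη : 0 < η) : ∫ u, box η u = 1 := by
  have h := boxHat_eq_integral hη 0
  rw [boxHat_zero hη] at h
  simp only [mul_zero, neg_zero, Complex.exp_zero, one_mul] at h
  rw [integral_complex_ofReal] at h
  exact_mod_cast h.symm

theorem norm_boxHat_le {η : ℝ} (hη : 0 < η) (z : ℂ) :
    ‖boxHat η z‖ ≤ max (Real.exp (-z.re / 2)) (Real.exp (-((1 + η) * z.re) / 2)) := by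
  rw [boxHat_eq_integral hη]
  set M := max (Real.exp (-z.re / 2)) (Real.exp (-((1 + η) * z.re) / 2)) with hM
  have h := norm_integral_le_of_norm_le (f := fun u : ℝ => Complex.exp (-(u * z)) * box η u)
    ((integrable_box η).const_mul M)
    (Eventually.of_forall fun u => ?_)
  · rwa [integral_const_mul, integral_box hη, mul_one] at h
  · by_cases hu : u ∈ Set.Icc (1 / 2) ((1 + η) / 2)
    · rw [norm_mul, Complex.norm_real, Real.norm_of_nonneg (box_nonneg hη u), Complex.norm_exp]
      refine mul_le_mul_of_nonneg_right ?_ (box_nonneg hη u)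
      have : (-((u : ℂ) * z)).re = -(u * z.re) := by simp
      rw [this]
      rcases le_total 0 z.re with h0 | h0
      · refine le_max_of_le_left (Real.exp_le_exp.mpr ?_)
        nlinarith [hu.1]
      · refine le_max_of_le_right (Real.exp_le_exp.mpr ?_)
        nlinarith [hu.2]
    · rw [box_eq_zero hu]; simp

theorem norm_mul_boxHat_le {η : ℝ} (hη : 0 < η) (z : ℂ) :
    ‖z‖ * ‖boxHat η z‖ ≤ 4 / η * max (Real.exp (-z.re / 2)) (Real.exp (-((1 + η) * z.re) / 2)) := by
  rcases eq_or_ne z 0 with rfl | hz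
  · rw [norm_zero, zero_mul]; positivity
  · rw [boxHat, dslope_of_ne _ hz, slope_def_field]
    simp only [zero_div, mul_zero, neg_zero, Complex.exp_zero, sub_self, sub_zero]
    rw [norm_div, mul_div_cancel₀ _ (norm_ne_zero_iff.mpr hz), norm_mul, norm_div,
      Complex.norm_real, Real.norm_of_nonneg hη.le]
    have h1 : ‖Complex.exp (-(z / 2)) - Complex.exp (-((1 + η) / 2 * z))‖
        ≤ 2 * max (Real.exp (-z.re / 2)) (Real.exp (-((1 + η) * z.re) / 2)) := by
      refine (norm_sub_le _ _).trans ?_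
      rw [Complex.norm_exp, Complex.norm_exp]
      have e1 : (-(z / 2)).re = -z.re / 2 := by simp; ring
      have e2 : (-((1 + η) / 2 * z)).re = -((1 + η) * z.re) / 2 := by
        have : (1 + η) / 2 * z = (((1 + η) / 2 : ℝ) : ℂ) * z := by push_cast; ring
        rw [this, Complex.neg_re, Complex.re_ofReal_mul]; ring
      rw [e1, e2]
      have := le_max_left (Real.exp (-z.re / 2)) (Real.exp (-((1 + η) * z.re) / 2))
      have := le_max_right (Real.exp (-z.re / 2)) (Real.exp (-((1 + η) * z.re) / 2))
      linarith
    calc _ ≤ 2 / η * (2 * max (Real.exp (-z.re / 2)) (Real.exp (-((1 + η) * z.re) / 2))) := by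
          simp only [Complex.norm_ofNat]
          gcongr
      _ = _ := by ring

theorem gFun_differentiable (η : ℝ) : Differentiable ℂ (gFun η) :=
  (boxHat_differentiable η).pow 2

theorem gFun_zero {η : ℝ} (hη : 0 < η) : gFun η 0 = 1 := by
  rw [gFun, boxHat_zero hη, one_pow]

theorem norm_gFun_lt_one {η : ℝ} (hη : 0 < η) {z : ℂ} (hz : 0 < z.re) : ‖gFun η z‖ < 1 := by
  rw [gFun, norm_pow]
  refine pow_lt_one₀ (norm_nonneg _) ((norm_boxHat_le hη z).trans_lt ?_) two_ne_zero
  refine max_lt ?_ ?_ <;> rw [Real.exp_lt_one_iff] <;> nlinarith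

theorem norm_gFun_le {η : ℝ} (hη : 0 < η) (z : ℂ) :
    ‖gFun η z‖ ≤ max (Real.exp (-z.re)) (Real.exp (-((1 + η) * z.re)))
      * (2 / (1 + (η / 4 * z.im) ^ 2)) := by
  set M := max (Real.exp (-z.re / 2)) (Real.exp (-((1 + η) * z.re) / 2)) with hM
  have hM0 : 0 ≤ M := le_max_of_le_left (Real.exp_pos _).le
  have hM2 : M ^ 2 ≤ max (Real.exp (-z.re)) (Real.exp (-((1 + η) * z.re))) := by
    rcases max_cases (Real.exp (-z.re / 2)) (Real.exp (-((1 + η) * z.re) / 2)) with h | h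
    · rw [hM, h.1, ← Real.exp_nat_mul]
      refine le_max_of_le_left (le_of_eq ?_)
      congr 1; push_cast; ring
    · rw [hM, h.1, ← Real.exp_nat_mul]
      refine le_max_of_le_right (le_of_eq ?_)
      congr 1; push_cast; ring
  rw [gFun, norm_pow]
  have h1 := norm_boxHat_le hη z
  have h2 := norm_mul_boxHat_le hη z
  rw [← hM] at h1 h2
  have h3 : |z.im| ≤ ‖z‖ := Complex.abs_im_le_norm z
  set n := ‖boxHat η z‖ with hn
  have hn0 : 0 ≤ n := norm_nonneg _
  have h4 : n ^ 2 ≤ M ^ 2 := by gcongr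
  have h5 : (η / 4 * z.im) ^ 2 * n ^ 2 ≤ M ^ 2 := by
    have h6 : η / 4 * |z.im| * n ≤ M := by
      have : |z.im| * n ≤ 4 / η * M := (mul_le_mul_of_nonneg_right h3 hn0).trans h2
      calc η / 4 * |z.im| * n = η / 4 * (|z.im| * n) := by ring
        _ ≤ η / 4 * (4 / η * M) := by gcongr
        _ = M := by field_simp
    calc _ = (η / 4 * |z.im| * n) ^ 2 := by
          rw [mul_pow (η / 4 * |z.im|), mul_pow, mul_pow, sq_abs]
      _ ≤ M ^ 2 := by gcongr
  calc n ^ 2 ≤ M ^ 2 * (2 / (1 + (η / 4 * z.im) ^ 2)) := by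
        rw [mul_div_assoc', le_div_iff₀ (by positivity)]
        linarith
    _ ≤ _ := by gcongr

theorem measurable_boxPow (η : ℝ) (m : ℕ) : Measurable (boxPow η m) := by
  induction m with
  | zero => exact measurable_box η
  | succ m ih =>
    have h : Measurable (Function.uncurry fun u w : ℝ => box η w * boxPow η m (u - w)) :=
      ((measurable_box η).comp measurable_snd).mul (ih.comp (measurable_fst.sub measurable_snd))
    exact (h.stronglyMeasurable.integral_prod_right (ν := volume)).measurable

theorem boxPow_nonneg {η : ℝ} (hη : 0 < η) (m : ℕ) (u : ℝ) : 0 ≤ boxPow η m u := by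
  induction m generalizing u with
  | zero => exact box_nonneg hη u
  | succ m ih => exact integral_nonneg fun w => mul_nonneg (box_nonneg hη w) (ih _)

theorem boxPow_le {η : ℝ} (hη : 0 < η) (m : ℕ) (u : ℝ) : boxPow η m u ≤ 2 / η := by
  induction m generalizing u with
  | zero => exact box_le hη u
  | succ m ih =>
    calc boxPow η (m + 1) u ≤ ∫ w, box η w * (2 / η) := by
          refine integral_mono_of_nonneg (Eventually.of_forall fun w =>
            mul_nonneg (box_nonneg hη w) (boxPow_nonneg hη m _)) ((integrable_box η).mul_const _)
            (Eventually.of_forall fun w => mul_le_mul_of_nonneg_left (ih _) (box_nonneg hη w))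
      _ = 2 / η := by rw [integral_mul_const, integral_box hη, one_mul]

theorem boxPow_eq_zero (η : ℝ) (m : ℕ) {u : ℝ}
    (hu : u ∉ Set.Icc ((m + 1) * (1 / 2) : ℝ) ((m + 1) * ((1 + η) / 2))) : boxPow η m u = 0 := by
  induction m generalizing u with
  | zero => exact box_eq_zero (by simpa using hu)
  | succ m ih =>
    have h : ∀ w, box η w * boxPow η m (u - w) = 0 := by
      intro w
      by_cases hw : w ∈ Set.Icc (1 / 2) ((1 + η) / 2)
      · rw [ih, mul_zero]
        intro h
        apply hu
        obtain ⟨h1, h2⟩ := h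
        obtain ⟨h3, h4⟩ := hw
        push_cast
        constructor <;> linarith
      · rw [box_eq_zero hw, zero_mul]
    change ∫ w, box η w * boxPow η m (u - w) = 0
    simp [h]

theorem integrable_exp_mul_boxPow {η : ℝ} (hη : 0 < η) (m : ℕ) (z : ℂ) :
    Integrable fun u : ℝ => Complex.exp (-(u * z)) * boxPow η m u := by
  set K := Set.Icc ((m + 1) * (1 / 2) : ℝ) ((m + 1) * ((1 + η) / 2)) with hK
  have h : (fun u : ℝ => Complex.exp (-(u * z)) * boxPow η m u)
      = K.indicator fun u : ℝ => Complex.exp (-(u * z)) * boxPow η m u := by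
    ext u
    rw [Set.indicator_apply]
    split_ifs with hu
    · rfl
    · rw [boxPow_eq_zero η m hu]; simp
  rw [h, integrable_indicator_iff measurableSet_Icc]
  have hc : ContinuousOn (fun u : ℝ => Complex.exp (-(u * z))) K := by fun_prop
  refine (hc.integrableOn_compact isCompact_Icc).mul_bdd (c := 2 / η) ?_
    (Eventually.of_forall fun u => ?_)
  · exact (Complex.measurable_ofReal.comp (measurable_boxPow η m)).aestronglyMeasurable
  · rw [Complex.norm_real, Real.norm_of_nonneg (boxPow_nonneg hη m u)]
    exact boxPow_le hη m u

theorem integral_exp_mul_boxPow {η : ℝ} (hη : 0 < η) (m : ℕ) (z : ℂ) :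
    ∫ u : ℝ, Complex.exp (-(u * z)) * boxPow η m u = boxHat η z ^ (m + 1) := by
  induction m with
  | zero => rw [zero_add, pow_one, boxHat_eq_integral hη]; rfl
  | succ m ih =>
    have h := integral_convolution (L := ContinuousLinearMap.mul ℝ ℂ) (μ := volume) (ν := volume)
      (integrable_exp_mul_boxPow hη 0 z) (integrable_exp_mul_boxPow hη m z)
    rw [ih, ContinuousLinearMap.mul_apply'] at h
    have h0 : ∫ u : ℝ, Complex.exp (-(u * z)) * boxPow η 0 u = boxHat η z :=
      (boxHat_eq_integral hη z).symm
    rw [h0] at h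
    rw [pow_succ', ← h]
    congr 1
    ext u
    rw [convolution_def]
    have e : ∀ w : ℝ, (ContinuousLinearMap.mul ℝ ℂ) (Complex.exp (-(w * z)) * boxPow η 0 w)
        (Complex.exp (-(((u - w : ℝ) : ℂ) * z)) * boxPow η m (u - w))
        = Complex.exp (-(u * z)) * ((box η w * boxPow η m (u - w) : ℝ) : ℂ) := by
      intro w
      rw [ContinuousLinearMap.mul_apply']
      have : Complex.exp (-(u * z)) = Complex.exp (-(w * z)) * Complex.exp (-(((u - w : ℝ) : ℂ) * z)) := by
        rw [← Complex.exp_add]; congr 1; push_cast; ring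
      rw [this]
      push_cast
      change _ * (box η w : ℂ) * _ = _
      ring
    simp_rw [e]
    rw [integral_const_mul, integral_complex_ofReal]
    rfl

end Box

end

section

open Filter Topology MeasureTheory
open scoped ENNReal

section ZeroFactor

/-- The `g`-term attached to the zero `b + iγ` at scale `ℓ`. -/
noncomputable def zeroTerm (η ℓ b γ : ℝ) (s : ℂ) : ℂ := gFun η (ℓ * (s - b - γ * Complex.I))

/-- The factor contributing the zeros `b ± iγ`. -/
noncomputable def zeroFactor (η ℓ b γ : ℝ) (s : ℂ) : ℂ :=
  (1 - zeroTerm η ℓ b γ s) * (1 - zeroTerm η ℓ b (-γ) s)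

/-- The height attached to scale `ℓ`. -/
noncomputable def scaleHeight (τ ℓ : ℝ) : ℝ := Real.exp (ℓ * (1 - τ))

/-- The mass attached to the pair `ℓ, b`. -/
noncomputable def scaleMass (η τ ℓ b : ℝ) : ℝ := Real.exp (ℓ * (b - 1) + η * (ℓ * (1 - τ)))

variable {η τ ℓ b γ : ℝ}

theorem zeroTerm_differentiable (η ℓ b γ : ℝ) : Differentiable ℂ (zeroTerm η ℓ b γ) :=
  (gFun_differentiable η).comp (by fun_prop)

theorem zeroFactor_differentiable (η ℓ b γ : ℝ) : Differentiable ℂ (zeroFactor η ℓ b γ) :=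
  ((differentiable_const _).sub (zeroTerm_differentiable _ _ _ _)).mul
    ((differentiable_const _).sub (zeroTerm_differentiable _ _ _ _))

theorem re_zeroTerm_arg (s : ℂ) : ((ℓ : ℂ) * (s - b - γ * Complex.I)).re = ℓ * (s.re - b) := by
  rw [Complex.re_ofReal_mul]; simp

theorem im_zeroTerm_arg (s : ℂ) : ((ℓ : ℂ) * (s - b - γ * Complex.I)).im = ℓ * (s.im - γ) := by
  rw [Complex.im_ofReal_mul]; simp

theorem norm_zeroTerm_lt_one (hη : 0 < η) (hℓ : 0 < ℓ) {s : ℂ} (hs : b < s.re) :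
    ‖zeroTerm η ℓ b γ s‖ < 1 :=
  norm_gFun_lt_one hη (by rw [re_zeroTerm_arg]; exact mul_pos hℓ (by linarith))

theorem zeroFactor_ne_zero (hη : 0 < η) (hℓ : 0 < ℓ) {s : ℂ} (hs : b < s.re) :
    zeroFactor η ℓ b γ s ≠ 0 := by
  have h : ∀ γ, 1 - zeroTerm η ℓ b γ s ≠ 0 := by
    intro γ h
    have h1 := norm_zeroTerm_lt_one (γ := γ) hη hℓ hs
    rw [← sub_eq_zero.mp h, norm_one] at h1
    exact lt_irrefl _ h1
  exact mul_ne_zero (h _) (h _)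

theorem zeroFactor_zero (hη : 0 < η) : zeroFactor η ℓ b γ (b + γ * Complex.I) = 0 := by
  rw [zeroFactor, zeroTerm]
  simp [gFun_zero hη]

theorem scaleMass_pos : 0 < scaleMass η τ ℓ b := Real.exp_pos _

theorem norm_zeroTerm_le (hη : 0 < η) (hℓ : 4 / η ≤ ℓ) (hb : b ≤ 1) {s : ℂ} (hτ : τ < 1)
    (hs : τ ≤ s.re) :
    ‖zeroTerm η ℓ b γ s‖ ≤ scaleMass η τ ℓ b * scaleHeight τ ℓ * (2 / (1 + (s.im - γ) ^ 2)) := by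
  have hℓ0 : 0 < ℓ := lt_of_lt_of_le (by positivity) hℓ
  refine (norm_gFun_le hη _).trans ?_
  rw [re_zeroTerm_arg, im_zeroTerm_arg]
  have h1 : 1 ≤ η / 4 * ℓ := by
    rw [div_le_iff₀ hη] at hℓ; linarith
  have h2 : (s.im - γ) ^ 2 ≤ (η / 4 * (ℓ * (s.im - γ))) ^ 2 := by
    have : (η / 4 * (ℓ * (s.im - γ))) ^ 2 = (η / 4 * ℓ) ^ 2 * (s.im - γ) ^ 2 := by ring
    rw [this]
    exact le_mul_of_one_le_left (sq_nonneg _) (one_le_pow₀ h1)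
  have h3 : ℓ * τ ≤ ℓ * s.re := mul_le_mul_of_nonneg_left hs hℓ0.le
  have hηℓ : 0 ≤ η * ℓ := by positivity
  rw [scaleMass, scaleHeight, ← Real.exp_add]
  gcongr
  refine max_le (Real.exp_le_exp.mpr ?_) (Real.exp_le_exp.mpr ?_)
  · nlinarith [mul_nonneg hηℓ (by linarith : 0 ≤ 1 - τ)]
  · nlinarith [mul_le_mul_of_nonneg_left hs hηℓ, mul_le_mul_of_nonneg_left hb hηℓ]

theorem height_mul_le {T ε x : ℝ} (hε : 0 ≤ ε) (hx : T / 2 ≤ |x|) :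
    ε * T * (2 / (1 + x ^ 2)) ≤ 2 * ε := by
  rw [mul_div_assoc', div_le_iff₀ (by positivity), ← sq_abs x]
  have : T ≤ 1 + |x| ^ 2 := by nlinarith [sq_nonneg (|x| - 1)]
  nlinarith [mul_le_mul_of_nonneg_left this hε]

theorem norm_zeroTerm_le_linear (hη : 0 < η) (hℓ : 4 / η ≤ ℓ) (hb : b ≤ 1) {s : ℂ} (hτ : τ < 1)
    (hs : τ ≤ s.re) (hγ : scaleHeight τ ℓ ≤ |γ|) :
    ‖zeroTerm η ℓ b γ s‖ ≤ 4 * scaleMass η τ ℓ b * (1 + |s.im|) := by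
  refine (norm_zeroTerm_le hη hℓ hb hτ hs).trans ?_
  set T := scaleHeight τ ℓ
  set ε := scaleMass η τ ℓ b
  have hT0 : 0 ≤ T := (Real.exp_pos _).le
  have hε0 : 0 ≤ ε := (Real.exp_pos _).le
  have ht := abs_nonneg s.im
  rcases le_total (T / 2) |s.im| with h | h
  · calc ε * T * (2 / (1 + (s.im - γ) ^ 2)) ≤ ε * T * 2 := by
          gcongr
          exact div_le_self (by norm_num) (by nlinarith [sq_nonneg (s.im - γ)])
      _ ≤ _ := by nlinarith
  · have h1 : T / 2 ≤ |s.im - γ| := by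
      have := abs_sub_abs_le_abs_sub γ s.im
      rw [abs_sub_comm] at this
      linarith
    refine (height_mul_le hε0 h1).trans ?_
    nlinarith [mul_nonneg hε0 ht]

theorem norm_zeroFactor_sub_one_le (hη : 0 < η) (hℓ : 4 / η ≤ ℓ) (hb : b ≤ 1) {s : ℂ} (hτ : τ < 1)
    (hs : τ ≤ s.re) (hγ : scaleHeight τ ℓ ≤ |γ|) :
    ‖zeroFactor η ℓ b γ s - 1‖ ≤ (1 + 4 * scaleMass η τ ℓ b * (1 + |s.im|)) ^ 2 - 1 := by
  have h1 := norm_zeroTerm_le_linear hη hℓ hb hτ hs hγ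
  have h2 := norm_zeroTerm_le_linear hη hℓ hb hτ hs (γ := -γ) (by rwa [abs_neg])
  have e : zeroFactor η ℓ b γ s - 1 = -zeroTerm η ℓ b γ s - zeroTerm η ℓ b (-γ) s
      + zeroTerm η ℓ b γ s * zeroTerm η ℓ b (-γ) s := by
    rw [zeroFactor]; ring
  rw [e]
  have h3 := norm_add_le (-zeroTerm η ℓ b γ s - zeroTerm η ℓ b (-γ) s)
    (zeroTerm η ℓ b γ s * zeroTerm η ℓ b (-γ) s)
  have h4 := norm_sub_le (-zeroTerm η ℓ b γ s) (zeroTerm η ℓ b (-γ) s)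
  rw [norm_neg] at h4
  rw [norm_mul] at h3
  have h5 := mul_le_mul h1 h2 (norm_nonneg _) ((norm_nonneg _).trans h1)
  nlinarith

theorem norm_zeroFactor_le (hη : 0 < η) (hℓ : 4 / η ≤ ℓ) (hb : b ≤ 1) {s : ℂ} (hτ : τ < 1)
    (hs : τ ≤ s.re) (hγ : scaleHeight τ ℓ ≤ |γ|) :
    ‖zeroFactor η ℓ b γ s‖ ≤ Real.exp (8 * (1 + |s.im|) * scaleMass η τ ℓ b) := by
  have h1 := norm_zeroFactor_sub_one_le hη hℓ hb hτ hs hγ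
  have h2 : ‖zeroFactor η ℓ b γ s‖ ≤ ‖zeroFactor η ℓ b γ s - 1‖ + 1 := by
    simpa using norm_add_le (zeroFactor η ℓ b γ s - 1) 1
  have h3 : 1 + 4 * scaleMass η τ ℓ b * (1 + |s.im|)
      ≤ Real.exp (4 * scaleMass η τ ℓ b * (1 + |s.im|)) := by
    linarith [Real.add_one_le_exp (4 * scaleMass η τ ℓ b * (1 + |s.im|))]
  have h0 : 0 ≤ 4 * scaleMass η τ ℓ b * (1 + |s.im|) := by
    have := scaleMass_pos (η := η) (τ := τ) (ℓ := ℓ) (b := b)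
    have := abs_nonneg s.im
    positivity
  calc _ ≤ (1 + 4 * scaleMass η τ ℓ b * (1 + |s.im|)) ^ 2 := by linarith
    _ ≤ Real.exp (4 * scaleMass η τ ℓ b * (1 + |s.im|)) ^ 2 := by gcongr
    _ = _ := by rw [← Real.exp_nat_mul]; congr 1; push_cast; ring

/-- Pointwise bound used for averaging over the ordinate `γ`. -/
theorem norm_zeroFactor_le_cauchy (hη : 0 < η) (hℓ : 4 / η ≤ ℓ) (hb : b ≤ 1) {s : ℂ} (hτ : τ < 1)
    (hs : τ ≤ s.re) (hγ : scaleHeight τ ℓ ≤ γ) (hε : 2 * scaleMass η τ ℓ b ≤ 1) :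
    ‖zeroFactor η ℓ b γ s‖ ≤ 1 + 4 * (scaleMass η τ ℓ b * scaleHeight τ ℓ) *
      ((1 + (s.im - γ) ^ 2)⁻¹ + (1 + (s.im + γ) ^ 2)⁻¹) := by
  have h1 := norm_zeroTerm_le (γ := γ) hη hℓ hb hτ hs
  have h2 := norm_zeroTerm_le (γ := -γ) hη hℓ hb hτ hs
  rw [sub_neg_eq_add] at h2
  set T := scaleHeight τ ℓ
  set ε := scaleMass η τ ℓ b
  have hT0 : 0 ≤ T := (Real.exp_pos _).le
  have hε0 : 0 ≤ ε := (Real.exp_pos _).le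
  have hmin : ‖zeroTerm η ℓ b γ s‖ ≤ 1 ∨ ‖zeroTerm η ℓ b (-γ) s‖ ≤ 1 := by
    rcases le_total 0 s.im with h | h
    · right
      refine h2.trans ((height_mul_le hε0 ?_).trans hε)
      rw [abs_of_nonneg (by linarith)]; linarith
    · left
      refine h1.trans ((height_mul_le hε0 ?_).trans hε)
      rw [abs_of_nonpos (by linarith)]; linarith
  set x := ‖zeroTerm η ℓ b γ s‖ with hx
  set y := ‖zeroTerm η ℓ b (-γ) s‖ with hy
  have hx0 : 0 ≤ x := norm_nonneg _
  have hy0 : 0 ≤ y := norm_nonneg _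
  have hxy : x * y ≤ x + y := by
    rcases hmin with h | h
    · nlinarith
    · nlinarith
  rw [zeroFactor, norm_mul]
  have n1 : ‖1 - zeroTerm η ℓ b γ s‖ ≤ 1 + x := by simpa using norm_sub_le 1 (zeroTerm η ℓ b γ s)
  have n2 : ‖1 - zeroTerm η ℓ b (-γ) s‖ ≤ 1 + y := by
    simpa using norm_sub_le 1 (zeroTerm η ℓ b (-γ) s)
  rw [div_eq_mul_inv] at h1 h2
  calc _ ≤ (1 + x) * (1 + y) := by gcongr
    _ ≤ 1 + 2 * (x + y) := by nlinarith
    _ ≤ _ := by nlinarith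

end ZeroFactor

end

section

open Filter Topology MeasureTheory
open scoped ENNReal

section Product

theorem isOpen_re_gt (τ : ℝ) : IsOpen {s : ℂ | τ < s.re} :=
  isOpen_lt continuous_const Complex.continuous_re

theorem differentiableOn_tprod_of_le {τ : ℝ} {f : ℕ → ℂ → ℂ} (hf : ∀ k, Differentiable ℂ (f k))
    {ε : ℕ → ℝ} (hε : Summable ε) (hε0 : ∀ k, 0 ≤ ε k)
    (h : ∀ k s, τ < s.re → ‖f k s - 1‖ ≤ ε k * (1 + |s.im|) ^ 2) :
    DifferentiableOn ℂ (fun s => ∏' k, f k s) {s : ℂ | τ < s.re} := by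
  intro s hs
  set U : Set ℂ := {z : ℂ | τ < z.re} ∩ {z : ℂ | |z.im| < |s.im| + 1} with hU
  have hUo : IsOpen U := (isOpen_re_gt τ).inter
    (isOpen_lt (Complex.continuous_im.abs) continuous_const)
  have hsU : s ∈ U := ⟨hs, by simp⟩
  have hp := Summable.hasProdLocallyUniformlyOn_nat_one_add (f := fun k z => f k z - 1) (K := U) hUo
    (hε.mul_right ((1 + (|s.im| + 1)) ^ 2)) (Eventually.of_forall fun k z hz => by
      refine (h k z hz.1).trans ?_
      have hz2 : |z.im| < |s.im| + 1 := hz.2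
      have := hε0 k
      gcongr) (fun k => ((hf k).sub_const 1).continuous.continuousOn)
  have hd : DifferentiableOn ℂ (fun z => ∏' k, (1 + (f k z - 1))) U := by
    refine hp.differentiableOn (Eventually.of_forall fun F => ?_) hUo
    simpa [Finset.prod_fn] using DifferentiableOn.finsetProd
      (fun i _ => ((differentiable_const (1 : ℂ)).add ((hf i).sub_const 1)).differentiableOn)
  simp only [add_sub_cancel] at hd
  exact (hd.differentiableAt (hUo.mem_nhds hsU)).differentiableWithinAt

theorem tendsto_prod_range_of_summable {z : ℕ → ℂ} (h : Summable fun k => ‖z k - 1‖) :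
    Tendsto (fun J => ∏ k ∈ Finset.range J, z k) atTop (𝓝 (∏' k, z k)) := by
  have := (multipliable_one_add_of_summable h).hasProd.tendsto_prod_nat
  simpa only [add_sub_cancel] using this

theorem tprod_eq_zero_of_summable {z : ℕ → ℂ} (h : Summable fun k => ‖z k - 1‖) {k : ℕ}
    (hk : z k = 0) : ∏' k, z k = 0 := by
  refine tendsto_nhds_unique (tendsto_prod_range_of_summable h) ?_
  refine tendsto_const_nhds.congr' ?_
  filter_upwards [eventually_gt_atTop k] with J hJ
  exact (Finset.prod_eq_zero (Finset.mem_range.mpr hJ) hk).symm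

theorem tprod_ne_zero_of_summable {z : ℕ → ℂ} (h : Summable fun k => ‖z k - 1‖)
    (hk : ∀ k, z k ≠ 0) : ∏' k, z k ≠ 0 := by
  have := tprod_one_add_ne_zero_of_summable (f := fun k => z k - 1)
    (fun k => by simpa using hk k) h
  simpa only [add_sub_cancel] using this

theorem norm_tprod_le_exp {z : ℕ → ℂ} (h : Summable fun k => ‖z k - 1‖) {ε : ℕ → ℝ}
    (hε : Summable ε) (hε0 : ∀ k, 0 ≤ ε k) (hz : ∀ k, ‖z k‖ ≤ Real.exp (ε k)) :
    ‖∏' k, z k‖ ≤ Real.exp (∑' k, ε k) := by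
  refine le_of_tendsto (tendsto_prod_range_of_summable h).norm (Eventually.of_forall fun J => ?_)
  rw [norm_prod]
  calc _ ≤ ∏ k ∈ Finset.range J, Real.exp (ε k) :=
        Finset.prod_le_prod (fun _ _ => norm_nonneg _) fun k _ => hz k
    _ = Real.exp (∑ k ∈ Finset.range J, ε k) := (Real.exp_sum _ _).symm
    _ ≤ _ := Real.exp_le_exp.mpr (hε.sum_le_tsum _ fun k _ => hε0 k)

end Product

/-- Admissible sequences of scales `ℓ` and abscissas `b`. -/
structure ScaleData (η τ β : ℝ) (ℓ b : ℕ → ℝ) : Prop where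
  η_pos : 0 < η
  η_le : η ≤ 1
  half_lt : 1 / 2 < τ
  lt_one : β < 1
  scale_le : ∀ k, 4 / η ≤ ℓ k
  b_le : ∀ k, b k ≤ β
  summable : Summable fun k => scaleMass η τ (ℓ k) (b k)
  tsum_le : ∑' k, scaleMass η τ (ℓ k) (b k) ≤ η / 64

namespace ScaleData

variable {η τ β : ℝ} {ℓ b γ : ℕ → ℝ}

theorem mass_le (h : ScaleData η τ β ℓ b) (k : ℕ) : scaleMass η τ (ℓ k) (b k) ≤ 1 / 64 :=
  (h.summable.le_tsum k fun _ _ => scaleMass_pos.le).trans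
    (h.tsum_le.trans (by linarith [h.η_le]))

theorem scale_pos (h : ScaleData η τ β ℓ b) (k : ℕ) : 0 < ℓ k :=
  lt_of_lt_of_le (div_pos (by norm_num) h.η_pos) (h.scale_le k)

theorem b_le_one (h : ScaleData η τ β ℓ b) (k : ℕ) : b k ≤ 1 := (h.b_le k).trans h.lt_one.le

/-- The product over all the prescribed zeros. -/
noncomputable def zeroProd (η : ℝ) (ℓ b γ : ℕ → ℝ) (s : ℂ) : ℂ :=
  ∏' k, zeroFactor η (ℓ k) (b k) (γ k) s

theorem norm_sub_one_le (h : ScaleData η τ β ℓ b) (hτ : τ < 1)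
    (hγ : ∀ k, scaleHeight τ (ℓ k) ≤ |γ k|) (k : ℕ) {s : ℂ} (hs : τ ≤ s.re) :
    ‖zeroFactor η (ℓ k) (b k) (γ k) s - 1‖
      ≤ 24 * scaleMass η τ (ℓ k) (b k) * (1 + |s.im|) ^ 2 := by
  refine (norm_zeroFactor_sub_one_le h.η_pos (h.scale_le k) (h.b_le_one k) hτ hs (hγ k)).trans ?_
  have h1 := h.mass_le k
  have h2 : 0 < scaleMass η τ (ℓ k) (b k) := scaleMass_pos
  set ε := scaleMass η τ (ℓ k) (b k)
  have h3 : (1 : ℝ) ≤ 1 + |s.im| := by linarith [abs_nonneg s.im]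
  set x := 1 + |s.im|
  nlinarith [mul_le_mul_of_nonneg_left (by nlinarith : x ≤ x ^ 2) h2.le,
    mul_le_mul_of_nonneg_right h1 (mul_nonneg h2.le (sq_nonneg x))]

theorem summable_norm_sub_one (h : ScaleData η τ β ℓ b) (hτ : τ < 1)
    (hγ : ∀ k, scaleHeight τ (ℓ k) ≤ |γ k|) {s : ℂ} (hs : τ ≤ s.re) :
    Summable fun k => ‖zeroFactor η (ℓ k) (b k) (γ k) s - 1‖ :=
  Summable.of_nonneg_of_le (fun _ => norm_nonneg _)
    (fun k => h.norm_sub_one_le hτ hγ k hs) ((h.summable.mul_left 24).mul_right _)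

theorem zeroProd_differentiableOn (h : ScaleData η τ β ℓ b) (hτ : τ < 1)
    (hγ : ∀ k, scaleHeight τ (ℓ k) ≤ |γ k|) :
    DifferentiableOn ℂ (zeroProd η ℓ b γ) {s : ℂ | τ < s.re} :=
  differentiableOn_tprod_of_le (fun _ => zeroFactor_differentiable _ _ _ _)
    (h.summable.mul_left 24) (fun _ => mul_nonneg (by norm_num) scaleMass_pos.le)
    (fun k _ hs => h.norm_sub_one_le hτ hγ k hs.le)

theorem norm_zeroProd_le (h : ScaleData η τ β ℓ b) (hτ : τ < 1)
    (hγ : ∀ k, scaleHeight τ (ℓ k) ≤ |γ k|) {s : ℂ} (hs : τ ≤ s.re) :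
    ‖zeroProd η ℓ b γ s‖ ≤ Real.exp (1 + |s.im|) := by
  have hs0 : (0 : ℝ) ≤ 1 + |s.im| := by linarith [abs_nonneg s.im]
  refine (norm_tprod_le_exp (h.summable_norm_sub_one hτ hγ hs)
    (h.summable.mul_left (8 * (1 + |s.im|)))
    (fun _ => mul_nonneg (by positivity) scaleMass_pos.le)
    (fun k => norm_zeroFactor_le h.η_pos (h.scale_le k) (h.b_le_one k) hτ hs (hγ k))).trans ?_
  rw [tsum_mul_left]
  refine Real.exp_le_exp.mpr ?_
  have := h.tsum_le
  have := h.η_le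
  nlinarith

theorem zeroProd_eq_zero (h : ScaleData η τ β ℓ b) (hτ : τ < 1)
    (hγ : ∀ k, scaleHeight τ (ℓ k) ≤ |γ k|) (k : ℕ) (hk : τ ≤ b k) :
    zeroProd η ℓ b γ (b k + γ k * Complex.I) = 0 :=
  tprod_eq_zero_of_summable (h.summable_norm_sub_one hτ hγ (by simpa using hk)) (k := k)
    (zeroFactor_zero h.η_pos)

theorem zeroProd_ne_zero (h : ScaleData η τ β ℓ b) (hτ : τ < 1)
    (hγ : ∀ k, scaleHeight τ (ℓ k) ≤ |γ k|) {s : ℂ} (hs : τ ≤ s.re) (hβ : β < s.re) :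
    zeroProd η ℓ b γ s ≠ 0 :=
  tprod_ne_zero_of_summable (h.summable_norm_sub_one hτ hγ hs)
    fun k => zeroFactor_ne_zero h.η_pos (h.scale_pos k) ((h.b_le k).trans_lt hβ)

end ScaleData

end

section

open Filter Topology MeasureTheory
open scoped ENNReal

section Averaging

theorem exists_seq_lintegral_lt_top {W : ℝ → ℝ≥0∞} (hW : Measurable W) (hWi : ∫⁻ t, W t < ∞)
    (hWt : ∀ t, W t ≠ ∞) (μ : ℕ → Measure ℝ)
    [∀ j, IsProbabilityMeasure (μ j)] [∀ j, NullSingletonClass (μ j)] {s : ℕ → Set ℝ}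
    (hs : ∀ j, μ j (s j)ᶜ = 0) {F : ℕ → ℝ → ℝ → ℂ}
    (hF : ∀ j, Measurable (Function.uncurry (F j))) {e : ℕ → ℝ} (he : Summable e)
    (he0 : ∀ j, 0 ≤ e j)
    (hc : ∀ j t, ∫⁻ u, ENNReal.ofReal ‖F j u t‖ ∂μ j ≤ ENNReal.ofReal (Real.exp (e j))) :
    ∃ u : ℕ → ℝ, Function.Injective u ∧ (∀ j, u j ∈ s j) ∧ ∀ G : ℝ → ℂ,
      (∀ t, Tendsto (fun J => ∏ j ∈ Finset.range J, F j (u j) t) atTop (𝓝 (G t))) →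
      ∫⁻ t, W t * ENNReal.ofReal ‖G t‖ < ∞ := by
  obtain ⟨u, hu, hus, hb⟩ := exists_seq_lintegral_prod_le hW μ hs
    (V := fun j u t => ENNReal.ofReal ‖F j u t‖)
    (fun j => ENNReal.measurable_ofReal.comp (hF j).norm) hc
  refine ⟨u, hu, hus, fun G hG => ?_⟩
  have hprod : ∀ J, (∏ j ∈ Finset.range J, ENNReal.ofReal (Real.exp (e j)))
      ≤ ENNReal.ofReal (Real.exp (∑' j, e j)) := by
    intro J
    rw [← ENNReal.ofReal_prod_of_nonneg (fun _ _ => (Real.exp_pos _).le), ← Real.exp_sum]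
    exact ENNReal.ofReal_le_ofReal (Real.exp_le_exp.mpr (he.sum_le_tsum _ fun j _ => he0 j))
  refine (lintegral_mul_le_of_tendsto_prod hW
    (V := fun j t => ENNReal.ofReal ‖F j (u j) t‖)
    (fun j => ENNReal.measurable_ofReal.comp ((hF j).comp measurable_prodMk_left).norm)
    (B := ENNReal.ofReal (Real.exp (∑' j, e j)) * ∫⁻ t, W t)
    (fun J => (hb J).trans (by gcongr; exact hprod J)) fun t => ?_).trans_lt
      (ENNReal.mul_lt_top ENNReal.ofReal_lt_top hWi)
  refine ENNReal.Tendsto.const_mul ?_ (Or.inr (hWt t))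
  have h1 := (ENNReal.continuous_ofReal.tendsto _).comp ((hG t).norm)
  refine h1.congr fun J => ?_
  simp only [Function.comp, norm_prod]
  rw [ENNReal.ofReal_prod_of_nonneg (fun _ _ => norm_nonneg _)]

theorem integrable_mul_inv_one_add_sq {T : ℝ} (hT : 0 < T) (a : ℝ) :
    Integrable (fun u : ℝ => T * (1 + (a + T * u) ^ 2)⁻¹) := by
  have h := (integrable_inv_one_add_sq.comp_add_left a).comp_mul_left' hT.ne'
  exact h.const_mul T

theorem integral_mul_inv_one_add_sq {T : ℝ} (hT : 0 < T) (a : ℝ) :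
    ∫ u : ℝ, T * (1 + (a + T * u) ^ 2)⁻¹ = Real.pi := by
  rw [integral_const_mul,
    Measure.integral_comp_mul_left (fun u : ℝ => (1 + (a + u) ^ 2)⁻¹) T,
    integral_add_left_eq_self (fun u : ℝ => (1 + u ^ 2)⁻¹) a, integral_univ_inv_one_add_sq,
    abs_of_pos (inv_pos.mpr hT), smul_eq_mul, mul_inv_cancel_left₀ hT.ne']

theorem setIntegral_mul_inv_one_add_sq_le {T : ℝ} (hT : 0 < T) (a : ℝ) (s : Set ℝ) :
    ∫ u in s, T * (1 + (a + T * u) ^ 2)⁻¹ ≤ Real.pi := by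
  rw [← integral_mul_inv_one_add_sq hT a]
  exact setIntegral_le_integral (integrable_mul_inv_one_add_sq hT a)
    (Eventually.of_forall fun u => by positivity)

theorem measurable_one_add_abs_rpow (r : ℝ) : Measurable fun t : ℝ => (1 + |t|) ^ r := by
  fun_prop

theorem integrable_one_add_abs_rpow {δ : ℝ} (hδ : 0 < δ) :
    Integrable fun t : ℝ => (1 + |t|) ^ (-1 - δ) := by
  have := integrable_one_add_norm (E := ℝ) (μ := volume) (r := 1 + δ) (by simpa using hδ)
  refine this.congr (Eventually.of_forall fun t => ?_)
  simp only [Real.norm_eq_abs]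
  congr 1
  ring

end Averaging

namespace ScaleData

variable {η τ β : ℝ} {ℓ b γ : ℕ → ℝ}

theorem lintegral_norm_zeroFactor_le (h : ScaleData η τ β ℓ b) (hτ : τ < 1) {σ : ℝ} (hσ : τ ≤ σ)
    (k : ℕ) (t : ℝ) :
    ∫⁻ u in Set.Icc (0 : ℝ) 1, ENNReal.ofReal
      ‖zeroFactor η (ℓ k) (b k) (scaleHeight τ (ℓ k) * (1 + u)) (σ + t * Complex.I)‖
      ≤ ENNReal.ofReal (Real.exp (8 * Real.pi * scaleMass η τ (ℓ k) (b k))) := by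
  set T := scaleHeight τ (ℓ k)
  set ε := scaleMass η τ (ℓ k) (b k)
  have hT0 : 0 < T := Real.exp_pos _
  have hε0 : 0 < ε := scaleMass_pos
  have hpt : ∀ u ∈ Set.Icc (0 : ℝ) 1,
      ‖zeroFactor η (ℓ k) (b k) (T * (1 + u)) (σ + t * Complex.I)‖ ≤
        1 + 4 * ε * (T * (1 + ((T - t) + T * u) ^ 2)⁻¹ + T * (1 + ((T + t) + T * u) ^ 2)⁻¹) := by
    intro u hu
    have := norm_zeroFactor_le_cauchy (s := σ + t * Complex.I) (γ := T * (1 + u)) h.η_pos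
      (h.scale_le k) (h.b_le_one k) hτ (by simpa using hσ)
      (by nlinarith [hu.1]) (by linarith [h.mass_le k])
    refine this.trans (le_of_eq ?_)
    have e1 : ((σ : ℂ) + t * Complex.I).im = t := by simp
    rw [e1, show (t - T * (1 + u)) ^ 2 = ((T - t) + T * u) ^ 2 by ring,
      show (t + T * (1 + u)) ^ 2 = ((T + t) + T * u) ^ 2 by ring]
    ring
  have i1 := (integrable_mul_inv_one_add_sq hT0 (T - t)).integrableOn (s := Set.Icc (0 : ℝ) 1)
  have i2 := (integrable_mul_inv_one_add_sq hT0 (T + t)).integrableOn (s := Set.Icc (0 : ℝ) 1)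
  have i0 : IntegrableOn (fun _ : ℝ => (1 : ℝ)) (Set.Icc (0 : ℝ) 1) := by simp
  have i12 : IntegrableOn (fun u => T * (1 + ((T - t) + T * u) ^ 2)⁻¹ +
      T * (1 + ((T + t) + T * u) ^ 2)⁻¹) (Set.Icc (0 : ℝ) 1) := i1.add i2
  have i3 : IntegrableOn (fun u => 1 + 4 * ε * (T * (1 + ((T - t) + T * u) ^ 2)⁻¹ +
      T * (1 + ((T + t) + T * u) ^ 2)⁻¹)) (Set.Icc (0 : ℝ) 1) := i0.add (i12.const_mul (4 * ε))
  calc _ ≤ ∫⁻ u in Set.Icc (0 : ℝ) 1, ENNReal.ofReal (1 + 4 * ε *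
        (T * (1 + ((T - t) + T * u) ^ 2)⁻¹ + T * (1 + ((T + t) + T * u) ^ 2)⁻¹)) := by
        refine setLIntegral_mono (by fun_prop) fun u hu => ENNReal.ofReal_le_ofReal (hpt u hu)
    _ = ENNReal.ofReal (∫ u in Set.Icc (0 : ℝ) 1, (1 + 4 * ε *
        (T * (1 + ((T - t) + T * u) ^ 2)⁻¹ + T * (1 + ((T + t) + T * u) ^ 2)⁻¹))) := by
        refine (ofReal_integral_eq_lintegral_ofReal i3 (Eventually.of_forall fun u => ?_)).symm
        simp only [Pi.zero_apply]
        positivity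
    _ ≤ _ := by
        refine ENNReal.ofReal_le_ofReal ?_
        rw [integral_add i0 (i12.const_mul (4 * ε)), integral_const_mul,
          integral_add i1 i2]
        have h1 := setIntegral_mul_inv_one_add_sq_le hT0 (T - t) (Set.Icc (0 : ℝ) 1)
        have h2 := setIntegral_mul_inv_one_add_sq_le hT0 (T + t) (Set.Icc (0 : ℝ) 1)
        have h3 : ∫ _ in Set.Icc (0 : ℝ) 1, (1 : ℝ) = 1 := by simp
        rw [h3]
        have h4 := Real.add_one_le_exp (8 * Real.pi * ε)
        nlinarith

theorem exists_ordinates (h : ScaleData η τ β ℓ b) (hτ : τ < 1) {σ δ : ℝ} (hσ : τ < σ)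
    (hδ : 0 < δ) :
    ∃ γ : ℕ → ℝ, (∃ u : ℕ → ℝ, Function.Injective u ∧ ∀ k, u k ∈ Set.Icc (0 : ℝ) 1 ∧
        γ k = scaleHeight τ (ℓ k) * (1 + u k)) ∧
      Integrable fun t : ℝ => (1 + |t|) ^ (-1 - δ) * ‖zeroProd η ℓ b γ (σ + t * Complex.I)‖ := by
  have hp : IsProbabilityMeasure (volume.restrict (Set.Icc (0 : ℝ) 1)) := ⟨by simp⟩
  have hWi := integrable_one_add_abs_rpow hδ
  obtain ⟨u, hu, hus, hG⟩ := exists_seq_lintegral_lt_top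
    (W := fun t => ENNReal.ofReal ((1 + |t|) ^ (-1 - δ)))
    (ENNReal.measurable_ofReal.comp (measurable_one_add_abs_rpow _))
    (by
      rw [← ofReal_integral_eq_lintegral_ofReal hWi
        (Eventually.of_forall fun t => by simp only [Pi.zero_apply]; positivity)]
      exact ENNReal.ofReal_lt_top)
    (fun _ => ENNReal.ofReal_ne_top)
    (fun _ => volume.restrict (Set.Icc (0 : ℝ) 1)) (s := fun _ => Set.Icc (0 : ℝ) 1)
    (fun _ => by simp)
    (F := fun k u t => zeroFactor η (ℓ k) (b k) (scaleHeight τ (ℓ k) * (1 + u))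
      (σ + t * Complex.I))
    (fun k => by
      refine Continuous.measurable ?_
      have hg := (gFun_differentiable η).continuous
      unfold Function.uncurry zeroFactor zeroTerm
      fun_prop)
    (h.summable.mul_left (8 * Real.pi))
    (fun k => mul_nonneg (by positivity) scaleMass_pos.le)
    (fun k t => h.lintegral_norm_zeroFactor_le hτ hσ.le k t)
  refine ⟨fun k => scaleHeight τ (ℓ k) * (1 + u k), ⟨u, hu, fun k => ⟨hus k, rfl⟩⟩, ?_⟩
  have hγ : ∀ k, scaleHeight τ (ℓ k) ≤ |scaleHeight τ (ℓ k) * (1 + u k)| := fun k => by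
    have h0 : 0 < scaleHeight τ (ℓ k) := Real.exp_pos _
    refine le_trans ?_ (le_abs_self _)
    nlinarith [(hus k).1]
  set γ : ℕ → ℝ := fun k => scaleHeight τ (ℓ k) * (1 + u k) with hγd
  have hfin := hG (fun t => zeroProd η ℓ b γ (σ + t * Complex.I)) fun t =>
    tendsto_prod_range_of_summable (h.summable_norm_sub_one hτ hγ (by simpa using hσ.le))
  refine ⟨((measurable_one_add_abs_rpow _).mul
    (continuous_vertical hσ (h.zeroProd_differentiableOn hτ hγ)).norm.measurable).aestronglyMeasurable, ?_⟩
  rw [hasFiniteIntegral_iff_ofReal (Eventually.of_forall fun t => by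
    simp only [Pi.zero_apply]; positivity)]
  refine lt_of_eq_of_lt (lintegral_congr fun t => ?_) hfin
  exact ENNReal.ofReal_mul (by positivity)

end ScaleData

end

section

open Filter Topology MeasureTheory

section LaplaceTerm

/-- The perturbation of the prime density, in the variable `v = log x`, producing the term
`(g ^ (m + 1)) / (m + 1)` in the logarithm of the zeta function. -/
noncomputable def densityTerm (η ℓ b γ : ℝ) (m : ℕ) (v : ℝ) : ℝ :=
  2 * Real.cos (γ * v) * Real.exp (b * v) * boxPow η (2 * m + 1) (v / ℓ) / ((m + 1) * ℓ)

theorem measurable_densityTerm (η ℓ b γ : ℝ) (m : ℕ) : Measurable (densityTerm η ℓ b γ m) := by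
  have := measurable_boxPow η (2 * m + 1)
  unfold densityTerm
  fun_prop

variable {η ℓ b γ : ℝ}

theorem densityTerm_eq_zero (hℓ : 0 < ℓ) {m : ℕ} {v : ℝ} (hv : v < (m + 1) * ℓ) :
    densityTerm η ℓ b γ m v = 0 := by
  rw [densityTerm, boxPow_eq_zero, mul_zero, zero_div]
  intro h
  have := h.1
  rw [le_div_iff₀ hℓ] at this
  push_cast at this
  nlinarith

theorem abs_densityTerm_le (hη : 0 < η) (hη1 : η ≤ 1) (hℓ : 0 < ℓ) (hb : b ≤ 1) (m : ℕ) {v : ℝ}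
    (hv : 0 < v) :
    |densityTerm η ℓ b γ m v| ≤ 8 / η * (Real.exp v / v) * Real.exp (ℓ * (b - 1)) ^ (m + 1) := by
  have hm : (0 : ℝ) < m + 1 := by positivity
  by_cases h : v / ℓ ∈ Set.Icc (((2 * m + 1 : ℕ) + 1) * (1 / 2) : ℝ)
      (((2 * m + 1 : ℕ) + 1) * ((1 + η) / 2))
  · have h1 := h.1
    have h2 := h.2
    rw [le_div_iff₀ hℓ] at h1
    rw [div_le_iff₀ hℓ] at h2
    push_cast at h1 h2
    have h3 : v / 2 ≤ (m + 1) * ℓ := by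
      nlinarith [mul_le_mul_of_nonneg_left hη1 (mul_pos hm hℓ).le]
    have h4 : b * v ≤ v + (m + 1) * (ℓ * (b - 1)) := by
      nlinarith [mul_le_mul_of_nonneg_left h1 (sub_nonneg.mpr hb)]
    have hbox := boxPow_le hη (2 * m + 1) (v / ℓ)
    have hbox0 := boxPow_nonneg hη (2 * m + 1) (v / ℓ)
    rw [densityTerm, abs_div, abs_mul, abs_mul, abs_mul, abs_of_nonneg hbox0,
      abs_of_pos (mul_pos hm hℓ), Real.abs_exp, abs_two]
    calc 2 * |Real.cos (γ * v)| * Real.exp (b * v) * boxPow η (2 * m + 1) (v / ℓ) / ((m + 1) * ℓ)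
        ≤ 2 * 1 * Real.exp (v + (m + 1) * (ℓ * (b - 1))) * (2 / η) / (v / 2) := by
          gcongr
          exact Real.abs_cos_le_one _
      _ = _ := by
          rw [Real.exp_add, ← Real.exp_nat_mul]
          push_cast
          field_simp
          ring
  · rw [densityTerm, boxPow_eq_zero _ _ h]
    simp only [mul_zero, zero_div, abs_zero]
    positivity

theorem exp_mul_densityTerm (hℓ : 0 < ℓ) (m : ℕ) (s : ℂ) (v : ℝ) :
    Complex.exp (-(s * v)) * densityTerm η ℓ b γ m v =
      (Complex.exp (-((v / ℓ : ℝ) * (ℓ * (s - b - γ * Complex.I)))) * boxPow η (2 * m + 1) (v / ℓ)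
        + Complex.exp (-((v / ℓ : ℝ) * (ℓ * (s - b - (-γ : ℝ) * Complex.I))))
          * boxPow η (2 * m + 1) (v / ℓ)) / ((m + 1) * ℓ) := by
  have hℓ' : (ℓ : ℂ) ≠ 0 := by exact_mod_cast hℓ.ne'
  have e1 : -(((v / ℓ : ℝ) : ℂ) * (ℓ * (s - b - γ * Complex.I)))
      = -(s * v) + b * v + (γ * v : ℂ) * Complex.I := by
    push_cast; field_simp; ring
  have e2 : -(((v / ℓ : ℝ) : ℂ) * (ℓ * (s - b - (-γ : ℝ) * Complex.I)))
      = -(s * v) + b * v + -(γ * v : ℂ) * Complex.I := by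
    push_cast; field_simp; ring
  rw [e1, e2, Complex.exp_add (-(s * v) + b * v), Complex.exp_add (-(s * v) + b * v),
    Complex.exp_add (-(s * v)), densityTerm]
  push_cast
  rw [Complex.two_cos]
  ring

theorem integrable_exp_mul_densityTerm (hη : 0 < η) (hℓ : 0 < ℓ) (m : ℕ) (s : ℂ) :
    Integrable fun v : ℝ => Complex.exp (-(s * v)) * densityTerm η ℓ b γ m v := by
  simp_rw [exp_mul_densityTerm hℓ]
  have := (((integrable_exp_mul_boxPow hη (2 * m + 1) (ℓ * (s - b - γ * Complex.I))).add
    (integrable_exp_mul_boxPow hη (2 * m + 1)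
      (ℓ * (s - b - (-γ : ℝ) * Complex.I)))).div_const ((m + 1) * ℓ : ℂ)).comp_div hℓ.ne'
  exact this

theorem integral_exp_mul_densityTerm (hη : 0 < η) (hℓ : 0 < ℓ) (m : ℕ) (s : ℂ) :
    ∫ v : ℝ, Complex.exp (-(s * v)) * densityTerm η ℓ b γ m v =
      zeroTerm η ℓ b γ s ^ (m + 1) / (m + 1) + zeroTerm η ℓ b (-γ) s ^ (m + 1) / (m + 1) := by
  simp_rw [exp_mul_densityTerm hℓ]
  have i1 := integrable_exp_mul_boxPow hη (2 * m + 1) (ℓ * (s - b - γ * Complex.I))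
  have i2 := integrable_exp_mul_boxPow hη (2 * m + 1) (ℓ * (s - b - (-γ : ℝ) * Complex.I))
  have hℓ' : (ℓ : ℂ) ≠ 0 := by exact_mod_cast hℓ.ne'
  have hm : (m + 1 : ℂ) ≠ 0 := by exact_mod_cast Nat.succ_ne_zero m
  have key := Measure.integral_comp_div (fun u : ℝ =>
    (Complex.exp (-(u * (ℓ * (s - b - γ * Complex.I)))) * boxPow η (2 * m + 1) u
        + Complex.exp (-(u * (ℓ * (s - b - (-γ : ℝ) * Complex.I))))
          * boxPow η (2 * m + 1) u) / ((m + 1) * ℓ : ℂ)) ℓ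
  refine key.trans ?_
  rw [integral_div, integral_add i1 i2, integral_exp_mul_boxPow hη, integral_exp_mul_boxPow hη,
    abs_of_pos hℓ, Complex.real_smul, zeroTerm, zeroTerm, gFun, gFun, ← pow_mul, ← pow_mul,
    show 2 * m + 1 + 1 = 2 * (m + 1) by ring]
  field_simp

theorem hasSum_zeroTerm_pow (hη : 0 < η) (hℓ : 0 < ℓ) {s : ℂ} (hs : b < s.re) :
    HasSum (fun m : ℕ => zeroTerm η ℓ b γ s ^ (m + 1) / (m + 1)
        + zeroTerm η ℓ b (-γ) s ^ (m + 1) / (m + 1))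
      (-(Complex.log (1 - zeroTerm η ℓ b γ s) + Complex.log (1 - zeroTerm η ℓ b (-γ) s))) := by
  rw [neg_add]
  exact (Complex.hasSum_taylorSeries_neg_log' (norm_zeroTerm_lt_one hη hℓ hs)).add
    (Complex.hasSum_taylorSeries_neg_log' (norm_zeroTerm_lt_one hη hℓ hs))

theorem exp_log_zeroTerm (hη : 0 < η) (hℓ : 0 < ℓ) {s : ℂ} (hs : b < s.re) :
    Complex.exp (Complex.log (1 - zeroTerm η ℓ b γ s) + Complex.log (1 - zeroTerm η ℓ b (-γ) s))
      = zeroFactor η ℓ b γ s := by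
  have h := zeroFactor_ne_zero (γ := γ) hη hℓ hs
  rw [zeroFactor] at h
  rw [Complex.exp_add, Complex.exp_log (left_ne_zero_of_mul h),
    Complex.exp_log (right_ne_zero_of_mul h), zeroFactor]

end LaplaceTerm

namespace ScaleData

variable {η τ β : ℝ} {ℓ b γ : ℕ → ℝ}

/-- The total perturbation of the prime density. -/
noncomputable def perturbation (η : ℝ) (ℓ b γ : ℕ → ℝ) (v : ℝ) : ℝ :=
  ∑' p : ℕ × ℕ, densityTerm η (ℓ p.1) (b p.1) (γ p.1) p.2 v

theorem measurable_perturbation : Measurable (perturbation η ℓ b γ) :=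
  Measurable.tsum fun _ => measurable_densityTerm _ _ _ _ _

theorem abs_term_le (h : ScaleData η τ β ℓ b) (hτ : τ < 1) (p : ℕ × ℕ) {v : ℝ} (hv : 0 < v) :
    |densityTerm η (ℓ p.1) (b p.1) (γ p.1) p.2 v| ≤
      8 / η * (Real.exp v / v) * (scaleMass η τ (ℓ p.1) (b p.1) * (1 / 2) ^ p.2) := by
  refine (abs_densityTerm_le h.η_pos h.η_le (h.scale_pos _) (h.b_le_one _) _ hv).trans ?_
  have hη := h.η_pos
  have h1 : Real.exp (ℓ p.1 * (b p.1 - 1)) ≤ scaleMass η τ (ℓ p.1) (b p.1) := by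
    rw [scaleMass, Real.exp_le_exp]
    have := mul_nonneg hη.le (mul_nonneg (h.scale_pos p.1).le (sub_nonneg.mpr hτ.le))
    linarith
  have h2 : Real.exp (ℓ p.1 * (b p.1 - 1)) ≤ 1 / 2 := h1.trans ((h.mass_le _).trans (by norm_num))
  have h3 : 0 < scaleMass η τ (ℓ p.1) (b p.1) := scaleMass_pos
  rw [pow_succ']
  gcongr

theorem summable_majorant (h : ScaleData η τ β ℓ b) :
    Summable fun p : ℕ × ℕ => scaleMass η τ (ℓ p.1) (b p.1) * (1 / 2 : ℝ) ^ p.2 :=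
  h.summable.mul_of_nonneg summable_geometric_two (fun _ => scaleMass_pos.le)
    (fun _ => by positivity)

theorem tsum_majorant_le (h : ScaleData η τ β ℓ b) :
    ∑' p : ℕ × ℕ, scaleMass η τ (ℓ p.1) (b p.1) * (1 / 2 : ℝ) ^ p.2 ≤ η / 32 := by
  have := h.summable.tsum_mul_tsum summable_geometric_two h.summable_majorant
  rw [← this, tsum_geometric_two]
  linarith [h.tsum_le]

theorem abs_perturbation_le (h : ScaleData η τ β ℓ b) (hτ : τ < 1) {v : ℝ} (hv : 0 < v) :
    |perturbation η ℓ b γ v| ≤ 1 / 4 * (Real.exp v / v) := by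
  have hη := h.η_pos
  have hs := h.summable_majorant.mul_left (8 / η * (Real.exp v / v))
  have h1 : ‖perturbation η ℓ b γ v‖ ≤ _ := tsum_of_norm_bounded hs.hasSum
    fun p => h.abs_term_le hτ p hv
  refine h1.trans ?_
  rw [tsum_mul_left]
  calc _ ≤ 8 / η * (Real.exp v / v) * (η / 32) := by
        gcongr
        exact h.tsum_majorant_le
    _ = _ := by field_simp; norm_num

theorem term_eq_zero (h : ScaleData η τ β ℓ b) (p : ℕ × ℕ) {v : ℝ} (hv : v ≤ 1) :
    densityTerm η (ℓ p.1) (b p.1) (γ p.1) p.2 v = 0 := by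
  refine densityTerm_eq_zero (h.scale_pos _) (hv.trans_lt ?_)
  have h1 : 4 ≤ ℓ p.1 := le_trans (by
    rw [le_div_iff₀ h.η_pos]; linarith [h.η_le]) (h.scale_le p.1)
  have h2 : (0 : ℝ) ≤ p.2 := Nat.cast_nonneg _
  nlinarith

theorem hasSum_integral_perturbation (h : ScaleData η τ β ℓ b) (hτ : τ < 1) {s : ℂ}
    (hs : 1 < s.re) :
    HasSum (fun p : ℕ × ℕ => zeroTerm η (ℓ p.1) (b p.1) (γ p.1) s ^ (p.2 + 1) / (p.2 + 1)
        + zeroTerm η (ℓ p.1) (b p.1) (-γ p.1) s ^ (p.2 + 1) / (p.2 + 1))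
      (∫ v : ℝ in Set.Ioi 1, Complex.exp (-(s * v)) * perturbation η ℓ b γ v) := by
  have hη := h.η_pos
  set F : ℕ × ℕ → ℝ → ℂ := fun p v =>
    Complex.exp (-(s * v)) * densityTerm η (ℓ p.1) (b p.1) (γ p.1) p.2 v with hF
  have hint : ∀ p, Integrable (F p) := fun p =>
    integrable_exp_mul_densityTerm hη (h.scale_pos _) _ _
  have hrestr : ∀ p, ∫ v in Set.Ioi 1, F p v = ∫ v, F p v := fun p =>
    setIntegral_eq_integral_of_forall_compl_eq_zero fun v hv => by
      simp only [hF]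
      rw [h.term_eq_zero p (not_lt.mp hv), Complex.ofReal_zero, mul_zero]
  have hdom : IntegrableOn (fun v : ℝ => Real.exp (-(s.re - 1) * v)) (Set.Ioi 1) :=
    exp_neg_integrableOn_Ioi _ (by linarith)
  have hnorm : ∀ p, ∀ v ∈ Set.Ioi (1 : ℝ), ‖F p v‖ ≤ 8 / η *
      (scaleMass η τ (ℓ p.1) (b p.1) * (1 / 2) ^ p.2) * Real.exp (-(s.re - 1) * v) := by
    intro p v hv
    have hv1 : (1 : ℝ) < v := hv
    have hm : 0 < scaleMass η τ (ℓ p.1) (b p.1) := scaleMass_pos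
    rw [norm_mul, Complex.norm_exp, Complex.norm_real, Real.norm_eq_abs]
    have e1 : (-(s * v)).re = -(s.re * v) := by simp
    rw [e1]
    calc Real.exp (-(s.re * v)) * |densityTerm η (ℓ p.1) (b p.1) (γ p.1) p.2 v|
        ≤ Real.exp (-(s.re * v)) * (8 / η * (Real.exp v / 1) *
          (scaleMass η τ (ℓ p.1) (b p.1) * (1 / 2) ^ p.2)) := by
          refine mul_le_mul_of_nonneg_left ((h.abs_term_le hτ p (by linarith)).trans ?_)
            (Real.exp_pos _).le
          gcongr
      _ = _ := by
          rw [show -(s.re - 1) * v = -(s.re * v) + v by ring, Real.exp_add]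
          ring
  have hsum : Summable fun p => ∫ v in Set.Ioi 1, ‖F p v‖ := by
    refine Summable.of_nonneg_of_le (fun p => integral_nonneg fun v => norm_nonneg _)
      (fun p => setIntegral_mono_on (hint p).integrableOn.norm
        (hdom.const_mul (8 / η * (scaleMass η τ (ℓ p.1) (b p.1) * (1 / 2) ^ p.2)))
        measurableSet_Ioi (hnorm p)) ?_
    simp_rw [integral_const_mul]
    exact (h.summable_majorant.mul_left (8 / η)).mul_right _
  have h1 := hasSum_integral_of_summable_integral_norm (μ := volume.restrict (Set.Ioi 1))
    (fun p => (hint p).integrableOn) hsum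
  have e2 : (fun v : ℝ => ∑' p, F p v) =
      fun v : ℝ => Complex.exp (-(s * v)) * perturbation η ℓ b γ v := by
    ext v
    simp only [hF, perturbation]
    rw [tsum_mul_left, Complex.ofReal_tsum]
  rw [e2] at h1
  refine h1.congr_fun fun p => ?_
  rw [hrestr p]
  exact (integral_exp_mul_densityTerm hη (h.scale_pos _) _ _).symm

theorem exp_neg_integral_perturbation (h : ScaleData η τ β ℓ b) (hτ : τ < 1) {s : ℂ}
    (hs : 1 < s.re) :
    Complex.exp (-∫ v : ℝ in Set.Ioi 1, Complex.exp (-(s * v)) * perturbation η ℓ b γ v)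
      = zeroProd η ℓ b γ s := by
  have hb : ∀ k, b k < s.re := fun k => (h.b_le_one k).trans_lt hs
  have h0 := h.hasSum_integral_perturbation (γ := γ) hτ hs
  set F : ℕ × ℕ → ℂ := fun p => zeroTerm η (ℓ p.1) (b p.1) (γ p.1) s ^ (p.2 + 1) / (p.2 + 1)
        + zeroTerm η (ℓ p.1) (b p.1) (-γ p.1) s ^ (p.2 + 1) / (p.2 + 1) with hF
  have h4 : ∀ k, HasSum (fun m => F (k, m)) (-(Complex.log (1 - zeroTerm η (ℓ k) (b k) (γ k) s)
      + Complex.log (1 - zeroTerm η (ℓ k) (b k) (-γ k) s))) := by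
    intro k
    have := hasSum_zeroTerm_pow (γ := γ k) h.η_pos (h.scale_pos k) (hb k)
    simpa only [hF] using this
  have h1 : HasSum (fun k => -(Complex.log (1 - zeroTerm η (ℓ k) (b k) (γ k) s)
      + Complex.log (1 - zeroTerm η (ℓ k) (b k) (-γ k) s)))
      (∫ v : ℝ in Set.Ioi 1, Complex.exp (-(s * v)) * perturbation η ℓ b γ v) :=
    HasSum.prod_fiberwise h0 h4
  have h2 := h1.neg.cexp
  have h3 : (Complex.exp ∘ fun k => - -(Complex.log (1 - zeroTerm η (ℓ k) (b k) (γ k) s)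
      + Complex.log (1 - zeroTerm η (ℓ k) (b k) (-γ k) s)))
      = fun k => zeroFactor η (ℓ k) (b k) (γ k) s := by
    ext k
    rw [Function.comp_apply, neg_neg]
    exact exp_log_zeroTerm h.η_pos (h.scale_pos k) (hb k)
  rw [h3] at h2
  exact h2.tprod_eq.symm

end ScaleData

end

section

open Filter Topology MeasureTheory

section Frullani

/-- The unperturbed prime density in the variable `v = log x`. -/
noncomputable def baseDensity (v : ℝ) : ℝ := (Real.exp v - 1) / v

theorem measurable_baseDensity : Measurable baseDensity := by
  unfold baseDensity
  fun_prop

theorem one_le_baseDensity {v : ℝ} (hv : 0 < v) : 1 ≤ baseDensity v := by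
  rw [baseDensity, le_div_iff₀ hv]
  linarith [Real.add_one_le_exp v]

theorem baseDensity_le {v : ℝ} (hv : 0 < v) : baseDensity v ≤ Real.exp v := by
  rw [baseDensity, div_le_iff₀ hv]
  have h := Real.add_one_le_exp (-v)
  have h2 : Real.exp v * Real.exp (-v) = 1 := by rw [← Real.exp_add]; simp
  nlinarith [Real.exp_pos v]

theorem baseDensity_eq_integral {v : ℝ} (hv : v ≠ 0) (s : ℂ) :
    Complex.exp (-(s * v)) * baseDensity v =
      ∫ x in Set.Ioc (0 : ℝ) 1, Complex.exp (-(s * v) + v * x) := by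
  have hv' : (v : ℂ) ≠ 0 := by exact_mod_cast hv
  rw [← intervalIntegral.integral_of_le zero_le_one]
  simp_rw [Complex.exp_add]
  rw [intervalIntegral.integral_const_mul, integral_exp_mul_complex hv', baseDensity]
  simp

theorem integrableOn_exp_neg_mul {a : ℝ} (ha : 0 < a) (c : ℝ) :
    IntegrableOn (fun v : ℝ => Real.exp (-(a * v))) (Set.Ioi c) := by
  simpa only [neg_mul] using exp_neg_integrableOn_Ioi c ha

theorem integrable_exp_prod {s : ℂ} (hs : 1 < s.re) :
    Integrable (fun p : ℝ × ℝ => Complex.exp (-(s * p.1) + p.1 * p.2))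
      ((volume.restrict (Set.Ioi 0)).prod (volume.restrict (Set.Ioc 0 1))) := by
  have h1 := (integrableOn_exp_neg_mul (a := s.re - 1) (by linarith) 0).integrable.mul_prod
    (integrable_const (1 : ℝ) (μ := volume.restrict (Set.Ioc (0 : ℝ) 1)))
  refine h1.mono' (by fun_prop) ?_
  rw [Measure.prod_restrict]
  refine (ae_restrict_mem (measurableSet_Ioi.prod measurableSet_Ioc)).mono fun p hp => ?_
  have hp1 : 0 < p.1 := hp.1
  have hp2 : p.2 ≤ 1 := hp.2.2
  rw [Complex.norm_exp, mul_one, Real.exp_le_exp]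
  simp
  nlinarith

theorem integrableOn_exp_mul_baseDensity {s : ℂ} (hs : 1 < s.re) :
    IntegrableOn (fun v : ℝ => Complex.exp (-(s * v)) * baseDensity v) (Set.Ioi 0) := by
  refine (integrable_exp_prod hs).integral_prod_left.congr ?_
  filter_upwards [ae_restrict_mem measurableSet_Ioi] with v hv
  exact (baseDensity_eq_integral (ne_of_gt hv) s).symm

theorem integral_exp_mul_baseDensity {s : ℂ} (hs : 1 < s.re) :
    ∫ v in Set.Ioi (0 : ℝ), Complex.exp (-(s * v)) * baseDensity v
      = Complex.log s - Complex.log (s - 1) := by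
  have h1 : ∫ v in Set.Ioi (0 : ℝ), Complex.exp (-(s * v)) * baseDensity v
      = ∫ v in Set.Ioi (0 : ℝ), ∫ x in Set.Ioc (0 : ℝ) 1, Complex.exp (-(s * v) + v * x) :=
    setIntegral_congr_fun measurableSet_Ioi fun v hv => baseDensity_eq_integral (ne_of_gt hv) s
  rw [h1, integral_integral_swap (integrable_exp_prod hs)]
  have h2 : ∀ x ∈ Set.Ioc (0 : ℝ) 1,
      ∫ v in Set.Ioi (0 : ℝ), Complex.exp (-(s * v) + v * x) = (s - x)⁻¹ := by
    intro x hx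
    have hre : (-(s - x) : ℂ).re < 0 := by simp; linarith [hx.2]
    have := integral_exp_mul_complex_Ioi hre 0
    simp only [Complex.ofReal_zero, mul_zero, Complex.exp_zero] at this
    rw [neg_div_neg_eq, one_div] at this
    rw [← this]
    congr 1
    ext v
    congr 1
    ring
  rw [setIntegral_congr_fun measurableSet_Ioc h2, ← intervalIntegral.integral_of_le zero_le_one]
  have h3 : ∀ x ∈ Set.uIcc (0 : ℝ) 1,
      HasDerivAt (fun x : ℝ => -Complex.log (s - x)) ((s - x)⁻¹) x := by
    intro x hx
    rw [Set.uIcc_of_le zero_le_one] at hx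
    have hsl : s - x ∈ Complex.slitPlane := Or.inl (by simp; linarith [hx.2])
    have h4 : HasDerivAt (fun x : ℝ => s - (x : ℂ)) (-1) x := by
      simpa using (Complex.ofRealCLM.hasDerivAt (x := x)).const_sub s
    have := (h4.clog_real hsl).fun_neg
    rwa [neg_div, neg_neg, one_div] at this
  rw [intervalIntegral.integral_eq_sub_of_hasDerivAt h3]
  · simp only [Complex.ofReal_one, Complex.ofReal_zero, sub_zero]
    ring
  · refine ContinuousOn.intervalIntegrable fun x hx => ?_
    rw [Set.uIcc_of_le zero_le_one] at hx
    refine ContinuousAt.continuousWithinAt (ContinuousAt.inv₀ (by fun_prop) fun h => ?_)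
    have := congrArg Complex.re h
    simp at this
    linarith [hx.2]

end Frullani

section LaplaceTransform

/-- The Laplace transform of a measure. -/
noncomputable def laplace (μ : Measure ℝ) (s : ℂ) : ℂ := ∫ v : ℝ, Complex.exp (-(s * v)) ∂μ

theorem laplace_differentiable {μ : Measure ℝ} [IsFiniteMeasure μ] {a c : ℝ}
    (h : ∀ᵐ v ∂μ, v ∈ Set.Icc a c) : Differentiable ℂ (laplace μ) := by
  have h1 : laplace μ = ProbabilityTheory.complexMGF (fun v : ℝ => -v) μ := by
    ext s
    simp [laplace, ProbabilityTheory.complexMGF]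
  have h2 : ProbabilityTheory.integrableExpSet (fun v : ℝ => -v) μ = Set.univ := by
    rw [Set.eq_univ_iff_forall]
    intro t
    change Integrable (fun v : ℝ => Real.exp (t * -v)) μ
    refine Integrable.of_bound (by fun_prop) (Real.exp (|t| * max |a| |c|)) ?_
    filter_upwards [h] with v hv
    rw [Real.norm_eq_abs, Real.abs_exp, Real.exp_le_exp]
    calc t * -v ≤ |t * -v| := le_abs_self _
      _ = |t| * |v| := by rw [abs_mul, abs_neg]
      _ ≤ _ := by
        gcongr
        exact abs_le_max_abs_abs hv.1 hv.2
  have h3 := ProbabilityTheory.differentiableOn_complexMGF (X := fun v : ℝ => -v) (μ := μ)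
  rw [h2, interior_univ, ← h1] at h3
  exact differentiableOn_univ.mp (h3.mono fun _ _ => trivial)

theorem norm_laplace_le {μ : Measure ℝ} [IsFiniteMeasure μ] (h : ∀ᵐ v ∂μ, 0 ≤ v) {s : ℂ}
    (hs : 0 ≤ s.re) : ‖laplace μ s‖ ≤ μ.real Set.univ := by
  have := norm_integral_le_of_norm_le_const (μ := μ) (C := 1)
    (f := fun v : ℝ => Complex.exp (-(s * v))) (by
      filter_upwards [h] with v hv
      rw [Complex.norm_exp, Real.exp_le_one_iff]
      simp
      positivity)
  simpa [laplace] using this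

theorem laplace_withDensity (μ : Measure ℝ) {f : ℝ → ℝ} (hf : Measurable f)
    (hf0 : ∀ᵐ v ∂μ, 0 ≤ f v) (s : ℂ) :
    laplace (μ.withDensity fun v => ENNReal.ofReal (f v)) s
      = ∫ v : ℝ, Complex.exp (-(s * v)) * f v ∂μ := by
  rw [laplace, integral_withDensity_eq_integral_toReal_smul (by fun_prop) (by simp)]
  refine integral_congr_ae ?_
  filter_upwards [hf0] with v hv
  rw [ENNReal.toReal_ofReal hv, Complex.real_smul, mul_comm]

end LaplaceTransform

section Correction

/-- The unperturbed density on `(0, 1]`, as a measure. -/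
noncomputable def initialMeasure : Measure ℝ :=
  (volume.restrict (Set.Ioc 0 1)).withDensity fun v => ENNReal.ofReal (baseDensity v)

instance : IsFiniteMeasure initialMeasure := by
  refine isFiniteMeasure_withDensity ?_
  refine (lt_of_le_of_lt (b := ∫⁻ _ in Set.Ioc (0 : ℝ) 1, ENNReal.ofReal (Real.exp 1)) ?_ ?_).ne
  · refine setLIntegral_mono (by fun_prop) fun v hv => ENNReal.ofReal_le_ofReal ?_
    exact (baseDensity_le hv.1).trans (Real.exp_le_exp.mpr hv.2)
  · simp

theorem ae_initialMeasure : ∀ᵐ v ∂initialMeasure, v ∈ Set.Icc (0 : ℝ) 1 := by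
  refine (withDensity_absolutelyContinuous _ _).ae_le ?_
  filter_upwards [ae_restrict_mem measurableSet_Ioc] with v hv using ⟨hv.1.le, hv.2⟩

theorem exp_integral_baseDensity {s : ℂ} (hs : 1 < s.re) :
    Complex.exp (∫ v in Set.Ioi (1 : ℝ), Complex.exp (-(s * v)) * baseDensity v)
      = s / (s - 1) * Complex.exp (-laplace initialMeasure s) := by
  have h1 := integrableOn_exp_mul_baseDensity hs
  have h2 := setIntegral_union (f := fun v : ℝ => Complex.exp (-(s * v)) * baseDensity v)
    (μ := volume) (s := Set.Ioc 0 1) (t := Set.Ioi 1)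
    (Set.disjoint_left.mpr fun x hx hx' => not_lt.mpr hx.2 hx') measurableSet_Ioi
    (h1.mono_set fun x hx => hx.1) (h1.mono_set (Set.Ioi_subset_Ioi zero_le_one))
  rw [Set.Ioc_union_Ioi_eq_Ioi zero_le_one, integral_exp_mul_baseDensity hs] at h2
  have h3 : laplace initialMeasure s
      = ∫ v in Set.Ioc (0 : ℝ) 1, Complex.exp (-(s * v)) * baseDensity v :=
    laplace_withDensity _ measurable_baseDensity (by
      filter_upwards [ae_restrict_mem measurableSet_Ioc] with v hv
      exact zero_le_one.trans (one_le_baseDensity hv.1)) s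
  rw [← h3] at h2
  have hs0 : s ≠ 0 := fun h => by simp [h] at hs; linarith
  have hs1 : s - 1 ≠ 0 := fun h => by
    rw [sub_eq_zero.mp h] at hs; simp at hs
  rw [← sub_eq_iff_eq_add'] at h2
  rw [← h2, sub_eq_add_neg, Complex.exp_add, Complex.exp_sub, Complex.exp_log hs0,
    Complex.exp_log hs1]

end Correction

end

section

open Filter Topology MeasureTheory

/-- A prime density in the variable `v = log x`, of Chebyshev type. -/
structure IsPrimeDensity (d : ℝ → ℝ) : Prop where
  measurable : Measurable d
  half_le : ∀ v, 1 ≤ v → 1 / 2 ≤ d v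
  le_exp : ∀ v, 1 ≤ v → d v ≤ 3 / 2 * Real.exp v

namespace ScaleData

variable {η τ β : ℝ} {ℓ b γ : ℕ → ℝ}

/-- The perturbed prime density. -/
noncomputable def primeDensity (η : ℝ) (ℓ b γ : ℕ → ℝ) (v : ℝ) : ℝ :=
  baseDensity v - perturbation η ℓ b γ v

theorem isPrimeDensity (h : ScaleData η τ β ℓ b) (hτ : τ < 1) :
    IsPrimeDensity (primeDensity η ℓ b γ) := by
  have key : ∀ v : ℝ, 1 ≤ v → |perturbation η ℓ b γ v| ≤ 1 / 2 * baseDensity v := by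
    intro v hv
    have hv0 : 0 < v := by linarith
    refine (h.abs_perturbation_le hτ hv0).trans ?_
    rw [baseDensity, mul_div_assoc', mul_div_assoc']
    refine div_le_div_of_nonneg_right ?_ hv0.le
    linarith [Real.add_one_le_exp v]
  refine ⟨measurable_baseDensity.sub measurable_perturbation, fun v hv => ?_, fun v hv => ?_⟩
  · have h1 := (abs_le.mp (key v hv)).2
    have h2 := one_le_baseDensity (v := v) (by linarith)
    unfold primeDensity
    linarith
  · have h1 := (abs_le.mp (key v hv)).1
    have h2 := baseDensity_le (v := v) (by linarith)
    unfold primeDensity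
    linarith

theorem integrableOn_exp_mul_perturbation (h : ScaleData η τ β ℓ b) (hτ : τ < 1) {s : ℂ}
    (hs : 1 < s.re) :
    IntegrableOn (fun v : ℝ => Complex.exp (-(s * v)) * perturbation η ℓ b γ v) (Set.Ioi 1) := by
  have hm := measurable_perturbation (η := η) (ℓ := ℓ) (b := b) (γ := γ)
  refine ((integrableOn_exp_neg_mul (a := s.re - 1) (by linarith) 1).const_mul (1 / 4)).mono'
    (by fun_prop) ?_
  filter_upwards [ae_restrict_mem measurableSet_Ioi] with v hv
  have hv1 : (1 : ℝ) < v := hv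
  rw [norm_mul, Complex.norm_exp, Complex.norm_real, Real.norm_eq_abs]
  have e1 : (-(s * v)).re = -(s.re * v) := by simp
  rw [e1]
  calc _ ≤ Real.exp (-(s.re * v)) * (1 / 4 * (Real.exp v / 1)) := by
        refine mul_le_mul_of_nonneg_left ((h.abs_perturbation_le hτ (by linarith)).trans ?_)
          (Real.exp_pos _).le
        gcongr
    _ = _ := by
        rw [show -((s.re - 1) * v) = -(s.re * v) + v by ring, Real.exp_add]
        ring

theorem exp_integral_primeDensity (h : ScaleData η τ β ℓ b) (hτ : τ < 1) {s : ℂ}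
    (hs : 1 < s.re) :
    Complex.exp (∫ v in Set.Ioi (1 : ℝ), Complex.exp (-(s * v)) * primeDensity η ℓ b γ v)
      = s / (s - 1) * Complex.exp (-laplace initialMeasure s) * zeroProd η ℓ b γ s := by
  have i1 : IntegrableOn (fun v : ℝ => Complex.exp (-(s * v)) * baseDensity v) (Set.Ioi 1) :=
    (integrableOn_exp_mul_baseDensity hs).mono_set (Set.Ioi_subset_Ioi zero_le_one)
  have i2 := h.integrableOn_exp_mul_perturbation (γ := γ) hτ hs
  have e : (fun v : ℝ => Complex.exp (-(s * v)) * primeDensity η ℓ b γ v) =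
      fun v : ℝ => Complex.exp (-(s * v)) * baseDensity v
        - Complex.exp (-(s * v)) * perturbation η ℓ b γ v := by
    ext v
    rw [primeDensity]
    push_cast
    ring
  rw [e, integral_sub i1 i2, sub_eq_add_neg, Complex.exp_add, exp_integral_baseDensity hs,
    h.exp_neg_integral_perturbation hτ hs]

end ScaleData

end

section

open Filter Topology MeasureTheory

namespace IsPrimeDensity

variable {d : ℝ → ℝ} {v : ℕ → ℝ}

theorem integrableOn_Ioc (h : IsPrimeDensity d) {a : ℝ} (ha : 1 ≤ a) (c : ℝ) :
    IntegrableOn d (Set.Ioc a c) := by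
  refine Measure.integrableOn_of_bounded (M := 3 / 2 * Real.exp c) (by simp)
    h.measurable.aestronglyMeasurable ?_
  filter_upwards [ae_restrict_mem measurableSet_Ioc] with x hx
  have hx1 : 1 ≤ x := ha.trans hx.1.le
  rw [Real.norm_eq_abs, abs_of_nonneg (by linarith [h.half_le x hx1])]
  refine (h.le_exp x hx1).trans ?_
  gcongr
  exact hx.2

theorem exists_cells (h : IsPrimeDensity d) :
    ∃ v : ℕ → ℝ, StrictMono v ∧ v 0 = 1 ∧ Tendsto v atTop atTop ∧
      ∀ j, ∫ x in Set.Ioc (v j) (v (j + 1)), d x = 1 := by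
  set D : ℝ → ℝ := fun x => if 1 < x then d x else 1 with hD
  have hDd : ∀ x, 1 < x → D x = d x := fun x hx => if_pos hx
  have hDpos : ∀ x, 1 / 2 ≤ D x := fun x => by
    simp only [hD]
    split_ifs with hx
    · exact h.half_le x hx.le
    · norm_num
  have hDm : Measurable D := Measurable.ite measurableSet_Ioi h.measurable measurable_const
  have hDi : ∀ a c, IntervalIntegrable D volume a c := by
    have : ∀ a c, IntegrableOn D (Set.Ioc a c) := fun a c => by
      refine Measure.integrableOn_of_bounded (M := 3 / 2 * Real.exp c + 1) (by simp)
        hDm.aestronglyMeasurable ?_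
      filter_upwards [ae_restrict_mem measurableSet_Ioc] with x hx
      rw [Real.norm_eq_abs, abs_of_nonneg (by linarith [hDpos x])]
      simp only [hD]
      split_ifs with hx1
      · have := (h.le_exp x hx1.le).trans
          (mul_le_mul_of_nonneg_left (Real.exp_le_exp.mpr hx.2) (by norm_num))
        linarith
      · linarith [Real.exp_pos c]
    exact fun a c => ⟨this a c, this c a⟩
  set Φ : ℝ → ℝ := fun x => ∫ y in (1 : ℝ)..x, D y with hΦ
  have hΦc : Continuous Φ := intervalIntegral.continuous_primitive hDi 1
  have hsub : ∀ a c, Φ c - Φ a = ∫ y in a..c, D y := fun a c =>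
    intervalIntegral.integral_interval_sub_left (hDi _ _) (hDi _ _)
  have hgrow : ∀ a c, a ≤ c → (c - a) / 2 ≤ Φ c - Φ a := by
    intro a c hac
    rw [hsub]
    have := intervalIntegral.integral_mono_on hac (f := fun _ => (1 / 2 : ℝ)) (by simp)
      (hDi a c) fun x _ => hDpos x
    simp only [intervalIntegral.integral_const, smul_eq_mul] at this
    linarith
  have hmono : StrictMono Φ := fun a c hac => by linarith [hgrow a c hac.le]
  have h1 : Φ 1 = 0 := by simp [hΦ]
  have hex : ∀ j : ℕ, ∃ x, Φ x = j := by
    intro j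
    have h2 := hgrow 1 (1 + 2 * j) (by linarith [(Nat.cast_nonneg j : (0 : ℝ) ≤ j)])
    have h3 := intermediate_value_Icc (f := Φ) (a := 1) (b := 1 + 2 * (j : ℝ))
      (by linarith [(Nat.cast_nonneg j : (0 : ℝ) ≤ j)]) hΦc.continuousOn
    obtain ⟨x, -, hx⟩ := h3 (⟨by rw [h1]; positivity, by rw [h1] at h2; linarith⟩ :
      (j : ℝ) ∈ Set.Icc (Φ 1) (Φ (1 + 2 * (j : ℝ))))
    exact ⟨x, hx⟩
  choose v hv using hex
  have hvm : StrictMono v := fun i j hij => by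
    rw [← hmono.lt_iff_lt, hv, hv]
    exact_mod_cast hij
  have hv0 : v 0 = 1 := hmono.injective (by rw [hv, h1]; simp)
  refine ⟨v, hvm, hv0, ?_, fun j => ?_⟩
  · refine tendsto_atTop_atTop_of_monotone hvm.monotone fun B => ?_
    obtain ⟨j, hj⟩ := exists_nat_ge (Φ B)
    exact ⟨j, hmono.le_iff_le.mp (by rw [hv]; exact hj)⟩
  · have h2 := hsub (v j) (v (j + 1))
    rw [hv, hv, intervalIntegral.integral_of_le (hvm.monotone (Nat.le_succ j))] at h2
    push_cast at h2
    rw [add_sub_cancel_left] at h2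
    rw [h2]
    refine setIntegral_congr_fun measurableSet_Ioc fun x hx => (hDd x ?_).symm
    rw [← hv0]
    exact (hvm.monotone (Nat.zero_le j)).trans_lt hx.1

/-- The prime measure on the `j`-th cell. -/
noncomputable def cellMeasure (d : ℝ → ℝ) (v : ℕ → ℝ) (j : ℕ) : Measure ℝ :=
  (volume.restrict (Set.Ioc (v j) (v (j + 1)))).withDensity fun x => ENNReal.ofReal (d x)

/-- The sequence `v` cuts `(1, ∞)` into cells of mass one for the density `d`. -/
structure IsCells (d : ℝ → ℝ) (v : ℕ → ℝ) : Prop where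
  density : IsPrimeDensity d
  strictMono : StrictMono v
  zero : v 0 = 1
  tendsto : Tendsto v atTop atTop
  mass : ∀ j, ∫ x in Set.Ioc (v j) (v (j + 1)), d x = 1

namespace IsCells

theorem one_le (h : IsCells d v) (j : ℕ) : 1 ≤ v j := by
  rw [← h.zero]
  exact h.strictMono.monotone (Nat.zero_le j)

theorem ae_nonneg (h : IsCells d v) (j : ℕ) :
    ∀ᵐ x ∂(volume.restrict (Set.Ioc (v j) (v (j + 1)))), 0 ≤ d x := by
  filter_upwards [ae_restrict_mem measurableSet_Ioc] with x hx
  linarith [h.density.half_le x ((h.one_le j).trans hx.1.le)]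

theorem isProbabilityMeasure (h : IsCells d v) (j : ℕ) :
    IsProbabilityMeasure (cellMeasure d v j) := by
  constructor
  rw [cellMeasure, withDensity_apply _ MeasurableSet.univ, setLIntegral_univ,
    ← ofReal_integral_eq_lintegral_ofReal (h.density.integrableOn_Ioc (h.one_le j) _)
      (h.ae_nonneg j), h.mass, ENNReal.ofReal_one]

theorem nullSingletonClass (d : ℝ → ℝ) (v : ℕ → ℝ) (j : ℕ) :
    NullSingletonClass (cellMeasure d v j) :=
  ⟨fun x => withDensity_absolutelyContinuous _ _ (measure_singleton x)⟩

theorem ae_mem (d : ℝ → ℝ) (v : ℕ → ℝ) (j : ℕ) :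
    ∀ᵐ x ∂(cellMeasure d v j), x ∈ Set.Ioc (v j) (v (j + 1)) :=
  (withDensity_absolutelyContinuous _ _).ae_le (ae_restrict_mem measurableSet_Ioc)

theorem iUnion_eq (h : IsCells d v) : ⋃ j, Set.Ioc (v j) (v (j + 1)) = Set.Ioi 1 := by
  ext x
  simp only [Set.mem_iUnion, Set.mem_Ioi]
  constructor
  · rintro ⟨j, hj⟩
    exact (h.one_le j).trans_lt hj.1
  · intro hx
    have hex : ∃ n, x ≤ v n := (h.tendsto.eventually_ge_atTop x).exists
    classical
    have h0 : Nat.find hex ≠ 0 := by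
      intro h0
      have := Nat.find_spec hex
      rw [h0, h.zero] at this
      linarith
    obtain ⟨j, hj⟩ := Nat.exists_eq_succ_of_ne_zero h0
    refine ⟨j, ?_, ?_⟩
    · exact not_le.mp (Nat.find_min hex (by omega))
    · have := Nat.find_spec hex
      rwa [hj] at this

theorem pairwise_disjoint (h : IsCells d v) :
    Pairwise (Function.onFun Disjoint fun j => Set.Ioc (v j) (v (j + 1))) := by
  simpa using h.strictMono.monotone.pairwise_disjoint_on_Ioc_succ

theorem laplace_cell (h : IsCells d v) (j : ℕ) (s : ℂ) :
    laplace (cellMeasure d v j) s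
      = ∫ x in Set.Ioc (v j) (v (j + 1)), Complex.exp (-(s * x)) * d x :=
  laplace_withDensity _ h.density.measurable (h.ae_nonneg j) s

theorem norm_exp_mul_le (h : IsPrimeDensity d) (s : ℂ) {x : ℝ} (hx : 1 < x) :
    ‖Complex.exp (-(s * x)) * d x‖ ≤ 3 / 2 * Real.exp (-((s.re - 1) * x)) := by
  rw [norm_mul, Complex.norm_exp, Complex.norm_real, Real.norm_eq_abs,
    abs_of_nonneg (by linarith [h.half_le x hx.le])]
  have e1 : (-(s * x)).re = -(s.re * x) := by simp
  rw [e1, show -((s.re - 1) * x) = -(s.re * x) + x by ring, Real.exp_add]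
  nlinarith [mul_le_mul_of_nonneg_left (h.le_exp x hx.le) (Real.exp_pos (-(s.re * x))).le]

theorem integrableOn_exp_mul (h : IsPrimeDensity d) {s : ℂ} (hs : 1 < s.re) :
    IntegrableOn (fun x : ℝ => Complex.exp (-(s * x)) * d x) (Set.Ioi 1) := by
  have hm := h.measurable
  refine ((integrableOn_exp_neg_mul (a := s.re - 1) (by linarith) 1).const_mul (3 / 2)).mono'
    (by fun_prop) ?_
  filter_upwards [ae_restrict_mem measurableSet_Ioi] with x hx using norm_exp_mul_le h s hx

theorem hasSum_laplace_cell (h : IsCells d v) {s : ℂ} (hs : 1 < s.re) :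
    HasSum (fun j => laplace (cellMeasure d v j) s)
      (∫ x in Set.Ioi (1 : ℝ), Complex.exp (-(s * x)) * d x) := by
  have := hasSum_integral_iUnion (f := fun x : ℝ => Complex.exp (-(s * x)) * d x) (μ := volume)
    (fun j => measurableSet_Ioc (a := v j) (b := v (j + 1))) h.pairwise_disjoint
    (by rw [h.iUnion_eq]; exact integrableOn_exp_mul h.density hs)
  rw [h.iUnion_eq] at this
  exact this.congr_fun fun j => h.laplace_cell j s

theorem summable_exp (h : IsCells d v) {σ : ℝ} (hσ : 1 < σ) :
    Summable fun j => Real.exp (-(σ * v j)) := by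
  rw [← summable_nat_add_iff 1]
  have hi : IntegrableOn (fun x : ℝ => Real.exp (-(σ * x)) * d x) (Set.Ioi 1) := by
    have := (integrableOn_exp_mul h.density (s := σ) (by simpa using hσ)).norm
    refine this.congr ?_
    filter_upwards [ae_restrict_mem measurableSet_Ioi] with x hx
    rw [norm_mul, Complex.norm_exp, Complex.norm_real, Real.norm_eq_abs,
      abs_of_nonneg (by linarith [h.density.half_le x (le_of_lt hx)])]
    simp
  have hsum := (hasSum_integral_iUnion (f := fun x : ℝ => Real.exp (-(σ * x)) * d x) (μ := volume)
    (fun j => measurableSet_Ioc (a := v j) (b := v (j + 1))) h.pairwise_disjoint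
    (by rw [h.iUnion_eq]; exact hi)).summable
  refine Summable.of_nonneg_of_le (fun _ => (Real.exp_pos _).le) (fun j => ?_) hsum
  have h1 : ∫ x in Set.Ioc (v j) (v (j + 1)), Real.exp (-(σ * v (j + 1))) * d x
      = Real.exp (-(σ * v (j + 1))) := by
    rw [integral_const_mul, h.mass, mul_one]
  rw [← h1]
  refine setIntegral_mono_on ((h.density.integrableOn_Ioc (h.one_le j) _).const_mul _)
    (hi.mono_set fun x hx => (h.one_le j).trans_lt hx.1) measurableSet_Ioc fun x hx => ?_
  have h2 := h.density.half_le x ((h.one_le j).trans hx.1.le)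
  have h3 : σ * x ≤ σ * v (j + 1) := mul_le_mul_of_nonneg_left hx.2 (by linarith)
  have : 0 ≤ d x := by linarith
  gcongr

end IsCells

end IsPrimeDensity

end

section

open Filter Topology MeasureTheory

theorem norm_exp_sub_exp_le {s : ℂ} {σ x y : ℝ} (hσ : 0 < σ) (hs : σ ≤ s.re) (hx : 0 ≤ x)
    (hxy : x ≤ y) :
    ‖Complex.exp (-(s * x)) - Complex.exp (-(s * y))‖
      ≤ ‖s‖ / σ * (Real.exp (-(σ * x)) - Real.exp (-(σ * y))) := by
  have h1 : ∀ u : ℝ, HasDerivAt (fun u : ℝ => Complex.exp (-(s * x)) - Complex.exp (-(s * u)))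
      (s * Complex.exp (-(s * u))) u := by
    intro u
    have h2 : HasDerivAt (fun u : ℝ => -(s * (u : ℂ))) (-(s * 1)) u :=
      ((HasDerivAt.ofReal_comp (hasDerivAt_id u)).const_mul s).neg
    have h4 := h2.cexp.const_sub (Complex.exp (-(s * x)))
    rwa [show -(Complex.exp (-(s * u)) * -(s * 1)) = s * Complex.exp (-(s * u)) by ring] at h4
  have h3 : ∀ u : ℝ, HasDerivAt
      (fun u : ℝ => ‖s‖ / σ * (Real.exp (-(σ * x)) - Real.exp (-(σ * u))))
      (‖s‖ * Real.exp (-(σ * u))) u := by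
    intro u
    have h2 : HasDerivAt (fun u : ℝ => -(σ * u)) (-(σ * 1)) u :=
      ((hasDerivAt_id u).const_mul σ).neg
    have h4 := (h2.exp.const_sub (Real.exp (-(σ * x)))).const_mul (‖s‖ / σ)
    rwa [show ‖s‖ / σ * -(Real.exp (-(σ * u)) * -(σ * 1)) = ‖s‖ * Real.exp (-(σ * u)) by
      field_simp] at h4
  refine image_norm_le_of_norm_deriv_right_le_deriv_boundary (a := x) (b := y)
    (fun u _ => (h1 u).continuousAt.continuousWithinAt) (fun u _ => (h1 u).hasDerivWithinAt)
    (by simp) h3 (fun u hu => ?_) ⟨hxy, le_rfl⟩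
  rw [norm_mul, Complex.norm_exp]
  have e1 : (-(s * u)).re = -(s.re * u) := by simp
  rw [e1]
  have : 0 ≤ u := hx.trans hu.1
  gcongr

theorem norm_neg_log_one_sub_sub_le {z : ℂ} (hz : ‖z‖ ≤ 2 / 3) :
    ‖-Complex.log (1 - z) - z‖ ≤ 2 * ‖z‖ ^ 2 := by
  have h1 := Complex.norm_log_one_add_sub_self_le (z := -z) (by rw [norm_neg]; linarith)
  rw [norm_neg, ← sub_eq_add_neg] at h1
  rw [← norm_neg, show -(-Complex.log (1 - z) - z) = Complex.log (1 - z) - -z by ring]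
  refine h1.trans ?_
  have h2 : (1 - ‖z‖)⁻¹ ≤ 3 := by
    rw [inv_le_comm₀ (by linarith) (by norm_num)]
    linarith
  nlinarith [mul_le_mul_of_nonneg_left h2 (sq_nonneg ‖z‖), sq_nonneg ‖z‖]

theorem exp_le_one_add_add_sq {x : ℝ} (hx : |x| ≤ 2) : Real.exp x ≤ 1 + x + 2 * x ^ 2 := by
  have h1 := (abs_le.mp (Real.abs_exp_sub_one_sub_id_le (x := x / 2)
    (by rw [abs_div, abs_two]; linarith))).2
  have h2 : Real.exp x = Real.exp (x / 2) ^ 2 := by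
    rw [← Real.exp_nat_mul]
    congr 1
    push_cast
    ring
  have h3 : Real.exp (x / 2) ≤ 1 + x / 2 + (x / 2) ^ 2 := by linarith
  have h4 := pow_le_pow_left₀ (Real.exp_pos (x / 2)).le h3 2
  rw [h2]
  refine h4.trans ?_
  obtain ⟨h5, h6⟩ := abs_le.mp hx
  nlinarith [mul_nonneg (sq_nonneg x) (by linarith : 0 ≤ 2 - x),
    mul_nonneg (sq_nonneg x) (mul_nonneg (by linarith : 0 ≤ 2 - x) (by linarith : 0 ≤ 2 + x))]

namespace IsPrimeDensity

variable {d : ℝ → ℝ} {v : ℕ → ℝ}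

/-- The difference between the logarithm of the Euler factor of the prime `exp x` and the
contribution of the `j`-th cell. -/
noncomputable def cellError (d : ℝ → ℝ) (v : ℕ → ℝ) (j : ℕ) (x : ℝ) (s : ℂ) : ℂ :=
  -Complex.log (1 - Complex.exp (-(s * x))) - laplace (cellMeasure d v j) s

theorem norm_exp_neg_mul_le {σ x y : ℝ} {s : ℂ} (hσ : 0 ≤ σ) (hs : σ ≤ s.re) (hy : 0 ≤ y)
    (hyx : y ≤ x) : ‖Complex.exp (-(s * x))‖ ≤ Real.exp (-(σ * y)) := by
  rw [Complex.norm_exp]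
  have e1 : (-(s * x)).re = -(s.re * x) := by simp
  rw [e1, Real.exp_le_exp, neg_le_neg_iff]
  exact mul_le_mul hs hyx hy (hσ.trans hs)

theorem exp_neg_half_le : Real.exp (-(1 / 2)) ≤ 2 / 3 := by
  rw [Real.exp_neg, inv_le_comm₀ (Real.exp_pos _) (by norm_num)]
  linarith [Real.add_one_le_exp (1 / 2 : ℝ)]

namespace IsCells

theorem norm_exp_sub_laplace_le (h : IsCells d v) {σ : ℝ} (hσ : 0 < σ) {s : ℂ} (hs : σ ≤ s.re)
    {j : ℕ} {x : ℝ} (hx : x ∈ Set.Ioc (v j) (v (j + 1))) :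
    ‖Complex.exp (-(s * x)) - laplace (cellMeasure d v j) s‖
      ≤ ‖s‖ / σ * (Real.exp (-(σ * v j)) - Real.exp (-(σ * v (j + 1)))) := by
  have := h.isProbabilityMeasure j
  have hint : Integrable (fun y : ℝ => Complex.exp (-(s * y))) (cellMeasure d v j) := by
    refine Integrable.of_bound (C := 1) (by fun_prop) ?_
    filter_upwards [ae_mem d v j] with y hy
    refine (norm_exp_neg_mul_le (y := 0) hσ.le hs le_rfl ?_).trans (by simp)
    linarith [h.one_le j, hy.1]
  have e : Complex.exp (-(s * x)) - laplace (cellMeasure d v j) s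
      = ∫ y, (Complex.exp (-(s * x)) - Complex.exp (-(s * y))) ∂(cellMeasure d v j) := by
    rw [integral_sub (integrable_const _) hint, laplace]
    simp
  rw [e]
  refine (norm_integral_le_of_norm_le_const (C := ‖s‖ / σ *
    (Real.exp (-(σ * v j)) - Real.exp (-(σ * v (j + 1))))) ?_).trans (by simp)
  filter_upwards [ae_mem d v j] with y hy
  have h0 := h.one_le j
  have mono : ∀ a b : ℝ, a ≤ b → Real.exp (-(σ * b)) ≤ Real.exp (-(σ * a)) := fun a b hab => by
    gcongr
  rcases le_total x y with hxy | hxy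
  · refine (norm_exp_sub_exp_le hσ hs (by linarith [hx.1]) hxy).trans ?_
    have := mono _ _ hx.1.le
    have := mono _ _ hy.2
    gcongr
  · rw [norm_sub_rev]
    refine (norm_exp_sub_exp_le hσ hs (by linarith [hy.1]) hxy).trans ?_
    have := mono _ _ hy.1.le
    have := mono _ _ hx.2
    gcongr

theorem norm_log_sub_exp_le (h : IsCells d v) {σ : ℝ} (hσ : 1 / 2 ≤ σ) {s : ℂ} (hs : σ ≤ s.re)
    {j : ℕ} {x : ℝ} (hx : v j ≤ x) :
    ‖-Complex.log (1 - Complex.exp (-(s * x))) - Complex.exp (-(s * x))‖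
      ≤ 2 * Real.exp (-(2 * σ * v j)) := by
  have h0 := h.one_le j
  have h1 := norm_exp_neg_mul_le (by linarith) hs (by linarith) hx
  have h2 : Real.exp (-(σ * v j)) ≤ 2 / 3 := by
    refine le_trans (Real.exp_le_exp.mpr ?_) exp_neg_half_le
    nlinarith
  refine (norm_neg_log_one_sub_sub_le (h1.trans h2)).trans ?_
  have h3 := pow_le_pow_left₀ (norm_nonneg _) h1 2
  rw [← Real.exp_nat_mul] at h3
  have e : ((2 : ℕ) : ℝ) * -(σ * v j) = -(2 * σ * v j) := by push_cast; ring
  rw [e] at h3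
  linarith

/-- The size of the error made on the `j`-th cell. -/
noncomputable def _root_.IsPrimeDensity.cellBound (v : ℕ → ℝ) (τ : ℝ) (j : ℕ) : ℝ :=
  2 * (Real.exp (-(τ * v j)) - Real.exp (-(τ * v (j + 1)))) + 2 * Real.exp (-(2 * τ * v j))

theorem norm_cellError_le (h : IsCells d v) {τ : ℝ} (hτ : 1 / 2 ≤ τ) {s : ℂ} (hs : τ ≤ s.re)
    {j : ℕ} {x : ℝ} (hx : x ∈ Set.Ioc (v j) (v (j + 1))) :
    ‖cellError d v j x s‖ ≤ cellBound v τ j * (1 + ‖s‖) := by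
  have h1 := h.norm_exp_sub_laplace_le (by linarith) hs hx
  have h2 := h.norm_log_sub_exp_le hτ hs hx.1.le
  have e : cellError d v j x s
      = (-Complex.log (1 - Complex.exp (-(s * x))) - Complex.exp (-(s * x)))
        + (Complex.exp (-(s * x)) - laplace (cellMeasure d v j) s) := by
    rw [cellError]
    ring
  rw [e]
  refine (norm_add_le _ _).trans ((add_le_add h2 h1).trans ?_)
  have hD : 0 ≤ Real.exp (-(τ * v j)) - Real.exp (-(τ * v (j + 1))) := by
    have := h.strictMono.monotone (Nat.le_succ j)
    rw [sub_nonneg]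
    gcongr
  have h3 : ‖s‖ / τ ≤ 2 * ‖s‖ := by
    rw [div_le_iff₀ (by linarith)]
    nlinarith [norm_nonneg s]
  have h4 := mul_le_mul_of_nonneg_right h3 hD
  have h5 := Real.exp_pos (-(2 * τ * v j))
  rw [cellBound]
  nlinarith [norm_nonneg s, mul_nonneg h5.le (norm_nonneg s)]

theorem cellBound_nonneg (h : IsCells d v) {τ : ℝ} (hτ : 1 / 2 ≤ τ) (j : ℕ) :
    0 ≤ cellBound v τ j := by
  have hD : 0 ≤ Real.exp (-(τ * v j)) - Real.exp (-(τ * v (j + 1))) := by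
    have := h.strictMono.monotone (Nat.le_succ j)
    rw [sub_nonneg]
    gcongr
  rw [cellBound]
  positivity

theorem summable_cellBound (h : IsCells d v) {τ : ℝ} (hτ : 1 / 2 < τ) :
    Summable (cellBound v τ) := by
  refine Summable.add (Summable.mul_left _ ?_) (Summable.mul_left _ (h.summable_exp (by linarith)))
  refine summable_of_sum_range_le (c := 1) (fun j => ?_) fun n => ?_
  · have := h.strictMono.monotone (Nat.le_succ j)
    rw [sub_nonneg]
    gcongr
  · rw [Finset.sum_range_sub' (fun j => Real.exp (-(τ * v j)))]
    have : Real.exp (-(τ * v 0)) ≤ 1 := by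
      rw [h.zero, Real.exp_le_one_iff]
      linarith
    linarith [Real.exp_pos (-(τ * v n))]

/-- The total error of a choice of primes. -/
noncomputable def _root_.IsPrimeDensity.totalError (d : ℝ → ℝ) (v w : ℕ → ℝ) (s : ℂ) : ℂ :=
  ∑' j, cellError d v j (w j) s

variable {w : ℕ → ℝ} {τ : ℝ}

theorem summable_norm_cellError (h : IsCells d v) (hτ : 1 / 2 < τ)
    (hw : ∀ j, w j ∈ Set.Ioc (v j) (v (j + 1))) {s : ℂ} (hs : τ ≤ s.re) :
    Summable fun j => ‖cellError d v j (w j) s‖ :=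
  Summable.of_nonneg_of_le (fun _ => norm_nonneg _)
    (fun j => h.norm_cellError_le hτ.le hs (hw j)) ((h.summable_cellBound hτ).mul_right _)

theorem norm_totalError_le (h : IsCells d v) (hτ : 1 / 2 < τ)
    (hw : ∀ j, w j ∈ Set.Ioc (v j) (v (j + 1))) {s : ℂ} (hs : τ ≤ s.re) :
    ‖totalError d v w s‖ ≤ (∑' j, cellBound v τ j) * (1 + ‖s‖) := by
  rw [← tsum_mul_right]
  exact tsum_of_norm_bounded ((h.summable_cellBound hτ).mul_right _).hasSum
    fun j => h.norm_cellError_le hτ.le hs (hw j)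

theorem differentiableAt_cellError (h : IsCells d v) {j : ℕ} {x : ℝ} (hx : 0 < x) {s : ℂ}
    (hs : 0 < s.re) : DifferentiableAt ℂ (cellError d v j x) s := by
  have := h.isProbabilityMeasure j
  have h1 : Differentiable ℂ (laplace (cellMeasure d v j)) :=
    laplace_differentiable ((ae_mem d v j).mono fun _ hy => Set.Ioc_subset_Icc_self hy)
  have h2 : ‖Complex.exp (-(s * x))‖ < 1 := by
    rw [Complex.norm_exp]
    have e1 : (-(s * x)).re = -(s.re * x) := by simp
    rw [e1, Real.exp_lt_one_iff]
    nlinarith [mul_pos hs hx]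
  have h3 : 1 - Complex.exp (-(s * x)) ∈ Complex.slitPlane := by
    rw [sub_eq_add_neg]
    exact Complex.mem_slitPlane_of_norm_lt_one (by rwa [norm_neg])
  unfold cellError
  have h4 : DifferentiableAt ℂ (fun s : ℂ => 1 - Complex.exp (-(s * x))) s := by fun_prop
  exact (h4.clog h3).neg.sub (h1 s)

theorem differentiableOn_totalError (h : IsCells d v) (hτ : 1 / 2 < τ)
    (hw : ∀ j, w j ∈ Set.Ioc (v j) (v (j + 1))) :
    DifferentiableOn ℂ (totalError d v w) {s | τ < s.re} := by
  intro s hs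
  set U : Set ℂ := {s | τ < s.re} ∩ Metric.ball 0 (‖s‖ + 1) with hU
  have hUo : IsOpen U := (isOpen_re_gt τ).inter Metric.isOpen_ball
  have hsU : s ∈ U := ⟨hs, by simp⟩
  have h1 : DifferentiableOn ℂ (totalError d v w) U := by
    refine Complex.differentiableOn_tsum_of_summable_norm
      (u := fun j => cellBound v τ j * (1 + (‖s‖ + 1))) ((h.summable_cellBound hτ).mul_right _)
      (fun j z hz => ?_) hUo fun j z hz => ?_
    · have hz1 : τ < z.re := hz.1
      exact (h.differentiableAt_cellError (by linarith [h.one_le j, (hw j).1])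
        (by linarith)).differentiableWithinAt
    · have hz1 : τ < z.re := hz.1
      refine (h.norm_cellError_le hτ.le hz1.le (hw j)).trans ?_
      have hz2 := hz.2
      rw [mem_ball_zero_iff] at hz2
      have := h.cellBound_nonneg hτ.le j
      gcongr
  exact (h1.differentiableAt (hUo.mem_nhds hsU)).differentiableWithinAt

theorem lintegral_exp_cellError_le (h : IsCells d v) {σ : ℝ} (hσ : 1 / 2 ≤ σ) {s : ℂ}
    (hs : σ ≤ s.re) (j : ℕ) :
    ∫⁻ x, ENNReal.ofReal ‖Complex.exp (cellError d v j x s)‖ ∂(cellMeasure d v j)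
      ≤ ENNReal.ofReal (Real.exp (10 * Real.exp (-(2 * σ * v j)))) := by
  have := h.isProbabilityMeasure j
  set q := Real.exp (-(2 * σ * v j)) with hq
  set L := laplace (cellMeasure d v j) s with hL
  have hv := h.one_le j
  have hint : Integrable (fun y : ℝ => Complex.exp (-(s * y))) (cellMeasure d v j) := by
    refine Integrable.of_bound (C := 1) (by fun_prop) ?_
    filter_upwards [ae_mem d v j] with y hy
    refine (norm_exp_neg_mul_le (σ := σ) (y := 0) (by linarith) hs le_rfl ?_).trans (by simp)
    linarith [hy.1]
  set g : ℝ → ℝ := fun x => (Complex.exp (-(s * x)) - L).re with hg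
  have hgi : Integrable g (cellMeasure d v j) := (hint.sub (integrable_const L)).re
  have hg0 : ∫ x, g x ∂(cellMeasure d v j) = 0 := by
    have h1 : ∫ x, g x ∂(cellMeasure d v j)
        = (∫ x, (Complex.exp (-(s * x)) - L) ∂(cellMeasure d v j)).re :=
      integral_re (hint.sub (integrable_const L))
    rw [h1, integral_sub hint (integrable_const L)]
    simp [hL, laplace]
  have hLn : ‖L‖ ≤ Real.exp (-(σ * v j)) := by
    refine (norm_integral_le_of_norm_le_const (C := Real.exp (-(σ * v j))) ?_).trans (by simp)
    filter_upwards [ae_mem d v j] with y hy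
    exact norm_exp_neg_mul_le (by linarith) hs (by linarith) hy.1.le
  have hq2 : Real.exp (-(σ * v j)) ^ 2 = q := by
    rw [← Real.exp_nat_mul, hq]
    congr 1
    push_cast
    ring
  have hgb : ∀ x ∈ Set.Ioc (v j) (v (j + 1)), |g x| ≤ 2 * Real.exp (-(σ * v j)) := by
    intro x hx
    refine (Complex.abs_re_le_norm _).trans ((norm_sub_le _ _).trans ?_)
    linarith [norm_exp_neg_mul_le (σ := σ) (by linarith) hs (by linarith) hx.1.le]
  have hexp : ∀ x ∈ Set.Ioc (v j) (v (j + 1)), Real.exp (g x) ≤ 1 + g x + 8 * q := by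
    intro x hx
    have h1 := hgb x hx
    have h2 : Real.exp (-(σ * v j)) ≤ 1 := by
      rw [Real.exp_le_one_iff]
      nlinarith
    have h3 := exp_le_one_add_add_sq (x := g x) (by linarith)
    have h4 : g x ^ 2 ≤ 4 * q := by
      rw [← sq_abs, ← hq2]
      nlinarith [abs_nonneg (g x)]
    linarith
  calc ∫⁻ x, ENNReal.ofReal ‖Complex.exp (cellError d v j x s)‖ ∂(cellMeasure d v j)
      ≤ ∫⁻ x, ENNReal.ofReal (Real.exp (2 * q) * (1 + g x + 8 * q)) ∂(cellMeasure d v j) := by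
        refine lintegral_mono_ae ?_
        filter_upwards [ae_mem d v j] with x hx
        refine ENNReal.ofReal_le_ofReal ?_
        rw [Complex.norm_exp]
        refine le_trans ?_ (mul_le_mul_of_nonneg_left (hexp x hx) (Real.exp_pos _).le)
        rw [← Real.exp_add, Real.exp_le_exp]
        have h1 := (Complex.abs_re_le_norm _).trans (h.norm_log_sub_exp_le hσ hs hx.1.le)
        have h2 := (abs_le.mp h1).2
        simp only [cellError, hg, Complex.sub_re] at h2 ⊢
        linarith
    _ = ENNReal.ofReal (∫ x, Real.exp (2 * q) * (1 + g x + 8 * q) ∂(cellMeasure d v j)) := by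
        rw [ofReal_integral_eq_lintegral_ofReal]
        · exact (((integrable_const 1).add hgi).add (integrable_const _)).const_mul _
        · filter_upwards [ae_mem d v j] with x hx
          exact mul_nonneg (Real.exp_pos _).le ((Real.exp_pos _).le.trans (hexp x hx))
    _ ≤ _ := by
        refine ENNReal.ofReal_le_ofReal ?_
        have e : ∫ x, Real.exp (2 * q) * (1 + g x + 8 * q) ∂(cellMeasure d v j)
            = Real.exp (2 * q) * (1 + 8 * q) := by
          have i1 : Integrable (fun x => 1 + g x) (cellMeasure d v j) :=
            (integrable_const 1).add hgi
          rw [integral_const_mul, integral_add i1 (integrable_const _),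
            integral_add (integrable_const 1) hgi, hg0]
          simp
        rw [e, show 10 * q = 2 * q + 8 * q by ring, Real.exp_add]
        gcongr
        linarith [Real.add_one_le_exp (8 * q)]

end IsCells

end IsPrimeDensity

end

section

open Filter Topology MeasureTheory
open scoped ENNReal

namespace IsPrimeDensity.IsCells

variable {d : ℝ → ℝ} {v w : ℕ → ℝ} {τ : ℝ}

theorem tendsto_prod_exp_cellError (h : IsCells d v) (hτ : 1 / 2 < τ)
    (hw : ∀ j, w j ∈ Set.Ioc (v j) (v (j + 1))) {s : ℂ} (hs : τ ≤ s.re) :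
    Tendsto (fun J => ∏ j ∈ Finset.range J, Complex.exp (cellError d v j (w j) s)) atTop
      (𝓝 (Complex.exp (totalError d v w s))) := by
  simp_rw [← Complex.exp_sum]
  exact (Complex.continuous_exp.tendsto _).comp
    (h.summable_norm_cellError hτ hw hs).of_norm.hasSum.tendsto_sum_nat

theorem exists_primes (h : IsCells d v) (hτ : 1 / 2 < τ) {W : ℝ → ℝ≥0∞} (hW : Measurable W)
    (hWi : ∫⁻ t, W t < ∞) (hWt : ∀ t, W t ≠ ∞) :
    ∃ w : ℕ → ℝ, (∀ j, w j ∈ Set.Ioc (v j) (v (j + 1))) ∧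
      ∫⁻ t : ℝ, W t * ENNReal.ofReal ‖Complex.exp (totalError d v w (τ + t * Complex.I))‖ < ∞ := by
  have hp := h.isProbabilityMeasure
  have hn := nullSingletonClass d v
  have hre : ∀ t : ℝ, τ ≤ ((τ : ℂ) + t * Complex.I).re := fun t => by simp
  obtain ⟨w, -, hw, hG⟩ := exists_seq_lintegral_lt_top hW hWi hWt (cellMeasure d v)
    (s := fun j => Set.Ioc (v j) (v (j + 1)))
    (fun j => mem_ae_iff.mp (ae_mem d v j))
    (F := fun j x t => Complex.exp (cellError d v j x (τ + t * Complex.I)))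
    (fun j => by
      have h1 : Continuous (laplace (cellMeasure d v j)) :=
        (laplace_differentiable ((ae_mem d v j).mono
          fun _ hy => Set.Ioc_subset_Icc_self hy)).continuous
      have h2 : Measurable fun p : ℝ × ℝ =>
          laplace (cellMeasure d v j) (τ + (p.2 : ℂ) * Complex.I) :=
        (h1.comp (by fun_prop)).measurable
      have h3 : Measurable fun p : ℝ × ℝ =>
          1 - Complex.exp (-((τ + (p.2 : ℂ) * Complex.I) * (p.1 : ℂ))) := by fun_prop
      exact Complex.measurable_exp.comp ((Complex.measurable_log.comp h3).neg.sub h2))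
    (e := fun j => 10 * Real.exp (-(2 * τ * v j)))
    ((h.summable_exp (by linarith)).mul_left _) (fun j => by positivity)
    (fun j t => h.lintegral_exp_cellError_le hτ.le (hre t) j)
  exact ⟨w, hw, hG _ fun t => h.tendsto_prod_exp_cellError hτ hw (hre t)⟩

/-- The Beurling system whose primes are `exp (w j)`. -/
noncomputable def system (h : IsCells d v) (hw : ∀ j, w j ∈ Set.Ioc (v j) (v (j + 1))) :
    BeurlingSystem where
  p j := Real.exp (w j)
  one_lt_p j := Real.one_lt_exp_iff.mpr (by linarith [h.one_le j, (hw j).1])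
  p_mono := monotone_nat_of_le_succ fun j =>
    Real.exp_le_exp.mpr ((hw j).2.trans (hw (j + 1)).1.le)
  p_tendsto := Real.tendsto_exp_atTop.comp
    (tendsto_atTop_mono (fun j => (hw j).1.le) h.tendsto)

theorem one_le_val (S : BeurlingSystem) (n : ℕ →₀ ℕ) : 1 ≤ S.val n := by
  rw [BeurlingSystem.val, Finsupp.prod]
  exact Finset.one_le_prod fun k _ => one_le_pow₀ (S.one_lt_p k).le

theorem val_cpow (h : IsCells d v) (hw : ∀ j, w j ∈ Set.Ioc (v j) (v (j + 1))) (n : ℕ →₀ ℕ)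
    (s : ℂ) : (((h.system hw).val n : ℝ) : ℂ) ^ (-s)
      = monomialVal (fun j => Complex.exp (-(s * w j))) n := by
  have h1 : (h.system hw).val n = Real.exp (∑ k ∈ n.support, n k * w k) := by
    rw [BeurlingSystem.val, Finsupp.prod, Real.exp_sum]
    exact Finset.prod_congr rfl fun k _ => (Real.exp_nat_mul _ _).symm
  rw [h1, Complex.cpow_def_of_ne_zero (by exact_mod_cast (Real.exp_pos _).ne'),
    ← Complex.ofReal_log (Real.exp_pos _).le, Real.log_exp, monomialVal, Finsupp.prod]
  simp_rw [← Complex.exp_nat_mul]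
  rw [← Complex.exp_sum]
  congr 1
  push_cast
  rw [Finset.sum_mul]
  exact Finset.sum_congr rfl fun k _ => by ring

theorem norm_exp_lt_one (h : IsCells d v) (hw : ∀ j, w j ∈ Set.Ioc (v j) (v (j + 1))) {s : ℂ}
    (hs : 0 < s.re) (j : ℕ) : ‖Complex.exp (-(s * w j))‖ < 1 := by
  rw [Complex.norm_exp]
  have e1 : (-(s * w j)).re = -(s.re * w j) := by simp
  rw [e1, Real.exp_lt_one_iff, neg_lt_zero]
  exact mul_pos hs (by linarith [h.one_le j, (hw j).1])

theorem summable_norm_exp (h : IsCells d v) (hw : ∀ j, w j ∈ Set.Ioc (v j) (v (j + 1))) {s : ℂ}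
    (hs : 1 < s.re) : Summable fun j => ‖Complex.exp (-(s * w j))‖ :=
  Summable.of_nonneg_of_le (fun _ => norm_nonneg _)
    (fun j => norm_exp_neg_mul_le (by linarith) le_rfl (by linarith [h.one_le j]) (hw j).1.le)
    (h.summable_exp hs)

theorem tsum_val_cpow (h : IsCells d v) (hw : ∀ j, w j ∈ Set.Ioc (v j) (v (j + 1))) {s : ℂ}
    (hs : 1 < s.re) : ∑' n, (((h.system hw).val n : ℝ) : ℂ) ^ (-s)
      = Complex.exp (∫ x in Set.Ioi (1 : ℝ), Complex.exp (-(s * x)) * d x)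
        * Complex.exp (totalError d v w s) := by
  simp_rw [h.val_cpow hw]
  rw [tsum_monomialVal (h.norm_exp_lt_one hw (by linarith)) (h.summable_norm_exp hw hs),
    ← Complex.exp_add]
  congr 1
  have h1 := (h.summable_norm_cellError (τ := 1) (by norm_num) hw hs.le).of_norm.hasSum
  rw [totalError, ← ((h.hasSum_laplace_cell hs).add h1).tsum_eq]
  refine tsum_congr fun j => ?_
  rw [cellError]
  ring

theorem summable_val_rpow (h : IsCells d v) (hw : ∀ j, w j ∈ Set.Ioc (v j) (v (j + 1))) :
    Summable fun n => (h.system hw).val n ^ (-2 : ℝ) := by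
  have hs : 1 < (2 : ℂ).re := by norm_num
  have h1 := summable_norm_monomialVal (h.norm_exp_lt_one hw (by linarith))
    (h.summable_norm_exp hw hs)
  refine h1.congr fun n => ?_
  rw [← h.val_cpow hw, Complex.norm_cpow_eq_rpow_re_of_pos
    (by linarith [one_le_val (h.system hw) n])]
  simp

end IsPrimeDensity.IsCells

end

section

open Filter Topology MeasureTheory
open scoped ENNReal

theorem re_pos_of_tendsto_mul_tsum {H : ℂ → ℂ} (hH : ContinuousAt H 1) (h1 : H 1 ≠ 0)
    {S : BeurlingSystem}
    (hζ : ∀ s : ℂ, 1 < s.re → H s = (s - 1) * ∑' n, ((S.val n : ℝ) : ℂ) ^ (-s)) :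
    0 < (H 1).re ∧ H 1 = ((H 1).re : ℝ) := by
  have hC : IsClosed {z : ℂ | 0 ≤ z.re ∧ z.im = 0} :=
    (isClosed_le continuous_const Complex.continuous_re).inter
      (isClosed_eq Complex.continuous_im continuous_const)
  have hval : ∀ n, 0 ≤ S.val n := fun n =>
    zero_le_one.trans (IsPrimeDensity.IsCells.one_le_val S n)
  have hlim : Tendsto (fun σ : ℝ => H σ) (𝓝[>] 1) (𝓝 (H 1)) := by
    have h2 : Tendsto (fun σ : ℝ => (σ : ℂ)) (𝓝[>] 1) (𝓝 1) := by
      have := (Complex.continuous_ofReal.tendsto (1 : ℝ)).mono_left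
        (nhdsWithin_le_nhds (s := Set.Ioi 1))
      simpa using this
    exact Tendsto.comp hH h2
  have hmem : H 1 ∈ {z : ℂ | 0 ≤ z.re ∧ z.im = 0} := by
    refine hC.mem_of_tendsto hlim ?_
    filter_upwards [self_mem_nhdsWithin] with σ hσ
    have hσ1 : (1 : ℝ) < σ := hσ
    have e : H σ = (((σ - 1) * ∑' n, S.val n ^ (-σ) : ℝ) : ℂ) := by
      rw [hζ σ (by simpa using hσ1)]
      push_cast
      congr 1
      refine tsum_congr fun n => ?_
      rw [Complex.ofReal_cpow (hval n)]
      push_cast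
      rfl
    rw [e]
    refine ⟨?_, Complex.ofReal_im _⟩
    rw [Complex.ofReal_re]
    exact mul_nonneg (by linarith) (tsum_nonneg fun n => Real.rpow_nonneg (hval n) _)
  have e : H 1 = ((H 1).re : ℝ) := Complex.ext (by simp) (by simpa using hmem.2)
  refine ⟨lt_of_le_of_ne hmem.1 fun h0 => h1 ?_, e⟩
  rw [e, ← h0, Complex.ofReal_zero]

namespace ScaleData

variable {η τ β : ℝ} {ℓ b : ℕ → ℝ}

theorem exists_system (h : ScaleData η τ β ℓ b) (hτ : τ < 1) {θ : ℝ} (hτθ : τ < θ)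
    (hθ : θ < 1) :
    ∃ (S : BeurlingSystem) (A K : ℝ) (γ : ℕ → ℝ) (g : ℂ → ℂ), 0 < A ∧
      (∃ u : ℕ → ℝ, Function.Injective u ∧ ∀ k, u k ∈ Set.Icc (0 : ℝ) 1 ∧
        γ k = scaleHeight τ (ℓ k) * (1 + u k)) ∧
      DifferentiableOn ℂ g {s | τ < s.re} ∧ (∀ s, g s ≠ 0) ∧
      (∀ s : ℂ, 1 < s.re → ∑' n, ((S.val n : ℝ) : ℂ) ^ (-s)
        = s / (s - 1) * g s * zeroProd η ℓ b γ s) ∧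
      ∀ x : ℝ, 1 ≤ x → |S.cnt x - A * x| ≤ K * x ^ θ := by
  have hτ2 := h.half_lt
  set σ := (τ + θ) / 2 with hσ
  set δ := (θ - τ) / 2 with hδ
  have hδ0 : 0 < δ := by rw [hδ]; linarith
  have hτσ : τ < σ := by rw [hσ]; linarith
  have hσ1 : σ < 1 := by rw [hσ]; linarith
  obtain ⟨γ, ⟨u, hu, huγ⟩, hγi⟩ := h.exists_ordinates hτ hτσ hδ0
  have hγ : ∀ k, scaleHeight τ (ℓ k) ≤ |γ k| := by
    intro k
    obtain ⟨h1, h2⟩ := huγ k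
    have h3 : 0 < scaleHeight τ (ℓ k) := Real.exp_pos _
    rw [h2, abs_of_nonneg (mul_nonneg h3.le (by linarith [h1.1]))]
    nlinarith [h1.1]
  set P := zeroProd η ℓ b γ with hP
  have hPd : DifferentiableOn ℂ P {s : ℂ | τ < s.re} := h.zeroProd_differentiableOn hτ hγ
  have hd := h.isPrimeDensity (γ := γ) hτ
  set d := primeDensity η ℓ b γ with hdd
  obtain ⟨v, hv1, hv2, hv3, hv4⟩ := hd.exists_cells
  have hc : IsPrimeDensity.IsCells d v := ⟨hd, hv1, hv2, hv3, hv4⟩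
  set W : ℝ → ℝ := fun t => (1 + |t|) ^ (-1 - δ) * ‖P (σ + t * Complex.I)‖ with hW
  have hPc : Continuous fun t : ℝ => P (σ + t * Complex.I) := continuous_vertical hτσ hPd
  have hWm : Measurable W := (measurable_one_add_abs_rpow _).mul hPc.norm.measurable
  have hW0 : ∀ t, 0 ≤ W t := fun t => by positivity
  obtain ⟨w, hw, hwi⟩ := hc.exists_primes (h.half_lt.trans hτσ)
    (W := fun t => ENNReal.ofReal (W t)) (ENNReal.measurable_ofReal.comp hWm)
    (by
      rw [← ofReal_integral_eq_lintegral_ofReal hγi (Eventually.of_forall hW0)]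
      exact ENNReal.ofReal_lt_top)
    (fun _ => ENNReal.ofReal_ne_top)
  set Z := IsPrimeDensity.totalError d v w with hZ
  have hZd : DifferentiableOn ℂ Z {s | τ < s.re} := hc.differentiableOn_totalError hτ2 hw
  have hLd : Differentiable ℂ (laplace initialMeasure) := laplace_differentiable ae_initialMeasure
  set g : ℂ → ℂ := fun s => Complex.exp (-laplace initialMeasure s + Z s) with hg
  have hgd : DifferentiableOn ℂ g {s | τ < s.re} :=
    (hLd.neg.differentiableOn.add hZd).cexp
  set H : ℂ → ℂ := fun s => s * g s * P s with hH
  have hHd : DifferentiableOn ℂ H {s | τ < s.re} := (differentiableOn_id.mul hgd).mul hPd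
  have hsum : ∀ s : ℂ, 1 < s.re → ∑' n, (((hc.system hw).val n : ℝ) : ℂ) ^ (-s)
      = s / (s - 1) * g s * P s := by
    intro s hs
    rw [hc.tsum_val_cpow hw hs, h.exp_integral_primeDensity hτ hs, hg]
    simp only [Complex.exp_add]
    ring
  have hHζ : ∀ s : ℂ, 1 < s.re →
      H s = (s - 1) * ∑' n, (((hc.system hw).val n : ℝ) : ℂ) ^ (-s) := by
    intro s hs
    have h1 : s - 1 ≠ 0 := by
      intro h0
      have := congrArg Complex.re h0
      simp at this
      linarith
    rw [hsum s hs, hH]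
    field_simp
  have hH1 : H 1 ≠ 0 := by
    refine mul_ne_zero (mul_ne_zero one_ne_zero (Complex.exp_ne_zero _)) ?_
    exact h.zeroProd_ne_zero hτ hγ (by simpa using hτ.le) (by simpa using h.lt_one)
  have hHc : ContinuousAt H 1 :=
    (hHd.differentiableAt ((isOpen_re_gt τ).mem_nhds (by simpa using hτ))).continuousAt
  obtain ⟨hA, hAe⟩ := re_pos_of_tendsto_mul_tsum hHc hH1 hHζ
  set M := initialMeasure.real Set.univ with hM
  have hM0 : 0 ≤ M := measureReal_nonneg
  have hL : ∀ s : ℂ, 0 ≤ s.re → ‖Complex.exp (-laplace initialMeasure s)‖ ≤ Real.exp M := by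
    intro s hs
    refine (Complex.norm_exp_le_exp_norm _).trans ?_
    rw [norm_neg, Real.exp_le_exp]
    exact norm_laplace_le (ae_initialMeasure.mono fun _ hx => hx.1) hs
  set E := ∑' j, IsPrimeDensity.cellBound v τ j with hE
  have hE0 : 0 ≤ E := tsum_nonneg fun j => hc.cellBound_nonneg hτ2.le j
  set C := Real.exp (2 + M + 3 * E + 1) with hC
  have hC2 : E + 2 ≤ C := by
    rw [hC]
    linarith [Real.add_one_le_exp (2 + M + 3 * E + 1)]
  have hb : ∀ s : ℂ, σ ≤ s.re → s.re ≤ 2 → ‖H s‖ ≤ C * Real.exp (C * |s.im|) := by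
    intro s hs1 hs2
    have hs0 : ‖s‖ ≤ 2 + |s.im| := by
      refine (Complex.norm_le_abs_re_add_abs_im s).trans ?_
      rw [abs_of_nonneg (by linarith : 0 ≤ s.re)]
      linarith
    have h1 : ‖s‖ ≤ Real.exp (2 + |s.im|) := by
      linarith [Real.add_one_le_exp (2 + |s.im|)]
    have h2 := hL s (by linarith)
    have h3 : ‖Complex.exp (Z s)‖ ≤ Real.exp (E * (3 + |s.im|)) := by
      refine (Complex.norm_exp_le_exp_norm _).trans (Real.exp_le_exp.mpr ?_)
      refine (hc.norm_totalError_le hτ2 hw (by linarith)).trans ?_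
      exact mul_le_mul_of_nonneg_left (by linarith) hE0
    have h4 := h.norm_zeroProd_le hτ hγ (s := s) (by linarith)
    rw [hH]
    simp only [hg, Complex.exp_add, norm_mul]
    calc ‖s‖ * (‖Complex.exp (-laplace initialMeasure s)‖ * ‖Complex.exp (Z s)‖) * ‖P s‖
        ≤ Real.exp (2 + |s.im|) * (Real.exp M * Real.exp (E * (3 + |s.im|)))
          * Real.exp (1 + |s.im|) := by gcongr
      _ = C * Real.exp ((E + 2) * |s.im|) := by
          rw [hC, ← Real.exp_add, ← Real.exp_add, ← Real.exp_add, ← Real.exp_add]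
          congr 1
          ring
      _ ≤ _ := by gcongr
  have hint : Integrable fun t : ℝ => ‖H (σ + t * Complex.I)‖ * (1 + |t|) ^ (-2 - δ) := by
    have hGi : Integrable fun t : ℝ => W t * ‖Complex.exp (Z (σ + t * Complex.I))‖ := by
      have hZc : Continuous fun t : ℝ => Complex.exp (Z (σ + t * Complex.I)) :=
        continuous_vertical (H := fun s => Complex.exp (Z s)) hτσ hZd.cexp
      refine ⟨(hWm.mul hZc.norm.measurable).aestronglyMeasurable, ?_⟩
      rw [hasFiniteIntegral_iff_ofReal (Eventually.of_forall fun t =>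
        mul_nonneg (hW0 t) (norm_nonneg _))]
      simp_rw [ENNReal.ofReal_mul (hW0 _)]
      exact hwi
    have hHc' : Continuous fun t : ℝ => H (σ + t * Complex.I) := continuous_vertical hτσ hHd
    refine (hGi.const_mul (Real.exp M)).mono'
      (hHc'.norm.measurable.mul (measurable_one_add_abs_rpow _)).aestronglyMeasurable
      (Eventually.of_forall fun t => ?_)
    have ht : 0 < 1 + |t| := by positivity
    have h1 : ‖(σ : ℂ) + t * Complex.I‖ ≤ 1 + |t| := by
      refine (norm_add_le _ _).trans ?_
      rw [Complex.norm_real, norm_mul, Complex.norm_real, Complex.norm_I, Real.norm_eq_abs,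
        Real.norm_eq_abs, abs_of_nonneg (by linarith)]
      linarith
    have h2 := hL ((σ : ℂ) + t * Complex.I) (by simp; linarith)
    have h3 : (1 + |t|) ^ (-1 - δ) = (1 + |t|) * (1 + |t|) ^ (-2 - δ) := by
      rw [show -1 - δ = 1 + (-2 - δ) by ring, Real.rpow_add ht, Real.rpow_one]
    rw [norm_mul, norm_norm, Real.norm_of_nonneg (by positivity)]
    simp only [hH, hg, hW, Complex.exp_add, norm_mul]
    rw [h3]
    calc _ ≤ (1 + |t|) * (Real.exp M * ‖Complex.exp (Z (σ + t * Complex.I))‖)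
          * ‖P (σ + t * Complex.I)‖ * (1 + |t|) ^ (-2 - δ) := by gcongr
      _ = _ := by ring
  obtain ⟨K, hK⟩ := ncard_sub_linear_bound (IsPrimeDensity.IsCells.one_le_val (hc.system hw))
    (hc.summable_val_rpow hw) (by linarith) hτσ hδ0 (by rw [hσ, hδ]; linarith) hθ hHd hAe
    (fun s hs => hHζ s (by rw [hs]; norm_num)) hb hint
  exact ⟨hc.system hw, (H 1).re, K, γ, g, hA, ⟨u, hu, huγ⟩, hgd, fun _ => Complex.exp_ne_zero _,
    hsum, hK⟩

end ScaleData

end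

section

open Filter Topology MeasureTheory

theorem finite_zeros_inter_isCompact {f : ℂ → ℂ} {τ : ℝ}
    (hf : DifferentiableOn ℂ f {s | τ < s.re}) {z : ℂ} (hz : τ < z.re) (hfz : f z ≠ 0)
    {k : Set ℂ} (hk : IsCompact k) (hkτ : k ⊆ {s | τ < s.re}) :
    {s | s ∈ k ∧ f s = 0}.Finite := by
  by_contra hinf
  obtain ⟨x, hx, hacc⟩ := Set.Infinite.exists_accPt_of_subset_isCompact hinf hk fun s hs => hs.1
  rw [accPt_iff_frequently_nhdsNE] at hacc
  have hconn : IsPreconnected {s : ℂ | τ < s.re} := (convex_halfSpace_re_gt τ).isPreconnected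
  exact hfz ((hf.analyticOnNhd (isOpen_re_gt τ)).eqOn_zero_of_preconnected_of_frequently_eq_zero
    hconn (hkτ hx) (hacc.mono fun s hs => hs.2) hz)

/-- The exponent for which the construction produces `T ^ scaleExponent` zeros. -/
noncomputable def scaleExponent (τ δ σ : ℝ) : ℝ := ((1 - σ) / (1 - τ) - δ) / (1 + δ)

theorem exists_le_scaleExponent {θ β ε : ℝ} (hθ : 1 / 2 < θ) (hθβ : θ < β) (hβ : β < 1)
    (hε : 0 < ε) (hε1 : ε < 1) :
    ∃ τ δ : ℝ, 1 / 2 < τ ∧ τ < θ ∧ 0 < δ ∧ δ ≤ 1 ∧ ∀ σ, θ ≤ σ → σ ≤ β →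
      (1 + β - 2 * σ) * (1 - ε) / (1 + β - 2 * θ) ≤ scaleExponent τ δ σ := by
  have hε2 : 0 < 1 - ε / 2 := by linarith
  have h1 : 1 - (1 - θ) / (1 - ε / 2) < θ := by
    have : 1 - θ < (1 - θ) / (1 - ε / 2) := by
      rw [lt_div_iff₀ hε2]
      nlinarith
    linarith
  obtain ⟨τ, hτ1, hτ2⟩ := exists_between (max_lt hθ h1)
  obtain ⟨hτ3, hτ4⟩ := max_lt_iff.mp hτ1
  refine ⟨τ, (1 - β) * ε / 4, hτ3, hτ2, by nlinarith, by nlinarith, fun σ hσ1 hσ2 => ?_⟩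
  set δ := (1 - β) * ε / 4 with hδ
  have hδ0 : 0 < δ := by rw [hδ]; nlinarith
  have hδε : δ ≤ ε / 4 := by rw [hδ]; nlinarith
  have hθ1 : 0 < 1 - θ := by linarith
  have hτ0 : 0 < 1 - τ := by linarith
  have hx : 0 < 1 - σ := by linarith
  have hD : 0 < 1 + β - 2 * θ := by linarith
  have h2 : (1 + β - 2 * σ) / (1 + β - 2 * θ) ≤ (1 - σ) / (1 - θ) := by
    rw [div_le_div_iff₀ hD hθ1]
    nlinarith [mul_nonneg (sub_nonneg.mpr hσ1) (by linarith : 0 ≤ 1 - β)]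
  have h3 : (1 - ε / 2) / (1 - θ) ≤ 1 / (1 - τ) := by
    have h4 : 1 - τ < (1 - θ) / (1 - ε / 2) := by linarith
    rw [lt_div_iff₀ hε2] at h4
    rw [div_le_div_iff₀ hθ1 hτ0]
    nlinarith
  rw [scaleExponent, le_div_iff₀ (by linarith)]
  have h5 : (1 + β - 2 * σ) * (1 - ε) / (1 + β - 2 * θ) ≤ (1 - σ) / (1 - θ) * (1 - ε) := by
    rw [mul_div_right_comm]
    exact mul_le_mul_of_nonneg_right h2 (by linarith)
  have h6 : (1 - ε / 2) * ((1 - σ) / (1 - θ)) ≤ (1 - σ) / (1 - τ) := by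
    have := mul_le_mul_of_nonneg_left h3 hx.le
    calc _ = (1 - σ) * ((1 - ε / 2) / (1 - θ)) := by ring
      _ ≤ _ := this
      _ = _ := by ring
  have h7 : 1 - β ≤ (1 - σ) / (1 - θ) := by
    rw [le_div_iff₀ hθ1]
    nlinarith
  set y := (1 - σ) / (1 - θ) with hy
  have h8 := mul_le_mul_of_nonneg_right h5 (by linarith : 0 ≤ 1 + δ)
  have h9 : δ ≤ y * (ε / 4) := by
    rw [hδ]
    nlinarith
  have hy0 : 0 ≤ y := by linarith
  have h10 : y * (1 - ε) * (1 + δ) ≤ y * (1 - ε + ε / 4) := by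
    rw [mul_assoc]
    refine mul_le_mul_of_nonneg_left ?_ hy0
    nlinarith
  linarith

namespace ScaleData

/-- The scale indexed by `k`, whose zeros have height about `exp (n₀ + n)`, `n = k.unpair.1`. -/
noncomputable def pairScale (τ : ℝ) (n₀ k : ℕ) : ℝ := ((n₀ + k.unpair.1 : ℕ) : ℝ) / (1 - τ)

/-- The real part of the zero indexed by `k`. -/
noncomputable def pairAbscissa (τ δ β : ℝ) (n₀ k : ℕ) : ℝ :=
  min β (1 - (1 - τ) * ((1 + δ) * Real.log ((k.unpair.2 : ℝ) + 1)
    / ((n₀ + k.unpair.1 : ℕ) : ℝ) + δ))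

theorem scaleMass_pair_le {τ δ β : ℝ} (hτ : τ < 1) {n₀ : ℕ} (hn₀ : 0 < n₀) (k : ℕ) :
    scaleMass (δ / 2) τ (pairScale τ n₀ k) (pairAbscissa τ δ β n₀ k)
      ≤ Real.exp (-(δ / 2 * n₀)) * (Real.exp (-(δ / 2)) ^ k.unpair.1
        * ((k.unpair.2 : ℝ) + 1) ^ (-(1 + δ))) := by
  have hN : (0 : ℝ) < ((n₀ + k.unpair.1 : ℕ) : ℝ) := by exact_mod_cast (by omega)
  have hτ0 : 0 < 1 - τ := by linarith
  have hj : (0 : ℝ) < (k.unpair.2 : ℝ) + 1 := by positivity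
  rw [Real.rpow_def_of_pos hj, ← Real.exp_nat_mul, ← Real.exp_add, ← Real.exp_add, scaleMass,
    Real.exp_le_exp]
  have h1 : pairScale τ n₀ k * (1 - τ) = ((n₀ + k.unpair.1 : ℕ) : ℝ) := by
    rw [pairScale]
    field_simp
  have h2 : pairScale τ n₀ k * (pairAbscissa τ δ β n₀ k - 1)
      ≤ -((1 + δ) * Real.log ((k.unpair.2 : ℝ) + 1)) - δ * ((n₀ + k.unpair.1 : ℕ) : ℝ) := by
    have h3 : pairAbscissa τ δ β n₀ k - 1 ≤ -((1 - τ) * ((1 + δ) *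
        Real.log ((k.unpair.2 : ℝ) + 1) / ((n₀ + k.unpair.1 : ℕ) : ℝ) + δ)) := by
      have h5 : pairAbscissa τ δ β n₀ k ≤ 1 - (1 - τ) * ((1 + δ) *
        Real.log ((k.unpair.2 : ℝ) + 1) / ((n₀ + k.unpair.1 : ℕ) : ℝ) + δ) := min_le_right _ _
      linarith
    have h4 : 0 ≤ pairScale τ n₀ k := by rw [pairScale]; positivity
    refine (mul_le_mul_of_nonneg_left h3 h4).trans (le_of_eq ?_)
    rw [mul_neg, ← mul_assoc, h1]
    field_simp
    ring
  rw [h1]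
  push_cast at h2 ⊢
  linarith

theorem summable_pair {δ : ℝ} (hδ : 0 < δ) : Summable fun k : ℕ =>
    Real.exp (-(δ / 2)) ^ k.unpair.1 * ((k.unpair.2 : ℝ) + 1) ^ (-(1 + δ)) := by
  have h1 : Summable fun n : ℕ => Real.exp (-(δ / 2)) ^ n :=
    summable_geometric_of_lt_one (Real.exp_pos _).le (by rw [Real.exp_lt_one_iff]; linarith)
  have h2 : Summable fun j : ℕ => ((j : ℝ) + 1) ^ (-(1 + δ)) := by
    have := (summable_nat_add_iff 1).mpr
      (Real.summable_nat_rpow (p := -(1 + δ)) |>.mpr (by linarith))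
    simpa using this
  have h3 := h1.mul_of_nonneg h2 (fun n => by positivity) (fun j => by positivity)
  exact (Nat.pairEquiv.symm.summable_iff (f := fun p : ℕ × ℕ =>
    Real.exp (-(δ / 2)) ^ p.1 * ((p.2 : ℝ) + 1) ^ (-(1 + δ)))).mpr h3

theorem exists_scaleData {τ δ β : ℝ} (hτ1 : 1 / 2 < τ) (hτ : τ < 1) (hδ : 0 < δ) (hδ1 : δ ≤ 1)
    (hβ : β < 1) : ∃ n₀ : ℕ, 0 < n₀ ∧
      ScaleData (δ / 2) τ β (pairScale τ n₀) (pairAbscissa τ δ β n₀) := by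
  set B := ∑' k : ℕ, Real.exp (-(δ / 2)) ^ k.unpair.1 * ((k.unpair.2 : ℝ) + 1) ^ (-(1 + δ)) with hB
  have hsum := summable_pair hδ
  have hB0 : 0 ≤ B := tsum_nonneg fun k => by positivity
  have h1 : Tendsto (fun n : ℕ => Real.exp (-(δ / 2 * n)) * B) atTop (𝓝 (0 * B)) := by
    refine Tendsto.mul_const _ (Real.tendsto_exp_neg_atTop_nhds_zero.comp ?_)
    exact tendsto_natCast_atTop_atTop.const_mul_atTop (by linarith)
  rw [zero_mul] at h1
  obtain ⟨n₀, hn1, hn2, hn3⟩ := ((h1.eventually_le_const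
    (show (0 : ℝ) < δ / 2 / 64 by positivity)).and
    ((eventually_gt_atTop 0).and (tendsto_natCast_atTop_atTop.eventually_ge_atTop
      (4 / (δ / 2) : ℝ)))).exists
  have hle := scaleMass_pair_le (δ := δ) (β := β) hτ hn2
  have hs := Summable.of_nonneg_of_le (fun _ => scaleMass_pos.le) hle (hsum.mul_left _)
  refine ⟨n₀, hn2, ⟨by positivity, by linarith, hτ1, hβ, fun k => ?_, fun k => min_le_left _ _, hs,
    ?_⟩⟩
  · rw [pairScale, le_div_iff₀ (by linarith)]
    push_cast
    have h2 : 0 ≤ 4 / (δ / 2) := by positivity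
    have h3 : (0 : ℝ) ≤ k.unpair.1 := Nat.cast_nonneg _
    nlinarith
  · refine (hs.tsum_le_tsum hle (hsum.mul_left _)).trans ?_
    rw [tsum_mul_left]
    exact hn1

theorem le_pairAbscissa {τ δ β σ : ℝ} (hτ : τ < 1) (hδ : 0 < δ) (hσ : σ ≤ β) {n₀ n j : ℕ}
    (hn : 0 < n₀) (hj : ((j : ℝ) + 1) ≤ Real.exp (((n₀ + n : ℕ) : ℝ) * scaleExponent τ δ σ)) :
    σ ≤ pairAbscissa τ δ β n₀ (Nat.pair n j) := by
  have hN : (0 : ℝ) < ((n₀ + n : ℕ) : ℝ) := by exact_mod_cast (by omega)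
  have hτ0 : 0 < 1 - τ := by linarith
  refine le_min hσ ?_
  rw [Nat.unpair_pair]
  have h1 := (Real.log_le_iff_le_exp (by positivity)).mpr hj
  have h2 : (1 + δ) * Real.log ((j : ℝ) + 1) / ((n₀ + n : ℕ) : ℝ)
      ≤ (1 - σ) / (1 - τ) - δ := by
    rw [div_le_iff₀ hN]
    refine (mul_le_mul_of_nonneg_left h1 (by linarith)).trans (le_of_eq ?_)
    rw [scaleExponent]
    field_simp
  have h3 := mul_le_mul_of_nonneg_left h2 hτ0.le
  have h4 : (1 - τ) * ((1 - σ) / (1 - τ) - δ) = 1 - σ - (1 - τ) * δ := by field_simp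
  simp only
  linarith

end ScaleData

end

section

open Filter Topology MeasureTheory

namespace ScaleData

theorem le_zeroCount {τ δ β σ T : ℝ} (hτ : τ < 1) (hδ : 0 < δ) (hσ : σ ≤ β)
    {n₀ n : ℕ} (hn₀ : 0 < n₀) {ζ : ℂ → ℂ} {γ u : ℕ → ℝ} (hu : Function.Injective u)
    (huγ : ∀ k, u k ∈ Set.Icc (0 : ℝ) 1 ∧ γ k = scaleHeight τ (pairScale τ n₀ k) * (1 + u k))
    (hζ : ∀ k, σ ≤ pairAbscissa τ δ β n₀ k →
      ζ (pairAbscissa τ δ β n₀ k + γ k * Complex.I) = 0)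
    (hfin : {ρ : ℂ | ζ ρ = 0 ∧ ρ ≠ 1 ∧ σ ≤ ρ.re ∧ |ρ.im| ≤ T}.Finite)
    (hT : 2 * Real.exp ((n₀ + n : ℕ) : ℝ) ≤ T) (hexp : 0 ≤ scaleExponent τ δ σ) :
    Real.exp (((n₀ + n : ℕ) : ℝ) * scaleExponent τ δ σ) / 2 ≤ zeroCount ζ σ T := by
  set X := Real.exp (((n₀ + n : ℕ) : ℝ) * scaleExponent τ δ σ) with hX
  have hτ0 : 0 < 1 - τ := by linarith
  have hX1 : 1 ≤ X := Real.one_le_exp (by positivity)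
  set J := ⌊X⌋₊ with hJ
  have hJ1 : X < J + 1 := Nat.lt_floor_add_one X
  have hJ2 : (J : ℝ) ≤ X := Nat.floor_le (by linarith)
  have hJ3 : (1 : ℝ) ≤ J := by
    have : 1 ≤ J := Nat.le_floor (by simpa using hX1)
    exact_mod_cast this
  set f : ℕ → ℂ := fun j =>
    pairAbscissa τ δ β n₀ (Nat.pair n j) + γ (Nat.pair n j) * Complex.I with hf
  have hre : ∀ j, (f j).re = pairAbscissa τ δ β n₀ (Nat.pair n j) := fun j => by simp [hf]
  have him : ∀ j, (f j).im = Real.exp ((n₀ + n : ℕ) : ℝ) * (1 + u (Nat.pair n j)) := fun j => by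
    have h1 : scaleHeight τ (pairScale τ n₀ (Nat.pair n j)) = Real.exp ((n₀ + n : ℕ) : ℝ) := by
      rw [scaleHeight, pairScale, Nat.unpair_pair]
      congr 1
      field_simp
    rw [← h1, ← (huγ _).2]
    simp [hf]
  have hinj : Function.Injective f := by
    intro i j hij
    have h1 := congrArg Complex.im hij
    rw [him, him] at h1
    have h2 := hu (add_left_cancel (mul_left_cancel₀ (Real.exp_pos _).ne' h1))
    exact (Nat.pair_eq_pair.mp h2).2
  have hsub : (((Finset.range J).image f : Finset ℂ) : Set ℂ)
      ⊆ {ρ : ℂ | ζ ρ = 0 ∧ ρ ≠ 1 ∧ σ ≤ ρ.re ∧ |ρ.im| ≤ T} := by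
    intro ρ hρ
    rw [Finset.mem_coe, Finset.mem_image] at hρ
    obtain ⟨j, hj, rfl⟩ := hρ
    have hj1 : (j : ℝ) + 1 ≤ X := by
      have : j + 1 ≤ J := Finset.mem_range.mp hj
      exact le_trans (by exact_mod_cast this) hJ2
    have h1 := le_pairAbscissa hτ hδ hσ hn₀ hj1
    have h2 := (huγ (Nat.pair n j)).1
    have h3 := Real.exp_pos ((n₀ + n : ℕ) : ℝ)
    have h4 : 0 < (f j).im := by
      rw [him]
      exact mul_pos h3 (by linarith [h2.1])
    refine ⟨hζ _ h1, fun h => ?_, by rwa [hre], ?_⟩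
    · rw [h] at h4
      simp at h4
    · rw [abs_of_pos h4, him]
      nlinarith [h2.2]
  have hcard : J ≤ {ρ : ℂ | ζ ρ = 0 ∧ ρ ≠ 1 ∧ σ ≤ ρ.re ∧ |ρ.im| ≤ T}.ncard := by
    have := Set.ncard_le_ncard hsub hfin
    rwa [Set.ncard_coe_finset, Finset.card_image_of_injective _ hinj, Finset.card_range] at this
  have : (J : ℝ) ≤ zeroCount ζ σ T := by
    rw [zeroCount]
    exact_mod_cast hcard
  linarith

end ScaleData

theorem exists_nat_scale {n₀ : ℕ} {T a : ℝ} (hT : 2 * Real.exp n₀ ≤ T) (ha0 : 0 ≤ a)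
    (ha1 : a ≤ 1) : ∃ n : ℕ, 2 * Real.exp ((n₀ + n : ℕ) : ℝ) ≤ T ∧
      1 / 12 * T ^ a ≤ Real.exp (((n₀ + n : ℕ) : ℝ) * a) / 2 := by
  have hT2 : 0 < T / 2 := by linarith [Real.exp_pos n₀]
  have hT0 : 0 < T := by linarith
  have hlog : (n₀ : ℝ) ≤ Real.log (T / 2) := by
    rw [Real.le_log_iff_exp_le hT2]
    linarith
  have hn : n₀ ≤ ⌊Real.log (T / 2)⌋₊ := Nat.le_floor hlog
  refine ⟨⌊Real.log (T / 2)⌋₊ - n₀, ?_⟩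
  rw [Nat.add_sub_cancel' hn]
  set N := ⌊Real.log (T / 2)⌋₊ with hN
  have h1 : (N : ℝ) ≤ Real.log (T / 2) := Nat.floor_le ((Nat.cast_nonneg n₀).trans hlog)
  have h2 : Real.log (T / 2) < N + 1 := Nat.lt_floor_add_one _
  constructor
  · rw [Real.le_log_iff_exp_le hT2] at h1
    linarith
  · have h3 : T ≤ 6 * Real.exp N := by
      rw [Real.log_lt_iff_lt_exp hT2, Real.exp_add] at h2
      have h4 := Real.exp_one_lt_d9
      nlinarith [Real.exp_pos (N : ℝ)]
    have h5 : T ^ a ≤ 6 * Real.exp (N * a) := by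
      refine (Real.rpow_le_rpow hT0.le h3 ha0).trans ?_
      rw [Real.mul_rpow (by norm_num) (Real.exp_pos _).le, ← Real.exp_mul]
      refine mul_le_mul_of_nonneg_right ?_ (Real.exp_pos _).le
      have := Real.rpow_le_rpow_of_exponent_le (x := 6) (by norm_num) ha1
      rwa [Real.rpow_one] at this
    linarith

theorem scaleExponent_le_one {τ δ σ : ℝ} (hδ : 0 ≤ δ) (hτ : τ < 1) (hσ : τ ≤ σ) :
    scaleExponent τ δ σ ≤ 1 := by
  rw [scaleExponent, div_le_one (by linarith)]
  have : (1 - σ) / (1 - τ) ≤ 1 := (div_le_one (by linarith)).mpr (by linarith)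
  linarith

theorem exists_system_zeroCount {θ β ε : ℝ} (hθ : 1 / 2 < θ) (hθβ : θ < β) (hβ : β < 1)
    (hε : 0 < ε) (hε1 : ε < 1) :
    ∃ (S : BeurlingSystem) (A T₀ K : ℝ) (ζ : ℂ → ℂ), 0 < A ∧ 1 ≤ T₀ ∧ S.IsZeta θ ζ ∧
      (∀ ρ : ℂ, β < ρ.re → ρ ≠ 1 → ζ ρ ≠ 0) ∧
      (∀ σ T : ℝ, θ < σ → σ ≤ β → T₀ ≤ T →
        1 / 12 * T ^ ((1 + β - 2 * σ) * (1 - ε) / (1 + β - 2 * θ)) ≤ zeroCount ζ σ T) ∧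
      ∀ x : ℝ, 1 ≤ x → |S.cnt x - A * x| ≤ K * x ^ θ := by
  obtain ⟨τ, δ, hτ1, hτθ, hδ, hδ1, hexp⟩ := exists_le_scaleExponent hθ hθβ hβ hε hε1
  have hτ : τ < 1 := by linarith
  obtain ⟨n₀, hn₀, h⟩ := ScaleData.exists_scaleData hτ1 hτ hδ hδ1 hβ
  obtain ⟨S, A, K, γ, g, hA, ⟨u, hu, huγ⟩, hgd, hg0, hsum, hcnt⟩ :=
    h.exists_system hτ hτθ (by linarith)
  have hγ : ∀ k, scaleHeight τ (ScaleData.pairScale τ n₀ k) ≤ |γ k| := by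
    intro k
    obtain ⟨h1, h2⟩ := huγ k
    have h3 : 0 < scaleHeight τ (ScaleData.pairScale τ n₀ k) := Real.exp_pos _
    rw [h2, abs_of_nonneg (mul_nonneg h3.le (by linarith [h1.1]))]
    nlinarith [h1.1]
  set P := ScaleData.zeroProd (δ / 2) (ScaleData.pairScale τ n₀)
    (ScaleData.pairAbscissa τ δ β n₀) γ with hP
  have hPd : DifferentiableOn ℂ P {s : ℂ | τ < s.re} := h.zeroProd_differentiableOn hτ hγ
  have hPβ : ∀ s : ℂ, β < s.re → P s ≠ 0 := fun s hs =>
    h.zeroProd_ne_zero hτ hγ (by linarith) hs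
  set ζ : ℂ → ℂ := fun s => s / (s - 1) * g s * P s with hζ
  have hne : ∀ s : ℂ, s ≠ 1 → s - 1 ≠ 0 := fun s hs => sub_ne_zero.mpr hs
  have hfac : ∀ s : ℂ, 0 < s.re → s ≠ 1 → s / (s - 1) * g s ≠ 0 := by
    intro s hs hs1
    refine mul_ne_zero (div_ne_zero (fun h0 => ?_) (hne s hs1)) (hg0 s)
    rw [h0] at hs
    simp at hs
  refine ⟨S, A, 2 * Real.exp n₀, K, ζ, hA, ?_, ⟨?_, fun s hs => (hsum s hs).symm⟩, ?_, ?_, hcnt⟩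
  · have := Real.one_le_exp (Nat.cast_nonneg (α := ℝ) n₀)
    linarith
  · have hsub : {s : ℂ | θ < s.re ∧ s ≠ 1} ⊆ {s : ℂ | τ < s.re} := fun s hs => hτθ.trans hs.1
    refine DifferentiableOn.mul (DifferentiableOn.mul ?_ (hgd.mono hsub)) (hPd.mono hsub)
    exact differentiableOn_id.div (differentiableOn_id.sub_const 1) fun s hs => hne s hs.2
  · intro ρ hρ hρ1
    exact mul_ne_zero (hfac ρ (by linarith) hρ1) (hPβ ρ hρ)
  · intro σ T hσ hσβ hT
    have he := hexp σ hσ.le hσβ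
    have he0 : 0 ≤ (1 + β - 2 * σ) * (1 - ε) / (1 + β - 2 * θ) :=
      div_nonneg (mul_nonneg (by linarith) (by linarith)) (by linarith)
    have hT1 : 1 ≤ T := by
      have := Real.one_le_exp (Nat.cast_nonneg (α := ℝ) n₀)
      linarith
    obtain ⟨n, hn1, hn2⟩ := exists_nat_scale hT (he0.trans he)
      (scaleExponent_le_one hδ.le hτ (hτθ.le.trans hσ.le))
    have hfin : {ρ : ℂ | ζ ρ = 0 ∧ ρ ≠ 1 ∧ σ ≤ ρ.re ∧ |ρ.im| ≤ T}.Finite := by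
      have hk : IsCompact (Set.Icc σ β ×ℂ Set.Icc (-T) T) := isCompact_Icc.reProdIm isCompact_Icc
      refine (finite_zeros_inter_isCompact hPd (z := 1) (by simpa using hτ)
        (hPβ 1 (by simpa using hβ)) hk ?_).subset ?_
      · intro s hs
        rw [Complex.mem_reProdIm] at hs
        exact hτθ.trans (hσ.trans_le hs.1.1)
      · rintro ρ ⟨h1, h2, h3, h4⟩
        have h5 : P ρ = 0 := (mul_eq_zero.mp h1).resolve_left (hfac ρ (by linarith) h2)
        refine ⟨?_, h5⟩
        rw [Complex.mem_reProdIm]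
        exact ⟨⟨h3, not_lt.mp fun h6 => hPβ ρ h6 h5⟩, abs_le.mp h4⟩
    refine le_trans ?_ (hn2.trans (ScaleData.le_zeroCount hτ hδ hσβ hn₀ hu huγ (fun k hk => ?_)
      hfin hn1 (he0.trans he)))
    · exact mul_le_mul_of_nonneg_left (Real.rpow_le_rpow_of_exponent_le hT1 he) (by norm_num)
    · have : P (ScaleData.pairAbscissa τ δ β n₀ k + γ k * Complex.I) = 0 :=
        h.zeroProd_eq_zero hτ hγ k (by linarith)
      simp only [hζ]
      rw [this, mul_zero]

end

/-- **Sharpness of the zero-density theorem** (Appendix A). For all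
`1/2 < θ < β < 1` and `ε > 0` there is a Beurling system with
`N(x) = Ax + O(x^θ exp(C√(log x)))` whose zeta function has no zeros with
`Re s > β`, has `N(β, T) ≥ c T^{(1-β)(1-ε)/(1+β-2θ)}`, and has
`N(σ, T) ≥ c T^{(1+β-2σ)(1-ε)/(1+β-2θ)}` for `θ < σ < β`, for all `T ≥ T₀`. -/
theorem beurling_zero_density_sharpness
    (θ β ε : ℝ) (hθ : 1 / 2 < θ) (hθβ : θ < β) (hβ : β < 1) (hε : 0 < ε) :
    ∃ (S : BeurlingSystem) (A C c T₀ K : ℝ) (ζ : ℂ → ℂ),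
      0 < A ∧ 0 < C ∧ 0 < c ∧
      (DifferentiableOn ℂ ζ {s : ℂ | θ < s.re ∧ s ≠ 1} ∧
        ∀ s : ℂ, 1 < s.re → ζ s = ∑' n : ℕ →₀ ℕ, (S.val n : ℂ) ^ (-s)) ∧
      (∀ ρ : ℂ, β < ρ.re → ρ ≠ 1 → ζ ρ ≠ 0) ∧
      (∀ T : ℝ, T₀ ≤ T →
        c * T ^ ((1 - β) * (1 - ε) / (1 + β - 2 * θ)) ≤ zeroCount ζ β T) ∧
      (∀ σ T : ℝ, θ < σ → σ < β → T₀ ≤ T →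
        c * T ^ ((1 + β - 2 * σ) * (1 - ε) / (1 + β - 2 * θ)) ≤ zeroCount ζ σ T) ∧
      (∀ x : ℝ, 1 ≤ x →
        |S.cnt x - A * x| ≤ K * x ^ θ * Real.exp (C * Real.sqrt (Real.log x))) := by
  obtain ⟨S, A, T₀, K, ζ, hA, hT₀, hζ, hne, hcount, hcnt⟩ :=
    exists_system_zeroCount hθ hθβ hβ (lt_min hε one_half_pos)
      ((min_le_right _ _).trans_lt one_half_lt_one)
  have hcount' : ∀ σ T : ℝ, θ < σ → σ ≤ β → T₀ ≤ T →
      1 / 12 * T ^ ((1 + β - 2 * σ) * (1 - ε) / (1 + β - 2 * θ)) ≤ zeroCount ζ σ T := by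
    intro σ T h1 h2 h3
    refine le_trans ?_ (hcount σ T h1 h2 h3)
    have h4 : ((1 + β - 2 * σ) * (1 - ε) / (1 + β - 2 * θ))
        ≤ (1 + β - 2 * σ) * (1 - min ε (1 / 2)) / (1 + β - 2 * θ) := by
      refine div_le_div_of_nonneg_right (mul_le_mul_of_nonneg_left ?_ (by linarith)) (by linarith)
      linarith [min_le_left ε (1 / 2)]
    exact mul_le_mul_of_nonneg_left (Real.rpow_le_rpow_of_exponent_le (hT₀.trans h3) h4)
      (by norm_num)
  refine ⟨S, A, 1, 1 / 12, T₀, K, ζ, hA, one_pos, by norm_num, hζ, hne, fun T hT => ?_,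
    fun σ T h1 h2 h3 => hcount' σ T h1 h2.le h3, fun x hx => (hcnt x hx).trans ?_⟩
  · have := hcount' β T hθβ le_rfl hT
    rwa [show 1 + β - 2 * β = 1 - β by ring] at this
  · have hKx : 0 ≤ K * x ^ θ := (abs_nonneg _).trans (hcnt x hx)
    exact le_mul_of_one_le_right hKx (Real.one_le_exp (by positivity))
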